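/- arXiv:math/0208221 — 6 statements merged into one kernel-verified Lean document; each statement's English description precedes it below -/
import Mathlib

section
/- The topological Borsuk number of the Euclidean plane equals 3. Precisely: (a) for every metric d on ℝ² that induces the standard (Euclidean) topology, there exists a compact set F ⊆ ℝ² with positive d-diameter such that F cannot be written as a union of two sets each having d-diameter strictly smaller than the d-diameter of F; and (b) for the standard Euclidean metric, every compact set F ⊆ ℝ² with positive diameter can be written as a union of three closed sets each of diameter strictly smaller than the diameter of F. -/
/-- The `d`-diameter of a set `F`: the supremum of distances `d x y` over `x, y ∈ F`. -/
noncomputable def ddiam (d : EuclideanSpace ℝ (Fin 2) → EuclideanSpace ℝ (Fin 2) → ℝ)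
    (F : Set (EuclideanSpace ℝ (Fin 2))) : ℝ :=
  sSup {r : ℝ | ∃ x ∈ F, ∃ y ∈ F, d x y = r}

section BorsukAux
open Set Metric
local notation "𝔼" => EuclideanSpace ℝ (Fin 2)

lemma borsuk_part_diam (X Y : 𝔼 → ℝ) (N D : ℝ) (hD : 0 < D) (hN : N = D ^ 2)
    (hXY : ∀ z w, N * dist z w ^ 2 = (X z - X w) ^ 2 + (Y z - Y w) ^ 2)
    (S : Set 𝔼)
    (hS : ∀ z ∈ S, ∀ w ∈ S, (X z - X w) ^ 2 + (Y z - Y w) ^ 2 ≤ 0.9 * N ^ 2) :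
    Metric.diam S < D := by
  have hN0 : 0 < N := by rw [hN]; positivity
  have : Metric.diam S ≤ 0.95 * D := by
    apply Metric.diam_le_of_forall_dist_le (by positivity)
    intro z hz w hw
    have h1 := hS z hz w hw
    rw [← hXY] at h1
    have h2 : dist z w ^ 2 ≤ 0.9 * N := by
      have : N * dist z w ^ 2 ≤ N * (0.9 * N) := by nlinarith
      exact le_of_mul_le_mul_left this hN0
    rw [hN] at h2
    exact (abs_le_of_sq_le_sq' (a := dist z w) (b := 0.95 * D) (by nlinarith [sq_nonneg D]) (by positivity)).2
  linarith

lemma borsuk_core (F : Set 𝔼) (hF : IsCompact F) (X Y : 𝔼 → ℝ) (hX : Continuous X)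
    (hY : Continuous Y) (N D h : ℝ) (hD : 0 < D) (hN : N = D ^ 2)
    (hXY : ∀ z w, N * dist z w ^ 2 = (X z - X w) ^ 2 + (Y z - Y w) ^ 2)
    (h1 : ∀ z ∈ F, (X z + N / 2) ^ 2 + Y z ^ 2 ≤ N ^ 2)
    (h2 : ∀ z ∈ F, (X z - N / 2) ^ 2 + Y z ^ 2 ≤ N ^ 2)
    (hh : N / 2 ≤ h) (hu : ∀ z ∈ F, Y z ≤ h) (hl : ∀ z ∈ F, h - N ≤ Y z) :
    ∃ A B C : Set 𝔼, IsClosed A ∧ IsClosed B ∧ IsClosed C ∧ F = A ∪ B ∪ C ∧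
        Metric.diam A < D ∧ Metric.diam B < D ∧ Metric.diam C < D := by
  have hN0 : 0 < N := by rw [hN]; positivity
  have hx1 : ∀ z ∈ F, X z ≤ N / 2 := fun z hz => by
    have := abs_le_of_sq_le_sq' (a := X z + N / 2) (b := N) (by nlinarith [h1 z hz, sq_nonneg (Y z)]) hN0.le
    linarith [this.2]
  have hx2 : ∀ z ∈ F, -(N / 2) ≤ X z := fun z hz => by
    have := abs_le_of_sq_le_sq' (a := X z - N / 2) (b := N) (by nlinarith [h2 z hz, sq_nonneg (Y z)]) hN0.le
    linarith [this.1]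
  have sqb : ∀ a b c : ℝ, |a - b| ≤ c → (a - b) ^ 2 ≤ c ^ 2 := fun a b c hc => by
    have := abs_nonneg (a - b)
    rw [← sq_abs (a - b)]; gcongr
  refine ⟨F ∩ {z | h - 0.2 * N ≤ Y z}, F ∩ {z | Y z ≤ h - 0.2 * N ∧ X z ≤ 0},
    F ∩ {z | Y z ≤ h - 0.2 * N ∧ 0 ≤ X z}, ?_, ?_, ?_, ?_, ?_, ?_, ?_⟩
  · exact hF.isClosed.inter (isClosed_le continuous_const hY)
  · exact hF.isClosed.inter ((isClosed_le hY continuous_const).inter (isClosed_le hX continuous_const))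
  · exact hF.isClosed.inter ((isClosed_le hY continuous_const).inter (isClosed_le continuous_const hX))
  · ext z
    simp only [mem_union, mem_inter_iff, mem_ofPred_eq]
    have e1 := le_total (h - 0.2 * N) (Y z)
    have e2 := le_total (X z) 0
    tauto
  · refine borsuk_part_diam X Y N D hD hN hXY _ ?_
    have hb : ∀ z ∈ F ∩ {z | h - 0.2 * N ≤ Y z}, |X z| ≤ 0.455 * N := by
      rintro z ⟨hz, hz'⟩
      simp only [mem_ofPred_eq] at hz'
      have hy : (0.3 * N) ^ 2 ≤ Y z ^ 2 := by
        have : 0.3 * N ≤ Y z := by linarith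
        gcongr
      have a1 := abs_le_of_sq_le_sq' (a := X z + N / 2) (b := 0.955 * N) (by nlinarith [h1 z hz, sq_nonneg N]) (by positivity)
      have a2 := abs_le_of_sq_le_sq' (a := X z - N / 2) (b := 0.955 * N) (by nlinarith [h2 z hz, sq_nonneg N]) (by positivity)
      rw [abs_le]; constructor <;> linarith [a1.2, a2.1]
    intro z hz w hw
    have c1 := abs_le.1 (hb z hz)
    have c2 := abs_le.1 (hb w hw)
    have d1 := hu z hz.1
    have d2 := hu w hw.1
    have d3 : h - 0.2 * N ≤ Y z := hz.2
    have d4 : h - 0.2 * N ≤ Y w := hw.2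
    have := sqb (X z) (X w) (0.91 * N) (by rw [abs_le]; constructor <;> linarith)
    have := sqb (Y z) (Y w) (0.2 * N) (by rw [abs_le]; constructor <;> linarith)
    nlinarith [sq_nonneg N]
  all_goals
    refine borsuk_part_diam X Y N D hD hN hXY _ ?_
    rintro z ⟨hz, hz1, hz2⟩ w ⟨hw, hw1, hw2⟩
    have d1 := hl z hz
    have d2 := hl w hw
    have d3 := hx1 z hz
    have d4 := hx1 w hw
    have d5 := hx2 z hz
    have d6 := hx2 w hw
    have := sqb (X z) (X w) (0.5 * N) (by rw [abs_le]; constructor <;> linarith)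
    have := sqb (Y z) (Y w) (0.8 * N) (by rw [abs_le]; constructor <;> linarith)
    nlinarith [sq_nonneg N]

lemma borsuk_plane (F : Set 𝔼) (hF : IsCompact F) (hpos : 0 < Metric.diam F) :
    ∃ A B C : Set 𝔼, IsClosed A ∧ IsClosed B ∧ IsClosed C ∧ F = A ∪ B ∪ C ∧
        Metric.diam A < Metric.diam F ∧ Metric.diam B < Metric.diam F ∧
        Metric.diam C < Metric.diam F := by
  have hne : F.Nonempty := by
    rcases F.eq_empty_or_nonempty with h | h
    · simp [h] at hpos
    · exact h
  have hle : ∀ z ∈ F, ∀ w ∈ F, dist z w ≤ Metric.diam F := fun z hz w hw =>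
    Metric.dist_le_diam_of_mem hF.isBounded hz hw
  obtain ⟨⟨p, q⟩, ⟨hp, hq⟩, hmax⟩ := (hF.prod hF).exists_isMaxOn (hne.prod hne)
    (f := fun z : 𝔼 × 𝔼 => dist z.1 z.2) (by fun_prop)
  have hpq : dist p q = Metric.diam F := by
    apply le_antisymm (hle p hp q hq)
    exact Metric.diam_le_of_forall_dist_le dist_nonneg fun z hz w hw =>
      isMaxOn_iff.1 hmax (z, w) (Set.mk_mem_prod hz hw)
  generalize Metric.diam F = D at *
  have hds : ∀ z w : 𝔼, dist z w ^ 2 = (z 0 - w 0) ^ 2 + (z 1 - w 1) ^ 2 := by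
    intro z w
    rw [EuclideanSpace.dist_eq, Real.sq_sqrt (by positivity)]
    simp [Real.dist_eq, sq_abs]
  obtain ⟨N, hN⟩ : ∃ N, N = D ^ 2 := ⟨_, rfl⟩
  have hN0 : 0 < N := by rw [hN]; positivity
  have hab : (q 0 - p 0) ^ 2 + (q 1 - p 1) ^ 2 = N := by
    rw [hN, ← hpq, hds]; ring
  obtain ⟨a, ha⟩ : ∃ a, a = q 0 - p 0 := ⟨_, rfl⟩
  obtain ⟨b, hb⟩ : ∃ b, b = q 1 - p 1 := ⟨_, rfl⟩
  rw [← ha, ← hb] at hab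
  let X : 𝔼 → ℝ := fun z => a * (z 0 - p 0) + b * (z 1 - p 1) - N / 2
  let Y : 𝔼 → ℝ := fun z => -b * (z 0 - p 0) + a * (z 1 - p 1)
  have hX : Continuous X := by fun_prop
  have hY : Continuous Y := by fun_prop
  have hXY : ∀ z w, N * dist z w ^ 2 = (X z - X w) ^ 2 + (Y z - Y w) ^ 2 := by
    intro z w
    rw [hds, ← hab]; simp only [X, Y]; ring
  have hXp : X p = - (N / 2) := by simp [X]
  have hYp : Y p = 0 := by simp [Y]
  have hXq : X q = N / 2 := by simp only [X]; rw [← ha, ← hb]; linarith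
  have hYq : Y q = 0 := by simp only [Y]; rw [← ha, ← hb]; ring
  have hd2 : ∀ z ∈ F, ∀ w ∈ F, (X z - X w) ^ 2 + (Y z - Y w) ^ 2 ≤ N ^ 2 := by
    intro z hz w hw
    rw [← hXY, sq N]
    have : dist z w ^ 2 ≤ N := by
      rw [hN]; have := hle z hz w hw; gcongr
    gcongr
  have h1 : ∀ z ∈ F, (X z + N / 2) ^ 2 + Y z ^ 2 ≤ N ^ 2 := fun z hz => by
    have := hd2 z hz p hp
    rw [hXp, hYp] at this; simpa using this
  have h2 : ∀ z ∈ F, (X z - N / 2) ^ 2 + Y z ^ 2 ≤ N ^ 2 := fun z hz => by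
    have := hd2 z hz q hq
    rw [hXq, hYq] at this; simpa using this
  clear_value X Y
  obtain ⟨s, hs, hs'⟩ := hF.exists_isMaxOn hne hY.continuousOn
  obtain ⟨t, ht, ht'⟩ := hF.exists_isMinOn hne hY.continuousOn
  have hst : Y s - Y t ≤ N := by
    have := abs_le_of_sq_le_sq' (a := Y s - Y t) (b := N)
      (by nlinarith [hd2 s hs t ht, sq_nonneg (X s - X t)]) hN0.le
    exact this.2
  have hs2 : ∀ z ∈ F, Y z ≤ Y s := fun z hz => hs' hz
  have ht2 : ∀ z ∈ F, Y t ≤ Y z := fun z hz => ht' hz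
  rcases le_total 0 (Y s + Y t) with hc | hc
  · refine borsuk_core F hF X Y hX hY N D (max (Y s) (N / 2)) hpos hN hXY h1 h2 (le_max_right _ _)
      (fun z hz => (hs2 z hz).trans (le_max_left _ _)) fun z hz => ?_
    have := ht2 z hz
    rcases max_cases (Y s) (N / 2) with h | h <;> linarith
  · refine borsuk_core F hF X (fun z => - Y z) hX hY.neg N D (max (- Y t) (N / 2)) hpos hN
      (fun z w => by rw [hXY]; ring) (fun z hz => by simpa using h1 z hz)
      (fun z hz => by simpa using h2 z hz) (le_max_right _ _)
      (fun z hz => (neg_le_neg (ht2 z hz)).trans (le_max_left _ _)) fun z hz => ?_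
    have := hs2 z hz
    rcases max_cases (- Y t) (N / 2) with h | h <;> linarith


/-- `K` meets every continuum joining `E` to `Z`. -/
def BCuts (E Z K : Set 𝔼) : Prop :=
  ∀ S : Set 𝔼, IsCompact S → IsPreconnected S → (S ∩ E).Nonempty → (S ∩ Z).Nonempty →
    (S ∩ K).Nonempty

lemma int_valued_const {S : Set 𝔼} (hS : IsPreconnected S) {g : 𝔼 → ℝ} (hg : ContinuousOn g S)
    (hi : ∀ x ∈ S, ∃ n : ℤ, g x = n * (2 * Real.pi)) {x y : 𝔼} (hx : x ∈ S) (hy : y ∈ S) :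
    g x = g y := by
  have key : ∀ x ∈ S, ∀ y ∈ S, ¬ g x < g y := by
    intro x hx y hy h
    have hpi := Real.pi_pos
    obtain ⟨n, hn⟩ := hi x hx
    obtain ⟨m, hm⟩ := hi y hy
    have hnm : n < m := by
      rw [hn, hm] at h
      have := lt_of_mul_lt_mul_right h (by positivity)
      exact_mod_cast this
    have hnm' : (n : ℝ) + 1 ≤ m := by exact_mod_cast hnm
    have : g x + Real.pi ∈ Icc (g x) (g y) := by
      constructor
      · linarith
      · rw [hn, hm]; nlinarith
    obtain ⟨z, hz, hz'⟩ := hS.intermediate_value hx hy hg this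
    obtain ⟨k, hk⟩ := hi z hz
    rw [hk, hn] at hz'
    have : ((2 * k : ℤ) : ℝ) = ((2 * n + 1 : ℤ) : ℝ) := by
      push_cast
      have : Real.pi * (2 * k) = Real.pi * (2 * n + 1) := by linarith
      exact mul_left_cancel₀ hpi.ne' this
    have : (2 * k : ℤ) = 2 * n + 1 := by exact_mod_cast this
    omega
  exact le_antisymm (not_lt.1 (key y hy x hx)) (not_lt.1 (key x hx y hy))

lemma meets_frontier {S P : Set 𝔼} (hS : IsPreconnected S) (hP : IsClosed P)
    (h1 : (S ∩ P).Nonempty) (h2 : (S ∩ Pᶜ).Nonempty) : (S ∩ frontier P).Nonempty := by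
  have := isPreconnected_closed_iff.1 hS P (closure Pᶜ) hP isClosed_closure
    (fun x _ => by
      by_cases hx : x ∈ P
      · exact Or.inl hx
      · exact Or.inr (subset_closure hx)) h1
    (h2.mono (inter_subset_inter_right _ subset_closure))
  rwa [frontier_eq_closure_inter_closure, hP.closure_eq]

lemma cuts_of_union {E Z F A B : Set 𝔼} (hA : IsClosed A) (hB : IsClosed B)
    (hF : F = A ∪ B) (hE : IsPreconnected E) (hZ : IsPreconnected Z) {z0 : 𝔼} (hz0 : z0 ∈ Z)
    (hZF : ∀ z ∈ Z, z ∉ F) (hcut : BCuts E Z F)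
    (hfr : ∀ x ∈ frontier F, x ∈ A → x ∈ B → False) :
    BCuts E Z A ∨ BCuts E Z B := by
  have hFc : IsClosed F := by rw [hF]; exact hA.union hB
  obtain ⟨V, hVdef⟩ : ∃ V, V = connectedComponentIn Fᶜ z0 := ⟨_, rfl⟩
  have hVo : IsOpen V := by rw [hVdef]; exact hFc.isOpen_compl.connectedComponentIn
  have hVp : IsPreconnected V := by rw [hVdef]; exact isPreconnected_connectedComponentIn
  have hVF : V ⊆ Fᶜ := by rw [hVdef]; exact connectedComponentIn_subset _ _
  have hZV : Z ⊆ V := by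
    rw [hVdef]; exact hZ.subset_connectedComponentIn hz0 (fun z hz => hZF z hz)
  have hz0V : z0 ∈ V := hZV hz0
  have hEV : ∀ e ∈ E, e ∉ V := by
    intro e he heV
    have hpc : IsPathConnected V := hVo.isConnected_iff_isPathConnected.1 ⟨⟨z0, hz0V⟩, hVp⟩
    obtain ⟨γ, hγ⟩ := hpc.joinedIn e heV z0 hz0V
    obtain ⟨x, ⟨t, rfl⟩, hx⟩ := hcut (range γ) (isCompact_range γ.continuous)
      (isPreconnected_range γ.continuous) ⟨e, ⟨0, by simp⟩, he⟩ ⟨z0, ⟨1, by simp⟩, hz0⟩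
    exact hVF (hγ t) hx
  -- the frontier of `V`
  have hVfrF : frontier V ⊆ F := by
    intro x hx
    by_contra hxF
    have hxV : x ∉ V := fun h => (hVo.inter_frontier_eq.subset ⟨h, hx⟩)
    have ho : IsOpen (connectedComponentIn Fᶜ x) := hFc.isOpen_compl.connectedComponentIn
    have hxc : x ∈ closure V := hx.1
    obtain ⟨y, hy1, hy2⟩ := mem_closure_iff.1 hxc _ ho (mem_connectedComponentIn hxF)
    have e1 := connectedComponentIn_eq hy1
    rw [hVdef] at hy2
    have e2 := connectedComponentIn_eq hy2
    apply hxV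
    rw [hVdef, e2, ← e1]
    exact mem_connectedComponentIn hxF
  have hVfr : frontier V ⊆ frontier F := by
    intro x hx
    rw [frontier_eq_closure_inter_closure]
    exact ⟨subset_closure (hVfrF hx), closure_mono hVF hx.1⟩
  obtain ⟨u, hu0, hu1, -⟩ := exists_continuous_zero_one_of_isClosed
    (s := frontier V ∩ A) (t := frontier V ∩ B) (isClosed_frontier.inter hA)
    (isClosed_frontier.inter hB) (by
      rw [Set.disjoint_left]
      rintro x ⟨hx, hxA⟩ ⟨_, hxB⟩
      exact hfr x (hVfr hx) hxA hxB)
  have hAB : ∀ x ∈ frontier V, x ∈ A ∨ x ∈ B := fun x hx => by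
    have := hVfrF hx
    rwa [hF] at this
  classical
  let φ : C(𝔼, Circle) := ⟨fun x => if x ∈ V then Circle.exp (-(Real.pi * u x))
      else Circle.exp (Real.pi * u x), by
    refine Continuous.if ?_ (by fun_prop) (by fun_prop)
    intro x hx
    rcases hAB x hx with h | h
    · have : u x = 0 := hu0 ⟨hx, h⟩
      simp [this]
    · have : u x = 1 := hu1 ⟨hx, h⟩
      rw [this, Circle.exp_eq_exp]
      exact ⟨-1, by push_cast; ring⟩⟩
  obtain ⟨ψ, ⟨hψ0, hψ⟩, -⟩ := Circle.isCoveringMap_exp.existsUnique_continuousMap_lifts φ z0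
    (-(Real.pi * u z0)) (by simp [φ, hz0V])
  have hψ' : ∀ x, Circle.exp (ψ x) = φ x := fun x => congrFun hψ x
  have hin : ∀ x ∈ V, ψ x + Real.pi * u x = 0 := by
    intro x hx
    have := int_valued_const hVp (g := fun x => ψ x + Real.pi * u x) (by fun_prop) (fun x hx => by
      have h := hψ' x
      simp only [φ, ContinuousMap.coe_mk, if_pos hx] at h
      obtain ⟨m, hm⟩ := Circle.exp_eq_exp.1 h
      exact ⟨m, by rw [hm]; ring⟩) hx hz0V
    rw [this, hψ0]; ring
  have hcl : ∀ x ∈ closure V, ψ x + Real.pi * u x = 0 := by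
    have hc : IsClosed {x | ψ x + Real.pi * u x = 0} := isClosed_eq (by fun_prop) (by fun_prop)
    exact fun x hx => closure_minimal (fun y hy => hin y hy) hc hx
  have hout : ∀ x ∉ V, ∃ n : ℤ, ψ x - Real.pi * u x = n * (2 * Real.pi) := by
    intro x hx
    have h := hψ' x
    simp only [φ, ContinuousMap.coe_mk, if_neg hx] at h
    obtain ⟨m, hm⟩ := Circle.exp_eq_exp.1 h
    exact ⟨m, by rw [hm]; ring⟩
  have hpi := Real.pi_pos
  have hgc : Continuous fun x => ψ x - Real.pi * u x := by fun_prop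
  have hgA : ∀ x ∈ frontier V, x ∈ A → ψ x - Real.pi * u x = 0 := by
    intro x hx h
    have h0 : u x = 0 := hu0 ⟨hx, h⟩
    have := hcl x hx.1
    rw [h0] at this ⊢; linarith
  have hgB : ∀ x ∈ frontier V, x ∈ B → ψ x - Real.pi * u x = - (2 * Real.pi) := by
    intro x hx h
    have h0 : u x = 1 := hu1 ⟨hx, h⟩
    have := hcl x hx.1
    rw [h0] at this ⊢; linarith
  obtain ⟨g, hgdef⟩ : ∃ g : 𝔼 → ℝ, g = fun x => ψ x - Real.pi * u x := ⟨_, rfl⟩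
  have hg : Continuous g := by rw [hgdef]; exact hgc
  replace hout : ∀ x ∉ V, ∃ n : ℤ, g x = n * (2 * Real.pi) := by rw [hgdef]; exact hout
  replace hgA : ∀ x ∈ frontier V, x ∈ A → g x = 0 := by rw [hgdef]; exact hgA
  replace hgB : ∀ x ∈ frontier V, x ∈ B → g x = -(2 * Real.pi) := by rw [hgdef]; exact hgB
  clear hgc hgdef hcl hin hψ' hψ hψ0
  have hne : ∀ x ∉ V, g x ≠ - Real.pi := by
    intro x hx h
    obtain ⟨n, hn⟩ := hout x hx
    rw [h] at hn
    have : ((2 * n : ℤ) : ℝ) = ((-1 : ℤ) : ℝ) := by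
      push_cast
      have : Real.pi * (2 * n) = Real.pi * (-1) := by linarith
      exact mul_left_cancel₀ hpi.ne' this
    have : (2 * n : ℤ) = -1 := by exact_mod_cast this
    omega
  let P : Set 𝔼 := Vᶜ ∩ {x | - Real.pi ≤ g x}
  let Q : Set 𝔼 := Vᶜ ∩ {x | g x ≤ - Real.pi}
  have hPc : IsClosed P := hVo.isClosed_compl.inter (isClosed_le continuous_const hg)
  have hQc : IsClosed Q := hVo.isClosed_compl.inter (isClosed_le hg continuous_const)
  have hPQ : ∀ x, x ∉ V → x ∈ P ∨ x ∈ Q := fun x hx =>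
    (le_total (-Real.pi) (g x)).imp (fun h => ⟨hx, h⟩) (fun h => ⟨hx, h⟩)
  have hdis : ∀ x, x ∈ P → x ∈ Q → False := fun x h1 h2 =>
    hne x h1.1 (le_antisymm h2.2 h1.2)
  have hfrV : ∀ R T : Set 𝔼, IsClosed R → IsClosed T → R ⊆ Vᶜ → (∀ x, x ∉ V → x ∈ R ∨ x ∈ T) →
      (∀ x, x ∈ R → x ∈ T → False) → ∀ x ∈ frontier R, x ∈ frontier V := by
    intro R T hR hT hRV hRT hd x hx
    have hxR : x ∈ R := hR.frontier_subset hx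
    by_contra hn
    have hxV : x ∉ closure V := fun h => hn (by
      rw [frontier_eq_closure_inter_closure]
      exact ⟨h, subset_closure (hRV hxR)⟩)
    apply hx.2
    rw [mem_interior]
    refine ⟨(closure V)ᶜ ∩ Tᶜ, ?_, isClosed_closure.isOpen_compl.inter hT.isOpen_compl, hxV,
      fun h => hd x hxR h⟩
    rintro y ⟨hy1, hy2⟩
    exact (hRT y (fun h => hy1 (subset_closure h))).resolve_right hy2
  have hE' : E ⊆ P ∨ E ⊆ Q := by
    by_contra hcon
    simp only [not_or, Set.not_subset] at hcon
    obtain ⟨⟨a, haE, haP⟩, b, hbE, hbQ⟩ := hcon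
    obtain ⟨x, -, h1, h2⟩ := isPreconnected_closed_iff.1 hE P Q hPc hQc
      (fun x hx => hPQ x (hEV x hx))
      ⟨b, hbE, (hPQ b (hEV b hbE)).resolve_right hbQ⟩
      ⟨a, haE, (hPQ a (hEV a haE)).resolve_left haP⟩
    exact hdis x h1 h2
  rcases hE' with hEP | hEQ
  · left
    rintro S hS hSc ⟨e, heS, heE⟩ ⟨z, hzS, hzZ⟩
    obtain ⟨x, hxS, hx⟩ := meets_frontier hSc hPc ⟨e, heS, hEP heE⟩
      ⟨z, hzS, fun h => h.1 (hZV hzZ)⟩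
    have hxV := hfrV P Q hPc hQc inter_subset_left hPQ hdis x hx
    refine ⟨x, hxS, (hAB x hxV).resolve_right fun hxB => ?_⟩
    have h1 := hgB x hxV hxB
    have h2 : -Real.pi ≤ g x := (hPc.frontier_subset hx).2
    linarith
  · right
    rintro S hS hSc ⟨e, heS, heE⟩ ⟨z, hzS, hzZ⟩
    obtain ⟨x, hxS, hx⟩ := meets_frontier hSc hQc ⟨e, heS, hEQ heE⟩
      ⟨z, hzS, fun h => h.1 (hZV hzZ)⟩
    have hxV := hfrV Q P hQc hPc inter_subset_left (fun x hx => (hPQ x hx).symm)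
      (fun x h1 h2 => hdis x h2 h1) x hx
    refine ⟨x, hxS, (hAB x hxV).resolve_left fun hxA => ?_⟩
    have h1 := hgA x hxV hxA
    have h2 : g x ≤ -Real.pi := (hQc.frontier_subset hx).2
    linarith

/-- Limits of cutting sets along an ultrafilter. -/
lemma cuts_limit {E Z Ω : Set 𝔼} (hΩ : IsClosed Ω) {d : 𝔼 → 𝔼 → ℝ}
    (hd : Continuous fun p : 𝔼 × 𝔼 => d p.1 p.2) (K : ℕ → Set 𝔼) (c : ℕ → ℝ) (r : ℝ)
    (hc : Filter.Tendsto c Filter.atTop (nhds r)) (hKΩ : ∀ n, K n ⊆ Ω)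
    (hKd : ∀ n, ∀ x ∈ K n, ∀ y ∈ K n, d x y ≤ c n) (hKc : ∀ n, BCuts E Z (K n)) :
    ∃ L : Set 𝔼, L ⊆ Ω ∧ (∀ x ∈ L, ∀ y ∈ L, d x y ≤ r) ∧ BCuts E Z L := by
  let 𝒰 := Filter.hyperfilter ℕ
  have hcu : Filter.Tendsto c 𝒰 (nhds r) := hc.mono_left Nat.hyperfilter_le_atTop
  refine ⟨{x | ∀ U : Set 𝔼, IsOpen U → x ∈ U → ∀ᶠ n in (𝒰 : Filter ℕ), (K n ∩ U).Nonempty},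
    ?_, ?_, ?_⟩
  · intro x hx
    by_contra hxΩ
    obtain ⟨n, y, hy1, hy2⟩ := (hx Ωᶜ hΩ.isOpen_compl hxΩ).exists
    exact hy2 (hKΩ n hy1)
  · intro x hx y hy
    by_contra! hlt
    obtain ⟨s, hs1, hs2⟩ := exists_between hlt
    have ho : IsOpen {p : 𝔼 × 𝔼 | s < d p.1 p.2} := isOpen_lt continuous_const hd
    obtain ⟨U, W, hU, hW, hxU, hyW, hUW⟩ := isOpen_prod_iff.1 ho x y hs2
    obtain ⟨n, ⟨⟨a, ha1, ha2⟩, ⟨b, hb1, hb2⟩⟩, hn⟩ :=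
      (((hx U hU hxU).and (hy W hW hyW)).and (hcu.eventually (gt_mem_nhds hs1))).exists
    have h1 : s < d a b := hUW (Set.mk_mem_prod ha2 hb2)
    have h2 := hKd n a ha1 b hb1
    linarith
  · intro S hS hSc hSE hSZ
    by_contra hem
    have hpt : ∀ x ∈ S, ∃ U ∈ nhdsWithin x S, ∀ᶠ n in (𝒰 : Filter ℕ), ¬ (K n ∩ U).Nonempty := by
      intro x hx
      by_contra! hcon
      apply hem
      refine ⟨x, hx, fun U hU hxU => ?_⟩
      exact hcon U (mem_nhdsWithin_of_mem_nhds (hU.mem_nhds hxU))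
    have := hS.induction_on (p := fun T => ∀ᶠ n in (𝒰 : Filter ℕ), ¬ (K n ∩ T).Nonempty)
      (by simp) (fun s t hst ht => ht.mono fun n hn h =>
        hn (h.mono (inter_subset_inter_right _ hst)))
      (fun s t hs ht => (hs.and ht).mono fun n hn h => by
        rw [inter_union_distrib_left, union_nonempty] at h
        exact h.elim hn.1 hn.2) hpt
    obtain ⟨n, hn⟩ := this.exists
    apply hn
    rw [inter_comm]
    exact hKc n S hS hSc hSE hSZ

lemma lower_bound (d : 𝔼 → 𝔼 → ℝ) (hsymm : ∀ x y, d x y = d y x)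
    (hzero : ∀ x y, d x y = 0 ↔ x = y) (htri : ∀ x y z, d x z ≤ d x y + d y z)
    (htop : ∀ s : Set 𝔼, IsOpen s ↔ ∀ x ∈ s, ∃ ε > 0, {y | d x y < ε} ⊆ s) :
    ∃ F : Set 𝔼, IsCompact F ∧ 0 < ddiam d F ∧ ∀ A B : Set 𝔼, F = A ∪ B →
          ¬ (ddiam d A < ddiam d F ∧ ddiam d B < ddiam d F) := by
  have hself : ∀ x, d x x = 0 := fun x => (hzero x x).2 rfl
  have hnn : ∀ x y, 0 ≤ d x y := fun x y => by
    have := htri x y x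
    rw [hself, hsymm y x] at this; linarith
  have hball : ∀ x ε, IsOpen {y | d x y < ε} := by
    intro x ε
    rw [htop]
    intro y hy
    have hy' : d x y < ε := hy
    refine ⟨ε - d x y, by linarith, fun z hz => ?_⟩
    have hz' : d y z < ε - d x y := hz
    have := htri x y z
    show d x z < ε
    linarith
  have hcont : Continuous fun p : 𝔼 × 𝔼 => d p.1 p.2 := by
    rw [continuous_iff_continuousAt]
    rintro ⟨x, y⟩
    rw [ContinuousAt, Metric.tendsto_nhds]
    intro ε hε
    have h1 : {z | d x z < ε / 2} ∈ nhds x := (hball x _).mem_nhds (by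
      show d x x < _; rw [hself]; linarith)
    have h2 : {z | d y z < ε / 2} ∈ nhds y := (hball y _).mem_nhds (by
      show d y y < _; rw [hself]; linarith)
    filter_upwards [prod_mem_nhds h1 h2]
    rintro ⟨a, b⟩ ⟨ha, hb⟩
    have ha' : d x a < ε / 2 := ha
    have hb' : d y b < ε / 2 := hb
    rw [Real.dist_eq, abs_lt]
    have t1 := htri a x b
    have t2 := htri x y b
    have t3 := htri x a y
    have t4 := htri a b y
    rw [hsymm a x] at t1
    rw [hsymm b y] at t4
    constructor <;> simp only <;> linarith
  have hcontx : ∀ x, Continuous (d x) := fun x =>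
    hcont.comp (Continuous.prodMk continuous_const continuous_id)
  -- localisation constants
  obtain ⟨η, hη, hηb⟩ := (htop (ball 0 1)).1 isOpen_ball 0 (by simp)
  obtain ⟨e, he⟩ : ∃ e : 𝔼, ‖e‖ = 1 := ⟨EuclideanSpace.single 0 1, by simp⟩
  have he0 : e ≠ 0 := by rintro rfl; simp at he
  let C : Set (ℝ × ℝ) := (Icc 0 1 ×ˢ Icc 0 1) ∩ {p | η / 2 ≤ d 0 (p.1 • e)}
  have hCc : IsCompact C := (isCompact_Icc.prod isCompact_Icc).inter_right
    (isClosed_le continuous_const ((hcontx 0).comp (by fun_prop)))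
  obtain ⟨m, hm, hmC⟩ := hCc.exists_forall_le' (a := 0)
    (f := fun p : ℝ × ℝ => d (p.1 • e) ((-p.2) • e))
    (hcont.comp (g := fun p : 𝔼 × 𝔼 => d p.1 p.2)
      (f := fun p : ℝ × ℝ => (p.1 • e, (-p.2) • e)) (by fun_prop)).continuousOn (by
    rintro ⟨t, s⟩ ⟨⟨ht, hs⟩, hts⟩
    simp only [mem_ofPred_eq] at hts ht hs ⊢
    refine lt_of_le_of_ne (hnn _ _) fun h0 => ?_
    have h1 := (hzero _ _).1 h0.symm
    have h2 : t = -s := smul_left_injective ℝ he0 h1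
    have h3 : t = 0 := by linarith [ht.1, hs.1]
    rw [h3, zero_smul, hself] at hts
    linarith)
  obtain ⟨κ, hκ⟩ : ∃ κ, κ = min m (η / 2) / 3 := ⟨_, rfl⟩
  have hκ0 : 0 < κ := by rw [hκ]; positivity
  have hκm : 3 * κ ≤ m := by rw [hκ]; linarith [min_le_left m (η / 2)]
  have hκη : 3 * κ ≤ η / 2 := by rw [hκ]; linarith [min_le_right m (η / 2)]
  obtain ⟨ρ', hρ'0, hρ'⟩ := Metric.isOpen_iff.1 (hball 0 κ) 0 (by
    show d 0 0 < κ; rwa [hself])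
  obtain ⟨ρ, hρdef⟩ : ∃ ρ, ρ = min (ρ' / 2) 1 := ⟨_, rfl⟩
  have hρ0 : 0 < ρ := by rw [hρdef]; positivity
  have hρ1 : ρ ≤ 1 := by rw [hρdef]; exact min_le_right _ _
  have hρ2 : ρ < ρ' := by rw [hρdef]; linarith [min_le_left (ρ' / 2) 1]
  let E : Set 𝔼 := closedBall 0 ρ
  let Z : Set 𝔼 := sphere 0 1
  let Ω : Set 𝔼 := closedBall 0 1
  have hEd : ∀ x ∈ E, ∀ y ∈ E, d x y ≤ 2 * κ := by
    intro x hx y hy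
    have h1 : d 0 x < κ := hρ' (closedBall_subset_ball hρ2 hx)
    have h2 : d 0 y < κ := hρ' (closedBall_subset_ball hρ2 hy)
    have := htri x 0 y
    rw [hsymm x 0] at this; linarith
  -- cutting sets meet opposite rays
  have hray : ∀ K, BCuts E Z K → ∀ v : 𝔼, ‖v‖ = 1 → ∃ t ∈ Icc ρ 1, t • v ∈ K := by
    intro K hK v hv
    obtain ⟨x, ⟨t, ht, rfl⟩, hx⟩ := hK ((fun t : ℝ => t • v) '' Icc ρ 1)
      (isCompact_Icc.image (by fun_prop)) (isPreconnected_Icc.image _ (by fun_prop))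
      ⟨ρ • v, ⟨ρ, ⟨le_rfl, hρ1⟩, rfl⟩, by simp [E, norm_smul, hv, abs_of_pos hρ0]⟩
      ⟨v, ⟨1, ⟨hρ1, le_rfl⟩, by simp⟩, by simp [Z, hv]⟩
    exact ⟨t, ht, hx⟩
  have hloc : ∀ K, BCuts E Z K → (∀ x ∈ K, ∀ y ∈ K, d x y ≤ 2 * κ) → K ⊆ ball 0 1 := by
    intro K hK hKd
    obtain ⟨t, ht, htK⟩ := hray K hK e he
    obtain ⟨s, hs, hsK⟩ := hray K hK (-e) (by rw [norm_neg, he])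
    rw [smul_neg, ← neg_smul] at hsK
    have h1 : d 0 (t • e) < η / 2 := by
      by_contra! hcon
      have := hmC (t, s) ⟨⟨⟨hρ0.le.trans ht.1, ht.2⟩, ⟨hρ0.le.trans hs.1, hs.2⟩⟩, hcon⟩
      have h2 := hKd _ htK _ hsK
      simp only at this
      linarith
    intro x hx
    apply hηb
    show d 0 x < η
    have := htri 0 (t • e) x
    have := hKd _ htK _ hx
    linarith
  have hEcut : BCuts E Z E := fun S _ _ h _ => h
  -- the minimal diameter
  let 𝒞 : Set ℝ := {s | ∃ K ⊆ Ω, BCuts E Z K ∧ ∀ x ∈ K, ∀ y ∈ K, d x y ≤ s}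
  have h𝒞E : 2 * κ ∈ 𝒞 := ⟨E, closedBall_subset_closedBall hρ1, hEcut, hEd⟩
  have h𝒞b : BddBelow 𝒞 := by
    refine ⟨0, ?_⟩
    rintro s ⟨K, -, hK, hKd⟩
    obtain ⟨t, ht, htK⟩ := hray K hK e he
    exact (hnn _ _).trans (hKd _ htK _ htK)
  obtain ⟨r, hr⟩ : ∃ r, r = sInf 𝒞 := ⟨_, rfl⟩
  have hrle : ∀ s ∈ 𝒞, r ≤ s := fun s hs => by rw [hr]; exact csInf_le h𝒞b hs
  obtain ⟨c, -, hc, hc𝒞⟩ := exists_seq_tendsto_sInf ⟨_, h𝒞E⟩ h𝒞b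
  rw [← hr] at hc
  choose K hKΩ hKcut hKd using hc𝒞
  obtain ⟨L, hLΩ, hLd, hLcut⟩ := cuts_limit (isClosed_closedBall (x := (0 : 𝔼)) (ε := 1))
    hcont K c r hc hKΩ hKd hKcut
  -- a maximal set of diameter `r`
  obtain ⟨F, hLF, hFmax⟩ := zorn_subset_nonempty
    {F : Set 𝔼 | F ⊆ Ω ∧ ∀ x ∈ F, ∀ y ∈ F, d x y ≤ r} (by
      intro ch hch hchain hne
      refine ⟨⋃₀ ch, ⟨sUnion_subset fun s hs => (hch hs).1, ?_⟩, fun s hs => subset_sUnion_of_mem hs⟩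
      rintro x ⟨s, hs, hxs⟩ y ⟨t, ht, hyt⟩
      rcases hchain.total hs ht with h | h
      · exact (hch ht).2 x (h hxs) y hyt
      · exact (hch hs).2 x hxs y (h hyt)) L ⟨hLΩ, hLd⟩
  obtain ⟨hFΩ, hFd⟩ := hFmax.prop
  have hclos : ∀ (A : Set 𝔼) (s : ℝ), (∀ x ∈ A, ∀ y ∈ A, d x y ≤ s) →
      ∀ x ∈ closure A, ∀ y ∈ closure A, d x y ≤ s := by
    intro A s hA x hx y hy
    have hcl : IsClosed {p : 𝔼 × 𝔼 | d p.1 p.2 ≤ s} := isClosed_le hcont continuous_const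
    have hmem : (x, y) ∈ closure (A ×ˢ A) := by rw [closure_prod_eq]; exact ⟨hx, hy⟩
    exact closure_minimal (fun p hp => hA p.1 hp.1 p.2 hp.2) hcl hmem
  have hFcl : IsClosed F := by
    have h1 : closure F ⊆ F := hFmax.le_of_ge
      ⟨closure_minimal hFΩ isClosed_closedBall, hclos F r hFd⟩ subset_closure
    exact isClosed_of_closure_subset h1
  have hFc : IsCompact F := (isCompact_closedBall (0 : 𝔼) 1).of_isClosed_subset hFcl hFΩ
  have hFcut : BCuts E Z F := fun S h1 h2 h3 h4 =>
    (hLcut S h1 h2 h3 h4).mono (inter_subset_inter_right _ hLF)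
  have hFball : F ⊆ ball 0 1 := hloc F hFcut fun x hx y hy =>
    (hFd x hx y hy).trans (hrle _ h𝒞E)
  have hbdd : ∀ A ⊆ F, ∀ x ∈ A, ∀ y ∈ A, d x y ≤ ddiam d A := by
    intro A hA x hx y hy
    apply le_csSup
    · refine ⟨r, ?_⟩
      rintro s ⟨x, hx, y, hy, rfl⟩
      exact hFd x (hA hx) y (hA hy)
    · exact ⟨x, hx, y, hy, rfl⟩
  obtain ⟨t, ht, htF⟩ := hray F hFcut e he
  obtain ⟨s, hs, hsF⟩ := hray F hFcut (-e) (by rw [norm_neg, he])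
  rw [smul_neg, ← neg_smul] at hsF
  have hts : 0 < d (t • e) (-s • e) := by
    refine lt_of_le_of_ne (hnn _ _) fun h0 => ?_
    have h2 : t = -s := smul_left_injective ℝ he0 ((hzero _ _).1 h0.symm)
    linarith [ht.1, hs.1]
  have hr0 : 0 < r := hts.trans_le (hFd _ htF _ hsF)
  have hFr : ddiam d F = r := by
    apply le_antisymm
    · refine csSup_le ⟨d (t • e) (t • e), t • e, htF, t • e, htF, rfl⟩ ?_
      rintro s ⟨x, hx, y, hy, rfl⟩
      exact hFd x hx y hy
    · exact hrle _ ⟨F, hFΩ, hFcut, hbdd F subset_rfl⟩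
  refine ⟨F, hFc, by rw [hFr]; exact hr0, ?_⟩
  rintro A B hAB ⟨hA, hB⟩
  rw [hFr] at hA hB
  have hAF : A ⊆ F := by rw [hAB]; exact subset_union_left
  have hBF : B ⊆ F := by rw [hAB]; exact subset_union_right
  have hAF' : closure A ⊆ F := closure_minimal hAF hFcl
  have hBF' : closure B ⊆ F := closure_minimal hBF hFcl
  have hdA := hclos A _ (hbdd A hAF)
  have hdB := hclos B _ (hbdd B hBF)
  have hrank : 1 < Module.rank ℝ 𝔼 := by
    rw [← Module.finrank_eq_rank]; simp
  have hFun : F = closure A ∪ closure B := by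
    rw [← closure_union, ← hAB, hFcl.closure_eq]
  have hor := cuts_of_union (E := E) (Z := Z) (F := F) isClosed_closure isClosed_closure hFun
    (convex_closedBall (0 : 𝔼) ρ).isPreconnected (isPreconnected_sphere hrank 0 1)
    (z0 := e) (by simp [Z, he]) (fun z hz hzF => by
      have h1 : ‖z‖ = 1 := by simpa [Z] using hz
      have h2 : ‖z‖ < 1 := by simpa using hFball hzF
      linarith) hFcut (by
    intro x hx hxA hxB
    have hxF : x ∈ F := hFcl.frontier_subset hx
    -- all points of `F` are at distance `< r` from `x`
    have hlt : ∀ y ∈ F, d x y < r := by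
      intro y hy
      rw [hFun] at hy
      rcases hy with hy | hy
      · exact (hdA x hxA y hy).trans_lt hA
      · exact (hdB x hxB y hy).trans_lt hB
    obtain ⟨y0, hy0, hmax⟩ := hFc.exists_isMaxOn ⟨x, hxF⟩ (hcontx x).continuousOn
    have hmax' : ∀ y ∈ F, d x y ≤ d x y0 := isMaxOn_iff.1 hmax
    have hlt0 := hlt y0 hy0
    rw [frontier_eq_closure_inter_closure] at hx
    obtain ⟨z, ⟨hz1, hz2⟩, hzF⟩ := mem_closure_iff.1 hx.2 ({z | d x z < r - d x y0} ∩ ball 0 1)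
      ((hball _ _).inter isOpen_ball) ⟨by show d x x < _; rw [hself]; linarith, hFball hxF⟩
    have hz1' : d x z < r - d x y0 := hz1
    have hzy : ∀ y ∈ F, d z y ≤ r := by
      intro y hy
      have h1 := htri z x y
      rw [hsymm z x] at h1
      linarith [hmax' y hy]
    apply hzF
    refine hFmax.le_of_ge (y := insert z F) ⟨?_, ?_⟩ (subset_insert _ _) (mem_insert _ _)
    · exact insert_subset (ball_subset_closedBall hz2) hFΩ
    · rintro a (rfl | ha) b (rfl | hb)
      · rw [hself]; exact hr0.le
      · exact hzy b hb
      · rw [hsymm]; exact hzy a ha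
      · exact hFd a ha b hb)
  rcases hor with h | h
  · exact absurd (hrle _ ⟨closure A, hAF'.trans hFΩ, h, hdA⟩) (not_le.2 hA)
  · exact absurd (hrle _ ⟨closure B, hBF'.trans hFΩ, h, hdB⟩) (not_le.2 hB)

end BorsukAux

/-- The topological Borsuk number of the Euclidean plane equals 3. -/
theorem topological_borsuk_number_of_plane_eq_three :
    -- (a) for every metric inducing the standard topology, some compact set of positive
    -- diameter cannot be split into two parts of smaller diameter
    (∀ d : EuclideanSpace ℝ (Fin 2) → EuclideanSpace ℝ (Fin 2) → ℝ,
      (∀ x y, d x y = d y x) →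
      (∀ x y, d x y = 0 ↔ x = y) →
      (∀ x y z, d x z ≤ d x y + d y z) →
      (∀ s : Set (EuclideanSpace ℝ (Fin 2)),
        IsOpen s ↔ ∀ x ∈ s, ∃ ε > 0, {y | d x y < ε} ⊆ s) →
      ∃ F : Set (EuclideanSpace ℝ (Fin 2)), IsCompact F ∧ 0 < ddiam d F ∧
        ∀ A B : Set (EuclideanSpace ℝ (Fin 2)), F = A ∪ B →
          ¬ (ddiam d A < ddiam d F ∧ ddiam d B < ddiam d F))
    ∧
    -- (b) for the Euclidean metric, every compact set of positive diameter is the union of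
    -- three closed sets of strictly smaller diameter
    (∀ F : Set (EuclideanSpace ℝ (Fin 2)), IsCompact F → 0 < Metric.diam F →
      ∃ A B C : Set (EuclideanSpace ℝ (Fin 2)),
        IsClosed A ∧ IsClosed B ∧ IsClosed C ∧ F = A ∪ B ∪ C ∧
        Metric.diam A < Metric.diam F ∧ Metric.diam B < Metric.diam F ∧
        Metric.diam C < Metric.diam F) := by
  exact ⟨fun d h1 h2 h3 h4 => lower_bound d h1 h2 h3 h4, fun F hF hpos => borsuk_plane F hF hpos⟩
end

section
/- For every metric d on ℝ² that induces the standard (Euclidean) topology, there exist a real number c > 0 and three pairwise distinct points x₁, x₂, x₃ ∈ ℝ² such that d(x₁,x₂) = d(x₂,x₃) = d(x₁,x₃) = c. -/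
/-- A continuous function with constant exponential on a connected space is constant. -/
theorem aux_const {A : Type*} [TopologicalSpace A] [PreconnectedSpace A] (g : A → ℂ)
    (hg : Continuous g) (c : ℂ) (h : ∀ a, Complex.exp (g a) = c) (a b : A) : g a = g b := by
  refine Complex.isCoveringMap_exp.const_of_comp hg ?_ a b
  intro a b
  simp [h]

/-- Continuous logarithm on the plane. -/
theorem aux_log (H : ℝ × ℝ → ℂ) (hH : Continuous H) (h0 : ∀ p, H p ≠ 0) :
    ∃ L : ℝ × ℝ → ℂ, Continuous L ∧ ∀ p, Complex.exp (L p) = H p := by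
  obtain ⟨L, ⟨-, hL⟩, -⟩ := Complex.isCoveringMapOn_exp.existsUnique_continuousMap_lifts
    (f := (⟨H, hH⟩ : C(ℝ × ℝ, ℂ))) (a₀ := (0, 0)) (e₀ := Complex.log (H (0, 0)))
    (by simp [Complex.exp_log (h0 _)]) (by intro p; simpa using h0 p)
  exact ⟨L, L.continuous, fun p => congrFun hL p⟩

theorem aux_main (D : ℂ → ℂ → ℝ) (hD : Continuous fun p : ℂ × ℂ => D p.1 p.2) :
    ∃ z₁ z₂ z₃ : ℂ, z₁ ≠ z₂ ∧ z₂ ≠ z₃ ∧ z₁ ≠ z₃ ∧ D z₁ z₂ = D z₂ z₃ ∧ D z₂ z₃ = D z₃ z₁ := by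
  by_contra! hcon
  set w : ℂ := Complex.exp (((2 * Real.pi / 3 : ℝ) : ℂ) * Complex.I) with hw
  have hwim : w.im ≠ 0 := by
    rw [hw, Complex.exp_ofReal_mul_I_im]
    exact (Real.sin_pos_of_pos_of_lt_pi (by positivity) (by linarith [Real.pi_pos])).ne'
  have hw1 : w ≠ 1 := by
    intro h; apply hwim; rw [h]; simp
  have hw0 : w ≠ 0 := Complex.exp_ne_zero _
  have hw3 : w ^ 3 = 1 := by
    rw [hw, ← Complex.exp_nat_mul, ← Complex.exp_two_pi_mul_I]
    congr 1
    push_cast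
    ring
  have hw2 : w ^ 2 = -1 - w := by
    have : (w - 1) * (w ^ 2 + w + 1) = 0 := by linear_combination hw3
    rcases mul_eq_zero.1 this with h | h
    · exact absurd (sub_eq_zero.1 h) hw1
    · linear_combination h
  let F : ℂ → ℂ → ℂ → ℂ := fun x y z => D x y + w * D y z + w ^ 2 * D z x
  have hF : ∀ x y z, x ≠ y → y ≠ z → x ≠ z → F x y z ≠ 0 := by
    intro x y z h1 h2 h3 h
    have h' : (D x y : ℂ) + w * D y z + w ^ 2 * D z x = 0 := h
    rw [hw2] at h'
    have him := congrArg Complex.im h'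
    have hre := congrArg Complex.re h'
    simp at him hre
    have e1 : D y z = D z x := by
      have : w.im * (D y z - D z x) = 0 := by linarith
      rcases mul_eq_zero.1 this with h | h
      · exact absurd h hwim
      · linarith
    rw [e1] at hre
    exact hcon x y z h1 h2 h3 (by rw [e1]; linarith) e1
  have hF1 : ∀ x y z, F y z x = w ^ 2 * F x y z := by
    intro x y z
    simp only [F]
    linear_combination (-(D y z : ℂ) - w * D z x) * hw3
  have hF2 : ∀ x y z, F z x y = w * F x y z := by
    intro x y z
    simp only [F]
    linear_combination (-(D z x : ℂ)) * hw3
  set v : ℂ := (w - w ^ 2) / 2 with hv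
  have hv2 : v ^ 2 = -3 / 4 := by
    rw [hv]; linear_combination (w - 2) / 4 * hw3 + hw2 / 4
  have hv0 : v ≠ 0 := by
    intro h; rw [h] at hv2; norm_num at hv2
  let u : ℝ → ℂ := fun s => Complex.exp (s * Complex.I)
  have hu : ∀ s, ‖u s‖ = 1 := fun s => Complex.norm_exp_ofReal_mul_I s
  have hu0 : ∀ s, u s ≠ 0 := fun s => Complex.exp_ne_zero _
  have huc : Continuous u := by fun_prop
  have huadd : ∀ s t, u (s + t) = u s * u t := by
    intro s t
    simp only [u]
    rw [← Complex.exp_add]; push_cast; ring_nf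
  have hu00 : u 0 = 1 := by simp [u]
  have hupi : u Real.pi = -1 := by simp [u]
  have huw : u (2 * Real.pi / 3) = w := rfl
  have hne : ∀ s, (u s * v) ^ 2 ≠ 9 / 4 := by
    intro s h
    have h3 : u s ^ 2 = -3 := by
      rw [mul_pow, hv2] at h; linear_combination (-4 / 3) * h
    have := congrArg norm h3
    rw [norm_pow, hu] at this
    norm_num at this
  let H : ℝ × ℝ → ℂ := fun p =>
    F (u p.2) (u p.2 * (-1 / 2 + u p.1 * v)) (u p.2 * (-1 / 2 - u p.1 * v))
  have hHc : Continuous H := by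
    have key : ∀ f g : ℝ × ℝ → ℂ, Continuous f → Continuous g →
        Continuous fun p => (D (f p) (g p) : ℂ) := fun f g hf hg =>
      Complex.continuous_ofReal.comp (hD.comp (hf.prodMk hg))
    have c1 : Continuous fun p : ℝ × ℝ => u p.2 := by fun_prop
    have c2 : Continuous fun p : ℝ × ℝ => u p.2 * (-1 / 2 + u p.1 * v) := by fun_prop
    have c3 : Continuous fun p : ℝ × ℝ => u p.2 * (-1 / 2 - u p.1 * v) := by fun_prop
    exact ((key _ _ c1 c2).add (continuous_const.mul (key _ _ c2 c3))).add
      (continuous_const.mul (key _ _ c3 c1))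
  have hH0 : ∀ p, H p ≠ 0 := by
    rintro ⟨s, t⟩
    apply hF
    · intro h
      have h' : u t * 1 = u t * (-1 / 2 + u s * v) := by simpa using h
      have := mul_left_cancel₀ (hu0 t) h'
      apply hne s
      have h3 : u s * v = 3 / 2 := by linear_combination -this
      rw [h3]; norm_num
    · intro h
      have := mul_left_cancel₀ (hu0 t) h
      have h3 : u s * v = 0 := by linear_combination this / 2
      exact mul_ne_zero (hu0 s) hv0 h3
    · intro h
      have h' : u t * 1 = u t * (-1 / 2 - u s * v) := by simpa using h
      have := mul_left_cancel₀ (hu0 t) h'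
      apply hne s
      have h3 : u s * v = -3 / 2 := by linear_combination this
      rw [h3]; norm_num
  obtain ⟨L, hLc, hL⟩ := aux_log H hHc hH0
  set τ : ℝ := 2 * Real.pi / 3 with hτ
  have hw_a : -1 / 2 + v = w := by rw [hv]; linear_combination -hw2 / 2
  have hw_b : -1 / 2 - v = w ^ 2 := by rw [hv]; linear_combination -hw2 / 2
  have hH_a : ∀ t, H (0, t + τ) = w ^ 2 * H (0, t) := by
    intro t
    simp only [H, hu00, one_mul, hw_a, hw_b, huadd, huw]
    rw [← hF1]
    congr 1
    · ring
    · linear_combination u t * hw3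
  have hH_b : ∀ t, H (Real.pi, t + τ) = w * H (Real.pi, t) := by
    intro t
    have ea : -1 / 2 + -1 * v = w ^ 2 := by rw [← hw_b]; ring
    have eb : -1 / 2 - -1 * v = w := by rw [← hw_a]; ring
    simp only [H, hupi, ea, eb, huadd, huw]
    rw [← hF2]
    congr 1
    · linear_combination u t * hw3
    · ring
  have hH_p : ∀ s t, H (s, t + τ + τ + τ) = H (s, t) := by
    intro s t
    have : u (t + τ + τ + τ) = u t := by
      simp only [huadd, huw]; linear_combination u t * hw3
    simp only [H, this]
  have ca : ∀ t, L (0, t + τ) - L (0, t) = L (0, 0 + τ) - L (0, 0) := fun t =>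
    aux_const (fun t : ℝ => L (0, t + τ) - L (0, t)) (by fun_prop) (w ^ 2)
      (fun t => by rw [Complex.exp_sub, hL, hL, hH_a, mul_div_cancel_right₀ _ (hH0 _)]) t 0
  have cb : ∀ t, L (Real.pi, t + τ) - L (Real.pi, t) = L (Real.pi, 0 + τ) - L (Real.pi, 0) :=
    fun t =>
    aux_const (fun t : ℝ => L (Real.pi, t + τ) - L (Real.pi, t)) (by fun_prop) w
      (fun t => by rw [Complex.exp_sub, hL, hL, hH_b, mul_div_cancel_right₀ _ (hH0 _)]) t 0
  have cp : L (0, 0 + τ + τ + τ) - L (0, 0) =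
      L (Real.pi, 0 + τ + τ + τ) - L (Real.pi, 0) :=
    aux_const (fun s : ℝ => L (s, 0 + τ + τ + τ) - L (s, 0)) (by fun_prop) 1
      (fun s => by rw [Complex.exp_sub, hL, hL, hH_p, div_self (hH0 _)]) 0 Real.pi
  have hab : L (0, 0 + τ) - L (0, 0) = L (Real.pi, 0 + τ) - L (Real.pi, 0) := by
    linear_combination cp / 3 - (ca (0 + τ) + ca (0 + τ + τ)) / 3
      + (cb (0 + τ) + cb (0 + τ + τ)) / 3
  have := congrArg Complex.exp hab
  rw [Complex.exp_sub, Complex.exp_sub, hL, hL, hL, hL, hH_a, hH_b,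
    mul_div_cancel_right₀ _ (hH0 _), mul_div_cancel_right₀ _ (hH0 _)] at this
  apply hw1
  apply mul_left_cancel₀ hw0
  rw [← sq, this, mul_one]

/-- For every metric on the plane inducing the standard topology, there exist three
pairwise distinct points that are mutually equidistant at some common distance `c > 0`. -/
theorem exists_equilateral_triple_of_equivalent_metric
    (d : EuclideanSpace ℝ (Fin 2) → EuclideanSpace ℝ (Fin 2) → ℝ)
    (hsymm : ∀ x y, d x y = d y x)
    (hzero : ∀ x y, d x y = 0 ↔ x = y)
    (htri : ∀ x y z, d x z ≤ d x y + d y z)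
    (htop : ∀ s : Set (EuclideanSpace ℝ (Fin 2)),
      IsOpen s ↔ ∀ x ∈ s, ∃ ε > 0, {y | d x y < ε} ⊆ s) :
    ∃ c > 0, ∃ x₁ x₂ x₃ : EuclideanSpace ℝ (Fin 2),
      x₁ ≠ x₂ ∧ x₂ ≠ x₃ ∧ x₁ ≠ x₃ ∧
      d x₁ x₂ = c ∧ d x₂ x₃ = c ∧ d x₁ x₃ = c := by
  have hself : ∀ x, d x x = 0 := fun x => (hzero x x).2 rfl
  have hball : ∀ x (r : ℝ), 0 < r → ∀ᶠ y in nhds x, d x y < r := by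
    intro x r hr
    have ho : IsOpen {y | d x y < r} := by
      rw [htop]
      intro y hy
      refine ⟨r - d x y, sub_pos.2 hy, fun z hz => ?_⟩
      have h1 : d y z < r - d x y := hz
      have h2 := htri x y z
      show d x z < r
      linarith
    exact ho.mem_nhds (by simpa [hself] using hr)
  have hdc : Continuous fun p : EuclideanSpace ℝ (Fin 2) × EuclideanSpace ℝ (Fin 2) =>
      d p.1 p.2 := by
    rw [continuous_iff_continuousAt]
    rintro ⟨x, y⟩
    rw [ContinuousAt, Metric.tendsto_nhds]
    intro r hr
    rw [nhds_prod_eq]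
    filter_upwards [(hball x (r / 2) (by linarith)).prod_mk (hball y (r / 2) (by linarith))]
    rintro ⟨a, b⟩ ⟨h1, h2⟩
    simp only at h1 h2 ⊢
    rw [Real.dist_eq, abs_lt]
    have t1 := htri a x b
    have t2 := htri x y b
    have t3 := htri x a y
    have t4 := htri a b y
    have s1 := hsymm a x
    have s2 := hsymm b y
    constructor <;> linarith
  let e := Complex.orthonormalBasisOneI.repr
  obtain ⟨z₁, z₂, z₃, h12, h23, h13, e1, e2⟩ := aux_main (fun z w => d (e z) (e w))
    (hdc.comp ((e.continuous.comp continuous_fst).prodMk (e.continuous.comp continuous_snd)))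
  have hne := e.injective.ne h12
  refine ⟨d (e z₁) (e z₂), ?_, e z₁, e z₂, e z₃, hne, e.injective.ne h23,
    e.injective.ne h13, rfl, e1.symm, ?_⟩
  · have h0 : d (e z₁) (e z₂) ≠ 0 := fun h => hne ((hzero _ _).1 h)
    have h1 := htri (e z₁) (e z₂) (e z₁)
    rw [hself, hsymm (e z₂) (e z₁)] at h1
    exact lt_of_le_of_ne (by linarith) h0.symm
  · rw [hsymm (e z₁) (e z₃), e1]
    exact e2.symm
end

section
/- Let p be a prime number and let n > m ≥ 1 be integers. There is no continuous map f from the unit sphere S^{2n-1} = { z ∈ ℂⁿ : ‖z‖ = 1 } to the unit sphere S^{2m-1} = { w ∈ ℂᵐ : ‖w‖ = 1 } satisfying f(ω·z) = ω·f(z) for all z, where ω = exp(2πi/p) and ω·z denotes coordinatewise multiplication by ω. -/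
open Complex

namespace ZpBU

/-- Coboundary of a cochain `x` (a function on lists), evaluated on a list. -/
def dl {X R : Type*} [CommRing R] : List X → (List X → R) → R
  | [], _ => 0
  | v :: l, x => x l - dl l (fun m => x (v :: m))

/-- Prism operator between two maps `a`, `b`. -/
def prism {X Y R : Type*} [CommRing R] (a b : X → Y) : List X → (List Y → R) → R
  | [], _ => 0
  | v :: l, x => x (a v :: b v :: l.map b) - prism a b l (fun m => x (a v :: m))

section alg
variable {X Y R : Type*} [CommRing R]

lemma dl_sub (l : List X) : ∀ x y : List X → R,
    dl l (fun m => x m - y m) = dl l x - dl l y := by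
  induction l with
  | nil => intro x y; simp [dl]
  | cons v l ih => intro x y; simp only [dl]; rw [ih]; ring

lemma dl_zero (l : List X) : dl l (fun _ => (0 : R)) = 0 := by
  induction l with
  | nil => simp [dl]
  | cons v l ih => simp only [dl]; rw [ih]; ring

lemma dl_neg (l : List X) (x : List X → R) : dl l (fun m => - x m) = - dl l x := by
  have := dl_sub l (fun _ => (0 : R)) x
  simpa [dl_zero] using this

lemma dl_add (l : List X) (x y : List X → R) :
    dl l (fun m => x m + y m) = dl l x + dl l y := by
  have := dl_sub l x (fun m => - y m)
  simpa [dl_neg] using this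

lemma dl_sum (l : List X) (n : ℕ) (x : ℕ → List X → R) :
    dl l (fun m => ∑ j ∈ Finset.range n, x j m) = ∑ j ∈ Finset.range n, dl l (x j) := by
  induction n with
  | zero => simp [dl_zero]
  | succ n ih => simp only [Finset.sum_range_succ]; rw [dl_add, ih]

lemma dl_map (f : X → Y) (l : List X) : ∀ x : List Y → R,
    dl l (fun m => x (m.map f)) = dl (l.map f) x := by
  induction l with
  | nil => intro x; simp [dl]
  | cons v l ih =>
    intro x
    simp only [dl, List.map_cons]
    rw [← ih (fun m => x (f v :: m))]

lemma dl_dl (l : List X) : ∀ x : List X → R, dl l (fun m => dl m x) = 0 := by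
  induction l with
  | nil => intro x; simp [dl]
  | cons v l ih =>
    intro x
    simp only [dl]
    rw [dl_sub, ih]; ring

lemma dl_congr (l : List X) : ∀ x y : List X → R, (∀ m, m.Sublist l → x m = y m) →
    dl l x = dl l y := by
  induction l with
  | nil => intro x y _; simp [dl]
  | cons v l ih =>
    intro x y h
    simp only [dl]
    rw [h l (List.sublist_cons_self v l), ih _ (fun m => y (v :: m))]
    intro m hm
    exact h _ (hm.cons_cons v)

lemma dl_len (l : List X) : ∀ (x : List X → R) , (∀ m : List X, m.length + 1 = l.length → x m = 0) →
    dl l x = 0 := by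
  induction l with
  | nil => intro x _; simp [dl]
  | cons v l ih =>
    intro x h
    simp only [dl]
    rw [h l (by simp), ih]
    · simp
    · intro m hm
      exact h _ (by simp [hm])

lemma prism_sub (a b : X → Y) (l : List X) : ∀ x y : List Y → R,
    prism a b l (fun m => x m - y m) = prism a b l x - prism a b l y := by
  induction l with
  | nil => intro x y; simp [prism]
  | cons v l ih => intro x y; simp only [prism]; rw [ih]; ring

lemma prism_zero (a b : X → Y) (l : List X) : ∀ x : List Y → R,
    (∀ m, (∀ u ∈ m, ∃ v ∈ l, u = a v ∨ u = b v) → x m = 0) → prism a b l x = 0 := by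
  induction l with
  | nil => intro x _; simp [prism]
  | cons v l ih =>
    intro x h
    simp only [prism]
    rw [h, ih]
    · simp
    · intro m hm
      apply h
      intro u hu
      rcases List.mem_cons.1 hu with rfl | hu
      · exact ⟨v, by simp, Or.inl rfl⟩
      · obtain ⟨w, hw, hw2⟩ := hm u hu
        exact ⟨w, by simp [hw], hw2⟩
    · intro u hu
      simp only [List.mem_cons, List.mem_map] at hu
      rcases hu with rfl | rfl | ⟨w, hw, rfl⟩
      · exact ⟨v, by simp, Or.inl rfl⟩
      · exact ⟨v, by simp, Or.inr rfl⟩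
      · exact ⟨w, by simp [hw], Or.inr rfl⟩

lemma prism_homotopy (a b : X → Y) (l : List X) : ∀ x : List Y → R,
    prism a b l (fun m => dl m x) + dl l (fun m => prism a b m x)
      = x (l.map b) - x (l.map a) := by
  induction l with
  | nil => intro x; simp [prism, dl]
  | cons v l ih =>
    intro x
    have h := ih (fun m => x (a v :: m))
    simp only [prism, dl, List.map_cons]
    rw [prism_sub, dl_sub, dl_map b l (fun m => x (a v :: b v :: m))]
    linear_combination h

/-- Alternating cochains. -/
def Alt (x : List X → R) : Prop :=
  (∀ l₁ a b l₂, x (l₁ ++ a :: b :: l₂) = - x (l₁ ++ b :: a :: l₂)) ∧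
  (∀ l₁ a l₂, x (l₁ ++ a :: a :: l₂) = 0)

lemma Alt.cons {x : List X → R} (h : Alt x) (c : X) : Alt (fun m => x (c :: m)) :=
  ⟨fun l₁ a b l₂ => h.1 (c :: l₁) a b l₂, fun l₁ a l₂ => h.2 (c :: l₁) a l₂⟩

lemma Alt.dl {x : List X → R} (h : Alt x) : Alt (fun l => dl l x) := by
  constructor
  · intro l₁ a b l₂
    induction l₁ generalizing x with
    | nil =>
      simp only [List.nil_append, ZpBU.dl]
      have : (fun m => x (a :: b :: m)) = fun m => - x (b :: a :: m) := by
        funext m; exact h.1 [] a b m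
      rw [this, dl_neg]; ring
    | cons c l₁ ih =>
      simp only [List.cons_append, ZpBU.dl]
      have h3 := ih (h.cons c)
      simp only at h3
      rw [h3, h.1]; ring
  · intro l₁ a l₂
    induction l₁ generalizing x with
    | nil =>
      simp only [List.nil_append, ZpBU.dl]
      have : (fun m => x (a :: a :: m)) = fun m => 0 := by
        funext m; exact h.2 [] a m
      rw [this, dl_zero]; ring
    | cons c l₁ ih =>
      simp only [List.cons_append, ZpBU.dl]
      have h3 := ih (h.cons c)
      simp only at h3
      rw [h3, h.2]; ring

lemma Alt.perm {l l' : List X} (hl : l.Perm l') : ∀ {x : List X → R}, Alt x →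
    x l = 0 → x l' = 0 := by
  induction hl with
  | nil => intro x _ h; exact h
  | cons c _ ih => intro x hx h; exact ih (hx.cons c) h
  | swap a b l =>
    intro x hx h
    have := hx.1 [] a b l
    simp only [List.nil_append] at this
    rw [this, h, neg_zero]
  | trans _ _ ih1 ih2 => intro x hx h; exact ih2 hx (ih1 hx h)

lemma Alt.dup {l : List X} {x : List X → R} (hx : Alt x) (hl : ¬ l.Nodup) : x l = 0 := by
  classical
  obtain ⟨a, ha⟩ := List.exists_duplicate_iff_not_nodup.2 hl
  have h2 : [a, a].Sublist l := List.duplicate_iff_sublist.1 ha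
  obtain ⟨t, ht⟩ := h2.exists_perm_append
  exact Alt.perm ht.symm hx (hx.2 [] a t)

lemma Alt.map {x : List Y → R} (h : Alt x) (f : X → Y) : Alt (fun m => x (m.map f)) := by
  constructor
  · intro l₁ a b l₂
    simpa using h.1 (l₁.map f) (f a) (f b) (l₂.map f)
  · intro l₁ a l₂
    simpa using h.2 (l₁.map f) (f a) (l₂.map f)

/-- The norm (for `k` even) or `1 - τ` (for `k` odd) acting on cochains. -/
def opA (p : ℕ) (τ : X → X) (k : ℕ) (x : List X → R) (l : List X) : R :=
  if Even k then ∑ j ∈ Finset.range p, x (l.map (τ^[j])) else x l - x (l.map τ)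

lemma dl_opA (p : ℕ) (τ : X → X) (k : ℕ) (x : List X → R) (l : List X) :
    dl l (opA p τ k x) = opA p τ k (fun m => dl m x) l := by
  by_cases hk : Even k
  · have : opA p τ k x = fun l => ∑ j ∈ Finset.range p, x (l.map (τ^[j])) := by
      funext l; simp [opA, hk]
    rw [this, dl_sum]
    simp only [opA, hk, if_true]
    exact Finset.sum_congr rfl fun j _ => dl_map _ _ _
  · have : opA p τ k x = fun l => x l - x (l.map τ) := by
      funext l; simp [opA, hk]
    rw [this, dl_sub, dl_map]
    simp [opA, hk]

lemma tele (p : ℕ) (τ : X → X) (x : List X → R) (l : List X) (hl : l.map (τ^[p]) = l) :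
    ∑ j ∈ Finset.range p, x (l.map (τ^[j])) - ∑ j ∈ Finset.range p, x ((l.map (τ^[j])).map τ) = 0 := by
  have : ∀ j, (l.map (τ^[j])).map τ = l.map (τ^[j+1]) := by
    intro j
    rw [List.map_map, Function.iterate_succ']
  simp only [this]
  have h := Finset.sum_range_sub (fun j => x (l.map (τ^[j]))) p
  simp only [Finset.sum_sub_distrib, hl, Function.iterate_zero, List.map_id] at h
  linear_combination -h

lemma opA_opA (p : ℕ) (τ : X → X) (k : ℕ) (x : List X → R) (l : List X)
    (hl : l.map (τ^[p]) = l) : opA p τ k (opA p τ (k+1) x) l = 0 := by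
  by_cases hk : Even k
  · have hk' : ¬ Even (k+1) := by simpa [Nat.even_add_one] using hk
    simp only [opA, hk, hk', if_true, if_false]
    rw [Finset.sum_sub_distrib]
    exact tele p τ x l hl
  · have hk' : Even (k+1) := by simpa [Nat.even_add_one] using hk
    simp only [opA, hk, hk', if_true, if_false]
    rw [← tele p τ x l hl]
    congr 1
    apply Finset.sum_congr rfl
    intro j _
    rw [List.map_map, List.map_map, ← Function.iterate_succ, Function.iterate_succ']

lemma opA_sub (p : ℕ) (τ : X → X) (k : ℕ) (x y : List X → R) (l : List X) :
    opA p τ k (fun m => x m - y m) l = opA p τ k x l - opA p τ k y l := by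
  unfold opA
  split_ifs
  · rw [Finset.sum_sub_distrib]
  · ring

lemma opA_add (p : ℕ) (τ : X → X) (k : ℕ) (x y : List X → R) (l : List X) :
    opA p τ k (fun m => x m + y m) l = opA p τ k x l + opA p τ k y l := by
  unfold opA
  split_ifs
  · rw [Finset.sum_add_distrib]
  · ring

lemma opA_congr (p : ℕ) (τ : X → X) (k : ℕ) (x y : List X → R) (l : List X)
    (h : ∀ j, x (l.map (τ^[j])) = y (l.map (τ^[j]))) :
    opA p τ k x l = opA p τ k y l := by
  unfold opA
  split_ifs
  · exact Finset.sum_congr rfl fun j _ => h j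
  · have h0 := h 0
    have h1 := h 1
    simp only [Function.iterate_zero, List.map_id, Function.iterate_one] at h0 h1
    rw [h0, h1]

lemma opA_period (p : ℕ) (τ : X → X) (k : ℕ) (x : List X → R) (l : List X) :
    opA p τ (k+2) x l = opA p τ k x l := by
  simp [opA, Nat.even_add_one]

end alg

section up
variable (p : ℕ)

/-- The free action on labels. -/
def tau (a : ZMod p × ℕ) : ZMod p × ℕ := (a.1 + 1, a.2)

lemma tau_iter (j : ℕ) (a : ZMod p × ℕ) : (tau p)^[j] a = (a.1 + j, a.2) := by
  induction j with
  | zero => simp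
  | succ j ih => rw [Function.iterate_succ', Function.comp, ih]; simp [tau, add_assoc]

lemma tau_p (l : List (ZMod p × ℕ)) : l.map ((tau p)^[p]) = l := by
  conv_rhs => rw [← List.map_id l]
  apply List.map_congr_left
  intro a _
  rw [tau_iter]; simp

/-- Lists of labels spanning a simplex of the `d`-fold join of `ZMod p`. -/
def Good (d : ℕ) (l : List (ZMod p × ℕ)) : Prop :=
  (∀ a ∈ l, a.2 < d) ∧ ∀ a ∈ l, ∀ b ∈ l, a.2 = b.2 → a = b

lemma Good.sublist {d : ℕ} {l m : List (ZMod p × ℕ)} (h : Good p d l) (hm : m.Sublist l) :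
    Good p d m :=
  ⟨fun a ha => h.1 a (hm.subset ha), fun a ha b hb => h.2 a (hm.subset ha) b (hm.subset hb)⟩

lemma Good.iter {d : ℕ} {l : List (ZMod p × ℕ)} (h : Good p d l) (j : ℕ) :
    Good p d (l.map ((tau p)^[j])) := by
  constructor
  · intro a ha
    obtain ⟨b, hb, rfl⟩ := List.mem_map.1 ha
    rw [tau_iter]; exact h.1 b hb
  · intro a ha b hb hab
    obtain ⟨a', ha', rfl⟩ := List.mem_map.1 ha
    obtain ⟨b', hb', rfl⟩ := List.mem_map.1 hb
    simp only [tau_iter] at hab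
    rw [h.2 a' ha' b' hb' hab]

open Classical in
/-- The group label of the vertex of least colour. -/
noncomputable def sel (S : Set (ZMod p × ℕ)) : ZMod p :=
  if h : ∃ a, a ∈ S ∧ ∀ b ∈ S, a.2 ≤ b.2 then h.choose.1 else 0

/-- `sel` on lists. -/
noncomputable def sl (l : List (ZMod p × ℕ)) : ZMod p := sel p {a | a ∈ l}

lemma sl_eq {d : ℕ} {l : List (ZMod p × ℕ)} (h : Good p d l) {a : ZMod p × ℕ} (ha : a ∈ l)
    (hmin : ∀ b ∈ l, a.2 ≤ b.2) : sl p l = a.1 := by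
  have hex : ∃ a, a ∈ {a | a ∈ l} ∧ ∀ b ∈ {a | a ∈ l}, a.2 ≤ b.2 := ⟨a, ha, hmin⟩
  unfold sl sel
  rw [dif_pos hex]
  have h1 := hex.choose_spec
  have : hex.choose = a := h.2 _ h1.1 _ ha (le_antisymm (h1.2 a ha) (hmin _ h1.1))
  rw [this]

lemma exists_min {l : List (ZMod p × ℕ)} (hl : l ≠ []) : ∃ a ∈ l, ∀ b ∈ l, a.2 ≤ b.2 := by
  have hne : l.toFinset.Nonempty := by simpa using hl
  obtain ⟨a, ha, h⟩ := Finset.exists_min_image l.toFinset (fun a => a.2) hne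
  exact ⟨a, by simpa using ha, fun b hb => h b (by simpa using hb)⟩

lemma sl_iter {d : ℕ} {l : List (ZMod p × ℕ)} (h : Good p d l) (hl : l ≠ []) (j : ℕ) :
    sl p (l.map ((tau p)^[j])) = sl p l + j := by
  obtain ⟨a, ha, hmin⟩ := exists_min p hl
  rw [sl_eq p h ha hmin, sl_eq p (h.iter p j) (List.mem_map_of_mem ha)]
  · rw [tau_iter]
  · intro b hb
    obtain ⟨b', hb', rfl⟩ := List.mem_map.1 hb
    simp only [tau_iter]
    exact hmin b' hb'

lemma sl_swap (l₁ : List (ZMod p × ℕ)) (a b : ZMod p × ℕ) (l₂ : List (ZMod p × ℕ)) :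
    sl p (l₁ ++ a :: b :: l₂) = sl p (l₁ ++ b :: a :: l₂) := by
  unfold sl
  congr 1
  ext c
  simp only [List.mem_append, List.mem_cons, Set.mem_ofPred_eq]
  tauto

lemma Alt.sl_ite {z : List (ZMod p × ℕ) → ZMod p} (hz : Alt z) (P : ZMod p → Prop)
    [DecidablePred P] : Alt (fun l => if P (sl p l) then z l else 0) := by
  constructor
  · intro l₁ a b l₂
    simp only [sl_swap p l₁ a b l₂]
    split_ifs
    · exact hz.1 _ _ _ _
    · simp
  · intro l₁ a l₂
    simp only [hz.2, ite_self]

lemma Alt.sl_sum {z : List (ZMod p × ℕ) → ZMod p} (hz : Alt z) (n : ZMod p → ℕ) :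
    Alt (fun l => ∑ j ∈ Finset.range (n (sl p l)), z (l.map ((tau p)^[j]))) := by
  constructor
  · intro l₁ a b l₂
    simp only [sl_swap p l₁ a b l₂]
    rw [← Finset.sum_neg_distrib]
    exact Finset.sum_congr rfl fun j _ => (hz.map ((tau p)^[j])).1 _ _ _ _
  · intro l₁ a l₂
    exact Finset.sum_eq_zero fun j _ => (hz.map ((tau p)^[j])).2 _ _ _

/-- Exactness. -/
lemma exact_step [Fact p.Prime] (d q k : ℕ) (hk : 1 ≤ k) (z : List (ZMod p × ℕ) → ZMod p)
    (hz : Alt z)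
    (hdeg : ∀ l : List (ZMod p × ℕ), l.length ≠ k → z l = 0)
    (hA : ∀ l, Good p d l → opA p (tau p) (q+1) z l = 0) :
    ∃ w : List (ZMod p × ℕ) → ZMod p, Alt w ∧
      (∀ l : List (ZMod p × ℕ), l.length ≠ k → w l = 0) ∧
      ∀ l, Good p d l → z l = opA p (tau p) q w l := by
  by_cases hq : Even q
  · have hq' : ¬ Even (q+1) := by simpa [Nat.even_add_one] using hq
    refine ⟨fun l => if sl p l = 0 then z l else 0, hz.sl_ite p (fun s => s = 0), ?_, ?_⟩
    · intro l hl
      simp [hdeg l hl]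
    · intro l hl
      by_cases hnil : l = []
      · subst hnil
        have : z [] = 0 := hdeg [] (by simp; omega)
        simp [opA, this]
      have hinv : ∀ j : ℕ, z (l.map ((tau p)^[j])) = z l := by
        intro j
        induction j with
        | zero => simp
        | succ j ih =>
          have := hA _ (hl.iter p j)
          simp only [opA, hq', if_false] at this
          rw [List.map_map, ← Function.iterate_succ'] at this
          rw [← ih]
          linear_combination -this
      simp only [opA, hq, if_true, hinv, sl_iter p hl hnil]
      rw [Finset.sum_eq_single (ZMod.val (- sl p l))]
      · simp
      · intro j hj hne
        rw [if_neg]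
        intro h0
        apply hne
        have : - sl p l = (j : ZMod p) := by linear_combination -h0
        rw [this, ZMod.val_natCast, Nat.mod_eq_of_lt (Finset.mem_range.1 hj)]
      · intro h
        exact absurd (Finset.mem_range.2 (ZMod.val_lt _)) h
  · have hq' : Even (q+1) := by simpa [Nat.even_add_one] using hq
    refine ⟨fun l => ∑ j ∈ Finset.range (ZMod.val (- sl p l)), z (l.map ((tau p)^[j])),
      hz.sl_sum p (fun s => ZMod.val (-s)), ?_, ?_⟩
    · intro l hl
      exact Finset.sum_eq_zero fun j _ => hdeg _ (by simpa using hl)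
    · intro l hl
      by_cases hnil : l = []
      · subst hnil
        have : z [] = 0 := hdeg [] (by simp; omega)
        simp [opA, this]
      have h1 := sl_iter p hl hnil 1
      simp only [Function.iterate_one, Nat.cast_one] at h1
      have hN := hA l hl
      simp only [opA, hq', if_true] at hN
      simp only [opA, hq, if_false, h1]
      have hm : ∀ j, (l.map (tau p)).map ((tau p)^[j]) = l.map ((tau p)^[j+1]) := by
        intro j
        rw [List.map_map, Function.iterate_succ]
      simp only [hm]
      obtain ⟨r, hr⟩ : ∃ r, r = ZMod.val (- sl p l) := ⟨_, rfl⟩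
      have hs : - sl p l = (r : ZMod p) := by rw [hr]; simp
      have hrp : r < p := hr ▸ ZMod.val_lt _
      have hs1 : - (sl p l + 1) = (r : ZMod p) - 1 := by rw [← hs]; ring
      rw [hs1, ← hr]
      rcases r with _ | r
      · have hp1 : p = (p - 1) + 1 := (Nat.succ_pred_prime Fact.out).symm
        have : ((0 : ℕ) : ZMod p) - 1 = ((p - 1 : ℕ) : ZMod p) := by
          rw [Nat.cast_sub (by omega)]; simp
        rw [this, ZMod.val_natCast, Nat.mod_eq_of_lt (by omega)]
        have hN2 := Finset.sum_range_succ' (fun j => z (l.map ((tau p)^[j]))) (p - 1)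
        rw [← hp1, hN] at hN2
        simp only [Function.iterate_zero, List.map_id] at hN2
        simp only [Finset.range_zero, Finset.sum_empty]
        linear_combination -hN2
      · have : ((r + 1 : ℕ) : ZMod p) - 1 = (r : ZMod p) := by push_cast; ring
        rw [this, ZMod.val_natCast, Nat.mod_eq_of_lt (by omega), Finset.sum_range_succ']
        simp

/-- The tower of cochains. -/
lemma tower [Fact p.Prime] (d : ℕ) : ∃ x : ℕ → List (ZMod p × ℕ) → ZMod p,
    x 0 [] = 1 ∧
    (∀ l, Good p d l → x (d+1) l = 0) ∧
    ∀ k l, Good p d l → dl l (x k) = opA p (tau p) k (x (k+1)) l := by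
  let S := {q : ℕ × (List (ZMod p × ℕ) → ZMod p) // Alt q.2 ∧
    (∀ l : List (ZMod p × ℕ), l.length ≠ q.1 → q.2 l = 0) ∧
    ∀ l, Good p d l → opA p (tau p) (q.1 + 1) (fun m => dl m q.2) l = 0}
  have step : ∀ s : S, ∃ t : S, t.1.1 = s.1.1 + 1 ∧
      ∀ l, Good p d l → dl l s.1.2 = opA p (tau p) s.1.1 t.1.2 l := by
    rintro ⟨⟨k, x⟩, h1, h2, h3⟩
    obtain ⟨w, hw1, hw2, hw3⟩ := exact_step p d k (k+1) (by omega) (fun m => dl m x) h1.dl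
      (fun l hl => dl_len l x (fun m hm => h2 m (by simp only; omega))) h3
    refine ⟨⟨⟨k+1, w⟩, hw1, hw2, ?_⟩, rfl, hw3⟩
    intro l hl
    simp only
    rw [opA_period, ← dl_opA, ← dl_dl l x]
    exact dl_congr _ _ _ fun m hm => (hw3 m (hl.sublist p hm)).symm
  choose nx hnx1 hnx2 using step
  have h0 : Alt (fun l : List (ZMod p × ℕ) => if l = [] then (1 : ZMod p) else 0) := by
    constructor <;> intros <;> simp
  let s0 : S := ⟨⟨0, fun l => if l = [] then 1 else 0⟩, h0, by
    intro l hl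
    have : l ≠ [] := by rintro rfl; simp at hl
    simp [this], by
    intro l hl
    rw [← dl_opA]
    rw [← dl_zero l]
    apply dl_congr
    intro m _
    simp [opA]⟩
  have hdeg : ∀ k, (nx^[k] s0).1.1 = k := by
    intro k
    induction k with
    | zero => rfl
    | succ k ih => rw [Function.iterate_succ', Function.comp, hnx1, ih]
  refine ⟨fun k => (nx^[k] s0).1.2, by simp [s0], ?_, ?_⟩
  · intro l hl
    by_cases hlen : l.length = d + 1
    · apply (nx^[d+1] s0).2.1.dup
      intro hnd
      have hinj : (l.map (fun a => a.2)).Nodup := by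
        apply List.Nodup.map_on _ hnd
        intro a ha b hb hab
        exact hl.2 a ha b hb hab
      have hsub : (l.map (fun a => a.2)).toFinset ⊆ Finset.range d := by
        intro i hi
        simp only [List.mem_toFinset, List.mem_map] at hi
        obtain ⟨a, ha, rfl⟩ := hi
        exact Finset.mem_range.2 (hl.1 a ha)
      have hc := Finset.card_le_card hsub
      rw [List.toFinset_card_of_nodup hinj] at hc
      simp at hc
      omega
    · exact (nx^[d+1] s0).2.2.1 l (by rw [hdeg]; exact hlen)
  · intro k l hl
    have := hnx2 (nx^[k] s0) l hl
    rw [hdeg k] at this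
    simp only
    rw [this, Function.iterate_succ', Function.comp]

end up
section geom

/-- The sup-norm unit sphere in the first `j` coordinates. -/
def Sph (N j : ℕ) : Set (Fin N → ℂ) :=
  {v | (∀ i, ‖v i‖ ≤ 1) ∧ (∃ i, i.val < j ∧ ‖v i‖ = 1) ∧ ∀ i : Fin N, j ≤ i.val → v i = 0}

/-- Lists of pairwise close points. -/
def Small (N j : ℕ) (ε : ℝ) (l : List (Fin N → ℂ)) : Prop :=
  (∀ v ∈ l, v ∈ Sph N j) ∧ ∀ v ∈ l, ∀ w ∈ l, dist v w < ε

lemma Sph.mono {N j k : ℕ} (h : j ≤ k) {v : Fin N → ℂ} (hv : v ∈ Sph N j) : v ∈ Sph N k := by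
  obtain ⟨h1, ⟨i, hi, hi2⟩, h3⟩ := hv
  exact ⟨h1, ⟨i, by omega, hi2⟩, fun i hi => h3 i (by omega)⟩

lemma Sph.smul {N j : ℕ} {ω : ℂ} (hω : ‖ω‖ = 1) {v : Fin N → ℂ} (hv : v ∈ Sph N j) :
    ω • v ∈ Sph N j := by
  obtain ⟨h1, ⟨i, hi, hi2⟩, h3⟩ := hv
  refine ⟨fun i => by simpa [hω] using h1 i, ⟨i, hi, by simpa [hω] using hi2⟩,
    fun i hi => by simp [h3 i hi]⟩

lemma Small.smul {N j : ℕ} {ε : ℝ} {ω : ℂ} (hω : ‖ω‖ = 1) {l : List (Fin N → ℂ)}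
    (hl : Small N j ε l) : Small N j ε (l.map (fun v => ω • v)) := by
  constructor
  · intro v hv
    obtain ⟨v', hv', rfl⟩ := List.mem_map.1 hv
    exact Sph.smul hω (hl.1 v' hv')
  · intro v hv w hw
    obtain ⟨v', hv', rfl⟩ := List.mem_map.1 hv
    obtain ⟨w', hw', rfl⟩ := List.mem_map.1 hw
    rw [dist_smul₀, hω, one_mul]
    exact hl.2 v' hv' w' hw'

lemma Small.iter {N j : ℕ} {ε : ℝ} {ω : ℂ} (hω : ‖ω‖ = 1) {l : List (Fin N → ℂ)}
    (hl : Small N j ε l) (k : ℕ) : Small N j ε (l.map ((fun v => ω • v)^[k])) := by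
  induction k with
  | zero => simpa using hl
  | succ k ih =>
    rw [Function.iterate_succ', ← List.map_map]
    exact ih.smul hω

lemma Small.sublist {N j : ℕ} {ε : ℝ} {l m : List (Fin N → ℂ)}
    (hl : Small N j ε l) (hm : m.Sublist l) : Small N j ε m :=
  ⟨fun a ha => hl.1 a (hm.subset ha), fun a ha b hb => hl.2 a (hm.subset ha) b (hm.subset hb)⟩

/-- Coefficients of the homotopy. -/
noncomputable def al (M i : ℕ) : ℝ := min 1 (2 - (i : ℝ) / M)
/-- Coefficients of the homotopy. -/
noncomputable def be (M i : ℕ) : ℝ := min 1 ((i : ℝ) / M)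

/-- The homotopy. -/
noncomputable def hom {N : ℕ} (j : Fin N) (M i : ℕ) (z : Fin N → ℂ) : Fin N → ℂ :=
  fun c => if c = j then (be M i : ℂ) else (al M i : ℂ) * z c

lemma al_nonneg {M i : ℕ} (hM : 0 < M) (hi : i ≤ 2 * M) : 0 ≤ al M i := by
  unfold al
  apply le_min zero_le_one
  have hM' : (0 : ℝ) < M := by exact_mod_cast hM
  have : (i : ℝ) / M ≤ 2 := by
    rw [div_le_iff₀ hM']; exact_mod_cast hi
  linarith

lemma be_nonneg {M i : ℕ} : 0 ≤ be M i := by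
  unfold be
  apply le_min zero_le_one
  positivity

lemma al_step (M i : ℕ) : |al M i - al M (i+1)| ≤ 1 / M := by
  unfold al
  have h := abs_min_sub_min_le_max (1:ℝ) (2 - (i:ℝ)/M) 1 (2 - ((i+1:ℕ):ℝ)/M)
  refine h.trans ?_
  have : (2 - (i:ℝ)/M) - (2 - ((i+1:ℕ):ℝ)/M) = 1 / M := by push_cast; ring
  rw [this, sub_self, abs_zero, abs_of_nonneg (by positivity)]
  exact max_le (by positivity) le_rfl

lemma be_step (M i : ℕ) : |be M i - be M (i+1)| ≤ 1 / M := by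
  unfold be
  have h := abs_min_sub_min_le_max (1:ℝ) ((i:ℝ)/M) 1 (((i+1:ℕ):ℝ)/M)
  refine h.trans ?_
  have : ((i:ℝ)/M) - (((i+1:ℕ):ℝ)/M) = - (1 / M) := by push_cast; ring
  rw [this, sub_self, abs_zero, abs_neg, abs_of_nonneg (by positivity)]
  exact max_le (by positivity) le_rfl

lemma hom_mem {N : ℕ} (j : Fin N) {M i : ℕ} (hM : 0 < M) (hi : i ≤ 2 * M) {z : Fin N → ℂ}
    (hz : z ∈ Sph N j.val) : hom j M i z ∈ Sph N (j.val + 1) := by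
  have hM' : (0 : ℝ) < M := by exact_mod_cast hM
  have ha0 := al_nonneg hM hi
  have hb0 : 0 ≤ be M i := be_nonneg
  have ha1 : al M i ≤ 1 := min_le_left _ _
  have hb1 : be M i ≤ 1 := min_le_left _ _
  obtain ⟨h1, ⟨c, hc, hc2⟩, h3⟩ := hz
  refine ⟨?_, ?_, ?_⟩
  · intro c
    unfold hom
    split_ifs
    · rw [Complex.norm_real, Real.norm_of_nonneg hb0]; exact hb1
    · rw [norm_mul, Complex.norm_real, Real.norm_of_nonneg ha0]
      exact mul_le_one₀ ha1 (norm_nonneg _) (h1 c)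
  · rcases le_total i M with h | h
    · have : al M i = 1 := by
        unfold al
        apply min_eq_left
        have : (i : ℝ) / M ≤ 1 := by rw [div_le_one hM']; exact_mod_cast h
        linarith
      refine ⟨c, by omega, ?_⟩
      have hcj : c ≠ j := by rintro rfl; omega
      simp [hom, hcj, this, hc2]
    · have : be M i = 1 := by
        unfold be
        apply min_eq_left
        rw [one_le_div hM']; exact_mod_cast h
      exact ⟨j, by omega, by simp [hom, this]⟩
  · intro c hc
    have hcj : c ≠ j := by rintro rfl; omega
    simp [hom, hcj, h3 c (by omega)]

lemma coord_est {a a' : ℝ} {z z' : ℂ} {δ η : ℝ} (ha : |a - a'| ≤ δ) (ha0 : 0 ≤ a') (ha1 : a' ≤ 1)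
    (hz : ‖z‖ ≤ 1) (hzz : ‖z - z'‖ ≤ η) : ‖(a : ℂ) * z - a' * z'‖ ≤ δ + η := by
  have : (a : ℂ) * z - a' * z' = ((a - a' : ℝ) : ℂ) * z + (a' : ℂ) * (z - z') := by push_cast; ring
  rw [this]
  refine (norm_add_le _ _).trans ?_
  rw [norm_mul, norm_mul, Complex.norm_real, Complex.norm_real, Real.norm_of_nonneg ha0,
    Real.norm_eq_abs]
  have h1 : |a - a'| * ‖z‖ ≤ |a - a'| := mul_le_of_le_one_right (abs_nonneg _) hz
  have h2 : a' * ‖z - z'‖ ≤ ‖z - z'‖ := mul_le_of_le_one_left (norm_nonneg _) ha1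
  linarith

lemma hom_dist {N : ℕ} (j : Fin N) {M i i' : ℕ} (hM : 0 < M) (hi' : i' ≤ 2 * M)
    (ha : |al M i - al M i'| ≤ 1 / M) (hb : |be M i - be M i'| ≤ 1 / M)
    {z z' : Fin N → ℂ} (hz : z ∈ Sph N j.val) {ε : ℝ} (hε : 1 / (M : ℝ) < ε / 2)
    (hzz : dist z z' < ε / 2) : dist (hom j M i z) (hom j M i' z') < ε := by
  have hε0 : 0 < ε := by
    have : (0:ℝ) ≤ 1 / M := by positivity
    linarith
  rw [dist_pi_lt_iff hε0]
  intro c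
  unfold hom
  split_ifs
  · rw [dist_eq_norm, ← Complex.ofReal_sub, Complex.norm_real, Real.norm_eq_abs]
    linarith
  · rw [dist_eq_norm]
    have h1 : ‖z c - z' c‖ ≤ dist z z' := by
      rw [← dist_eq_norm]; exact dist_le_pi_dist z z' c
    have := coord_est ha (al_nonneg hM hi') (min_le_left _ _) (hz.1 c) h1
    linarith

lemma acyc {R : Type*} [CommRing R] {N : ℕ} (j : Fin N) {ε : ℝ} (hε : 0 < ε)
    (x : List (Fin N → ℂ) → R)
    (hx : ∀ l, Small N (j.val + 1) ε l → dl l x = 0) :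
    ∃ y : List (Fin N → ℂ) → R, ∀ l, Small N j.val (ε / 2) l → x l = dl l y := by
  obtain ⟨n, hn⟩ := exists_nat_one_div_lt (half_pos hε)
  obtain ⟨M, hMn⟩ : ∃ M, M = n + 1 := ⟨_, rfl⟩
  have hM : 0 < M := by omega
  have hMε : 1 / (M : ℝ) < ε / 2 := by rw [hMn]; push_cast; exact hn
  let e : Fin N → ℂ := fun c => if c = j then 1 else 0
  have he : e ∈ Sph N (j.val + 1) := by
    refine ⟨fun c => ?_, ⟨j, by omega, by simp [e]⟩, fun c hc => ?_⟩
    · simp only [e]; split_ifs <;> simp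
    · have : c ≠ j := by rintro rfl; omega
      simp [e, this]
  refine ⟨fun l => x (e :: l.map (fun _ => e)) -
    ∑ i ∈ Finset.range (2 * M), prism (hom j M i) (hom j M (i+1)) l x, ?_⟩
  intro l hl
  rw [dl_sub, dl_sum]
  have hstep : ∀ i ∈ Finset.range (2 * M),
      dl l (fun m => prism (hom j M i) (hom j M (i+1)) m x)
        = x (l.map (hom j M (i+1))) - x (l.map (hom j M i)) := by
    intro i hi
    have hi2 : i + 1 ≤ 2 * M := Finset.mem_range.1 hi
    rw [← prism_homotopy, prism_zero, zero_add]
    intro m hm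
    apply hx
    constructor
    · intro u hu
      obtain ⟨v, hv, rfl | rfl⟩ := hm u hu
      · exact hom_mem j hM (by omega) (hl.1 v hv)
      · exact hom_mem j hM (by omega) (hl.1 v hv)
    · intro u hu w hw
      have h0 : (0:ℝ) ≤ 1 / M := by positivity
      have ha := al_step M i
      have hb := be_step M i
      obtain ⟨v, hv, rfl | rfl⟩ := hm u hu <;> obtain ⟨v', hv', rfl | rfl⟩ := hm w hw
      · exact hom_dist j hM (by omega) (by simp) (by simp) (hl.1 v hv) hMε
          (hl.2 v hv v' hv')
      · exact hom_dist j hM (by omega) ha hb (hl.1 v hv) hMε (hl.2 v hv v' hv')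
      · exact hom_dist j hM (by omega) (by rwa [abs_sub_comm]) (by rwa [abs_sub_comm])
          (hl.1 v hv) hMε (hl.2 v hv v' hv')
      · exact hom_dist j hM (by omega) (by simp) (by simp) (hl.1 v hv) hMε
          (hl.2 v hv v' hv')
  rw [Finset.sum_congr rfl hstep, Finset.sum_range_sub (fun i => x (l.map (hom j M i)))]
  have h0 : l.map (hom j M 0) = l := by
    conv_rhs => rw [← List.map_id l]
    apply List.map_congr_left
    intro z hz
    funext c
    by_cases hc : c = j
    · subst hc
      simp [hom, be, (hl.1 z hz).2.2 c le_rfl]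
    · simp [hom, hc, al]
  have h1 : l.map (hom j M (2 * M)) = l.map (fun _ => e) := by
    apply List.map_congr_left
    intro z hz
    funext c
    have : (M : ℝ) ≠ 0 := by exact_mod_cast hM.ne'
    by_cases hc : c = j
    · subst hc
      simp [hom, be, e, this]
    · simp [hom, hc, al, e, this]
  rw [h0, h1]
  have h2 : dl (e :: l.map (fun _ => e)) x = 0 := by
    apply hx
    have : ∀ u ∈ (e :: l.map (fun _ => e)), u = e := by
      intro u hu
      simp only [List.mem_cons, List.mem_map] at hu
      rcases hu with rfl | ⟨_, _, rfl⟩ <;> rfl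
    refine ⟨fun u hu => by rw [this u hu]; exact he, fun u hu w hw => ?_⟩
    rw [this u hu, this w hw, dist_self]; exact hε
  simp only [dl] at h2
  rw [dl_map (fun _ => e) l (fun m => x (e :: m))]
  linear_combination h2

/-- Core nonexistence result for labellings. -/
lemma no_label (p : ℕ) [Fact p.Prime] (d : ℕ) (ω : ℂ) (hω : ‖ω‖ = 1) (hωp : ω ^ p = 1)
    (lab : (Fin (d+1) → ℂ) → ZMod p × ℕ)
    (hlab : ∀ v ∈ Sph (d+1) (d+1), lab (ω • v) = tau p (lab v)) (ε₀ : ℝ) (hε₀ : 0 < ε₀)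
    (hgood : ∀ l, Small (d+1) (d+1) ε₀ l → Good p d (l.map lab)) : False := by
  obtain ⟨x, hx0, hxd, hx⟩ := tower p d
  let T : (Fin (d+1) → ℂ) → (Fin (d+1) → ℂ) := fun v => ω • v
  have hT : ∀ k v, T^[k] v = ω ^ k • v := by
    intro k v
    induction k with
    | zero => simp
    | succ k ih => rw [Function.iterate_succ', Function.comp, ih, pow_succ', mul_smul]
  have hTp : ∀ l : List (Fin (d+1) → ℂ), l.map (T^[p]) = l := by
    intro l
    conv_rhs => rw [← List.map_id l]
    apply List.map_congr_left
    intro v _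
    rw [hT, hωp, one_smul]; rfl
  have hlabT : ∀ k, ∀ v ∈ Sph (d+1) (d+1), lab (T^[k] v) = (tau p)^[k] (lab v) := by
    intro k v hv
    induction k with
    | zero => simp
    | succ k ih =>
      rw [Function.iterate_succ', Function.comp, Function.iterate_succ', Function.comp, ← ih]
      apply hlab
      rw [hT]
      exact Sph.smul (by simp [hω]) hv
  let X : ℕ → List (Fin (d+1) → ℂ) → ZMod p := fun k l => x k (l.map lab)
  have hX : ∀ k l, Small (d+1) (d+1) ε₀ l → dl l (X k) = opA p T k (X (k+1)) l := by
    intro k l hl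
    simp only [X]
    rw [dl_map lab l (x k), hx k _ (hgood l hl)]
    have : ∀ j, (l.map lab).map ((tau p)^[j]) = (l.map (T^[j])).map lab := by
      intro j
      rw [List.map_map, List.map_map]
      apply List.map_congr_left
      intro v hv
      exact (hlabT j v (hl.1 v hv)).symm
    have h1 := this 1
    simp only [Function.iterate_one] at h1
    simp only [opA, this, h1]
  have key : ∀ i k, i + k = d + 1 → ∃ ε, 0 < ε ∧ ε ≤ ε₀ ∧
      ∃ y z : List (Fin (d+1) → ℂ) → ZMod p, ∀ l, Small (d+1) k ε l →
        X k l = opA p T k y l + dl l z := by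
    intro i
    induction i with
    | zero =>
      intro k hk
      obtain rfl : k = d + 1 := by omega
      refine ⟨ε₀, hε₀, le_rfl, fun _ => 0, fun _ => 0, fun l hl => ?_⟩
      rw [dl_zero]
      simp only [X]
      rw [hxd _ (hgood l hl)]
      simp [opA]
    | succ i ih =>
      intro k hk
      obtain ⟨ε, hε, hεle, y, z, hyz⟩ := ih (k+1) (by omega)
      obtain ⟨y', hy'⟩ := acyc (⟨k, by omega⟩ : Fin (d+1)) hε
        (fun l => X k l - opA p T k z l) (by
          intro l hl
          have hl' : Small (d+1) (d+1) ε₀ l :=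
            ⟨fun v hv => Sph.mono (by simp only; omega) (hl.1 v hv),
              fun v hv w hw => (hl.2 v hv w hw).trans_le hεle⟩
          rw [dl_sub, dl_opA, hX k l hl', ← opA_sub, ← opA_opA p T k y l (hTp l)]
          apply opA_congr
          intro j
          rw [hyz _ (hl.iter hω j)]
          ring)
      refine ⟨ε / 2, half_pos hε, by linarith, z, y', fun l hl => ?_⟩
      rw [← hy' l hl]; ring
  obtain ⟨ε, hε, -, y, z, hyz⟩ := key (d+1) 0 (by omega)
  have := hyz [] ⟨by simp, by simp⟩
  simp [X, hx0, opA, dl] at this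

end geom
section phase

/-- Normalized argument. -/
noncomputable def th (p : ℕ) (z : ℂ) : ℝ := Complex.arg z * p / (2 * Real.pi)

open Classical in
/-- Which half of the sector. -/
noncomputable def ht (p : ℕ) (z : ℂ) : ℕ := if Int.fract (th p z) < 1 / 2 then 0 else 1

/-- Which sector. -/
noncomputable def gr (p : ℕ) (z : ℂ) : ZMod p := ((⌊th p z⌋ : ℤ) : ZMod p)

lemma ht_lt (p : ℕ) (z : ℂ) : ht p z < 2 := by
  unfold ht; split_ifs <;> norm_num

lemma th_mul (p : ℕ) {z u : ℂ} (hz : z ≠ 0) (hu : u ≠ 0) :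
    ∃ n : ℤ, th p (z * u) = th p z + th p u + ((p * n : ℤ) : ℝ) := by
  have h := Complex.arg_mul_coe_angle hz hu
  rw [← Real.Angle.coe_add, Real.Angle.angle_eq_iff_two_pi_dvd_sub] at h
  obtain ⟨k, hk⟩ := h
  refine ⟨k, ?_⟩
  unfold th
  have : Complex.arg (z * u) = Complex.arg z + Complex.arg u + 2 * Real.pi * k := by linarith
  rw [this]
  have := Real.pi_pos.ne'
  push_cast
  field_simp

lemma gr_of_th {p : ℕ} {z' : ℂ} {a : ℝ} {n : ℤ} (h : th p z' = a + ((p * n : ℤ) : ℝ)) :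
    gr p z' = ((⌊a⌋ : ℤ) : ZMod p) ∧ Int.fract (th p z') = Int.fract a := by
  rw [gr, h, Int.floor_add_intCast, Int.fract_add_intCast]
  simp

lemma th_omega {p : ℕ} (hp : p.Prime) :
    th p (Complex.exp (2 * Real.pi * Complex.I / p)) = 1 := by
  have hp0 : (0 : ℝ) < p := by exact_mod_cast hp.pos
  have hp2 : (2 : ℝ) ≤ p := by exact_mod_cast hp.two_le
  have h1 : (2 * Real.pi * Complex.I / p : ℂ) = ((2 * Real.pi / p : ℝ) : ℂ) * Complex.I := by
    push_cast; ring
  have hpi := Real.pi_pos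
  have h2 : 2 * Real.pi / p ≤ Real.pi := by
    rw [div_le_iff₀ hp0]; nlinarith
  have h3 : 0 < 2 * Real.pi / p := by positivity
  unfold th
  rw [h1, Complex.arg_exp_mul_I, (toIocMod_eq_self _).2]
  · field_simp
  · constructor <;> linarith

lemma phase_equiv {p : ℕ} (hp : p.Prime) {z : ℂ} (hz : z ≠ 0) :
    gr p (Complex.exp (2 * Real.pi * Complex.I / p) * z) = gr p z + 1 ∧
    ht p (Complex.exp (2 * Real.pi * Complex.I / p) * z) = ht p z := by
  obtain ⟨n, hn⟩ := th_mul p hz (Complex.exp_ne_zero (2 * Real.pi * Complex.I / p))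
  rw [th_omega hp, mul_comm] at hn
  obtain ⟨h1, h2⟩ := gr_of_th hn
  constructor
  · rw [h1, Int.floor_add_one, gr]; push_cast; rfl
  · unfold ht
    rw [h2, Int.fract_add_one]

lemma phase_sep {p : ℕ} : ∃ η > 0, η < 1 ∧ ∀ z u : ℂ, z ≠ 0 → ‖u - 1‖ < η →
    ht p (z * u) = ht p z → gr p (z * u) = gr p z := by
  have hc : ContinuousAt (th p) 1 := by
    unfold th
    have := Complex.continuousAt_arg (x := 1) (by simp)
    fun_prop
  have h0 : th p 1 = 0 := by simp [th]
  obtain ⟨η, hη, hη2⟩ := Metric.continuousAt_iff.1 hc (1/2) (by norm_num)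
  refine ⟨min η (1/2), by positivity, (min_le_right _ _).trans_lt (by norm_num), ?_⟩
  intro z u hz hu ht'
  have hu0 : u ≠ 0 := by
    rintro rfl
    have := hu.trans_le (min_le_right _ _)
    norm_num at this
  have hth : |th p u| < 1/2 := by
    have := hη2 (x := u) (by rw [dist_eq_norm]; exact hu.trans_le (min_le_left _ _))
    rwa [h0, dist_zero_right, Real.norm_eq_abs] at this
  obtain ⟨n, hn⟩ := th_mul p hz hu0
  obtain ⟨h1, h2⟩ := gr_of_th hn
  rw [h1, gr]
  congr 1
  unfold ht at ht'
  rw [h2] at ht'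
  obtain ⟨ha, hb⟩ := abs_lt.1 hth
  generalize th p z = a at *
  generalize th p u = b at *
  have e1 := Int.floor_add_fract a
  have e2 := Int.floor_add_fract (a + b)
  have f1 := Int.fract_nonneg a
  have f2 := Int.fract_nonneg (a + b)
  have g1 := Int.fract_lt_one a
  have g2 := Int.fract_lt_one (a + b)
  have k1 : (⌊a + b⌋ : ℝ) < ⌊a⌋ + 1 := by
    split_ifs at ht' <;> linarith
  have k2 : (⌊a⌋ : ℝ) < ⌊a + b⌋ + 1 := by
    split_ifs at ht' <;> linarith
  have k1' : ⌊a + b⌋ < ⌊a⌋ + 1 := by exact_mod_cast k1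
  have k2' : ⌊a⌋ < ⌊a + b⌋ + 1 := by exact_mod_cast k2
  omega

/-- Index of a coordinate of maximal size. -/
noncomputable def mx {m : ℕ} [NeZero m] (u : Fin m → ℝ) : Fin m :=
  (Finite.exists_max u).choose

lemma mx_spec {m : ℕ} [NeZero m] (u : Fin m → ℝ) (k : Fin m) : u k ≤ u (mx u) :=
  (Finite.exists_max u).choose_spec k

/-- Label of a vector. -/
noncomputable def vlab (p : ℕ) {m : ℕ} [NeZero m] (w : Fin m → ℂ) : ZMod p × ℕ :=
  let j := mx (fun i => ‖w i‖)
  (gr p (w j), 2 * j.val + ht p (w j))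

lemma norm_mx {m : ℕ} [NeZero m] (w : Fin m → ℂ) : ‖w (mx (fun i => ‖w i‖))‖ = ‖w‖ := by
  apply le_antisymm (norm_le_pi_norm _ _)
  exact (pi_norm_le_iff_of_nonneg (norm_nonneg _)).2 fun i => mx_spec (fun i => ‖w i‖) i

lemma vlab_equiv {p : ℕ} (hp : p.Prime) {ω : ℂ}
    (hω : ω = Complex.exp (2 * Real.pi * Complex.I / p)) (hω1 : ‖ω‖ = 1)
    {m : ℕ} [NeZero m] {w : Fin m → ℂ} (hw : w ≠ 0) :
    vlab p (ω • w) = tau p (vlab p w) := by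
  have h : (fun i => ‖(ω • w) i‖) = fun i => ‖w i‖ := by
    funext i; simp [hω1]
  have hne : w (mx (fun i => ‖w i‖)) ≠ 0 := by
    rw [← norm_ne_zero_iff, norm_mx]; simpa using hw
  obtain ⟨h1, h2⟩ := phase_equiv hp hne
  rw [← hω] at h1 h2
  unfold vlab tau
  rw [h]
  simp only [Pi.smul_apply, smul_eq_mul, h1, h2]

lemma vlab_lt (p : ℕ) {m : ℕ} [NeZero m] (w : Fin m → ℂ) : (vlab p w).2 < 2 * m := by
  have h1 := ht_lt p (w (mx (fun i => ‖w i‖)))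
  have h2 := (mx (fun i => ‖w i‖)).isLt
  simp only [vlab]
  omega

lemma vlab_sep {p : ℕ} {m : ℕ} [NeZero m] {c : ℝ} (hc : 0 < c) : ∃ δ > 0, ∀ w w' : Fin m → ℂ,
    c ≤ ‖w‖ → dist w w' < δ → (vlab p w).2 = (vlab p w').2 → vlab p w = vlab p w' := by
  obtain ⟨η, hη, hη1, h⟩ := phase_sep (p := p)
  refine ⟨η * c, by positivity, ?_⟩
  intro w w' hw hd hcol
  have t1 := ht_lt p (w (mx (fun i => ‖w i‖)))
  have t2 := ht_lt p (w' (mx (fun i => ‖w' i‖)))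
  have hcol' := hcol
  simp only [vlab] at hcol'
  have hj : mx (fun i => ‖w' i‖) = mx (fun i => ‖w i‖) := by
    apply Fin.ext; omega
  have hn := norm_mx w
  refine Prod.ext ?_ hcol
  simp only [vlab]
  rw [hj] at t2 hcol' ⊢
  generalize mx (fun i => ‖w i‖) = j at *
  have hwj : w j ≠ 0 := by
    rw [← norm_ne_zero_iff, hn]; linarith
  have hd' : ‖w' j - w j‖ < η * c := by
    rw [← dist_eq_norm, dist_comm]; exact (dist_le_pi_dist w w' j).trans_lt hd
  have hmul : w j * (w' j / w j) = w' j := by field_simp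
  have := h (w j) (w' j / w j) hwj (by
    have : w' j / w j - 1 = (w' j - w j) / w j := by field_simp
    rw [this, norm_div, hn, div_lt_iff₀ (by linarith)]
    exact hd'.trans_le (mul_le_mul_of_nonneg_left hw hη.le))
  rw [hmul] at this
  exact (this (by omega)).symm

end phase

section final

/-- Existence of a continuous equivariant map vanishing only at the origin. -/
def PP (ω : ℂ) (n m : ℕ) : Prop := ∃ G : (Fin n → ℂ) → (Fin m → ℂ), Continuous G ∧
  (∀ v, G (ω • v) = ω • G v) ∧ ∀ v, G v = 0 → v = 0

lemma not_PP {p : ℕ} (hp : p.Prime) {ω : ℂ}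
    (hω : ω = Complex.exp (2 * Real.pi * Complex.I / p)) {m : ℕ} (hm : 1 ≤ m) :
    ¬ PP ω (2 * m + 1) m := by
  rintro ⟨G, hG, hGe, hG0⟩
  have : Fact p.Prime := ⟨hp⟩
  have : NeZero m := ⟨by omega⟩
  have hp0 : (p : ℂ) ≠ 0 := by exact_mod_cast hp.ne_zero
  have hω1 : ‖ω‖ = 1 := by
    have : (2 * Real.pi * Complex.I / p : ℂ) = ((2 * Real.pi / p : ℝ) : ℂ) * Complex.I := by
      push_cast; ring
    rw [hω, this, Complex.norm_exp_ofReal_mul_I]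
  have hωp : ω ^ p = 1 := by
    rw [hω, ← Complex.exp_nat_mul, mul_div_cancel₀ _ hp0, Complex.exp_two_pi_mul_I]
  have hsph : ∀ v ∈ Sph (2*m+1) (2*m+1), v ∈ Metric.sphere (0 : Fin (2*m+1) → ℂ) 1 := by
    rintro v ⟨h1, ⟨i, _, hi⟩, _⟩
    rw [mem_sphere_zero_iff_norm]
    apply le_antisymm
    · exact (pi_norm_le_iff_of_nonneg zero_le_one).2 h1
    · rw [← hi]; exact norm_le_pi_norm v i
  have hK : IsCompact (Metric.sphere (0 : Fin (2*m+1) → ℂ) 1) := isCompact_sphere _ _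
  obtain ⟨c, hc, hcG⟩ : ∃ c > 0, ∀ v ∈ Metric.sphere (0 : Fin (2*m+1) → ℂ) 1, c ≤ ‖G v‖ := by
    have hne : (Metric.sphere (0 : Fin (2*m+1) → ℂ) 1).Nonempty :=
      NormedSpace.sphere_nonempty.2 zero_le_one
    obtain ⟨v, hv, hmin⟩ := hK.exists_isMinOn hne (hG.norm.continuousOn)
    refine ⟨‖G v‖, ?_, fun w hw => hmin hw⟩
    rw [gt_iff_lt, norm_pos_iff]
    intro h
    have := hG0 v h
    subst this
    simp at hv
  obtain ⟨δ, hδ, hsep⟩ := vlab_sep (p := p) (m := m) hc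
  obtain ⟨ε, hε, hun⟩ := Metric.uniformContinuousOn_iff.1
    (hK.uniformContinuousOn_of_continuous hG.continuousOn) δ hδ
  apply no_label p (2*m) ω hω1 hωp (fun v => vlab p (G v)) ?_ ε hε
  · intro l hl
    constructor
    · intro a ha
      obtain ⟨v, _, rfl⟩ := List.mem_map.1 ha
      exact vlab_lt p _
    · intro a ha b hb
      obtain ⟨v, hv, rfl⟩ := List.mem_map.1 ha
      obtain ⟨w, hw, rfl⟩ := List.mem_map.1 hb
      have hv' := hsph v (hl.1 v hv)
      have hw' := hsph w (hl.1 w hw)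
      exact hsep _ _ (hcG v hv') (hun v hv' w hw' (hl.2 v hv w hw))
  · intro v hv
    simp only [hGe]
    apply vlab_equiv hp hω hω1
    intro h
    have := hcG v (hsph v hv)
    rw [h, norm_zero] at this
    linarith

lemma PP.succ {ω : ℂ} {n m : ℕ} (h : PP ω n m) : PP ω (n+1) (m+1) := by
  obtain ⟨G, hG, hGe, hG0⟩ := h
  refine ⟨fun v => Fin.cons (v 0) (G (fun i => v i.succ)), ?_, ?_, ?_⟩
  · apply continuous_pi
    intro i
    refine Fin.cases ?_ (fun i => ?_) i
    · simp only [Fin.cons_zero]; fun_prop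
    · simp only [Fin.cons_succ]; fun_prop
  · intro v
    funext i
    refine Fin.cases ?_ (fun i => ?_) i
    · simp
    · have : (fun i : Fin n => (ω • v) i.succ) = ω • (fun i : Fin n => v i.succ) := rfl
      have h2 := congrFun (hGe (fun i : Fin n => v i.succ)) i
      rw [← this] at h2
      exact h2
  · intro v hv
    have h0 := congrFun hv 0
    have h1 : (fun i : Fin n => v i.succ) = 0 := by
      apply hG0
      funext i
      have := congrFun hv i.succ
      simpa using this
    funext i
    refine Fin.cases ?_ (fun i => ?_) i
    · simpa using h0
    · exact congrFun h1 i

lemma PP.comp {ω : ℂ} {n m k : ℕ} (h : PP ω n m) (h' : PP ω m k) : PP ω n k := by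
  obtain ⟨G, hG, hGe, hG0⟩ := h
  obtain ⟨G', hG', hGe', hG0'⟩ := h'
  exact ⟨fun v => G' (G v), hG'.comp hG, fun v => by simp only [hGe, hGe'],
    fun v hv => hG0 v (hG0' _ hv)⟩

lemma PP.incl {ω : ℂ} {n m : ℕ} (h : n ≤ m) : PP ω n m := by
  refine ⟨fun v i => if h : i.val < n then v ⟨i.val, h⟩ else 0, ?_, ?_, ?_⟩
  · apply continuous_pi
    intro i
    split_ifs
    · fun_prop
    · fun_prop
  · intro v
    funext i
    simp only [Pi.smul_apply]
    split_ifs <;> simp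
  · intro v hv
    funext i
    have := congrFun hv ⟨i.val, by omega⟩
    simpa using this

lemma PP.up {ω : ℂ} {m : ℕ} (h : PP ω (m+1) m) (k : ℕ) : PP ω (m+k) m := by
  have h1 : ∀ k, PP ω (m + k + 1) (m + k) := by
    intro k
    induction k with
    | zero => exact h
    | succ k ih => exact ih.succ
  induction k with
  | zero => exact PP.incl le_rfl
  | succ k ih => exact (h1 k).comp ih

lemma PP_of_map {ω : ℂ} (hω1 : ‖ω‖ = 1) {n m : ℕ}
    (f : {z : EuclideanSpace ℂ (Fin n) // ‖z‖ = 1} → {w : EuclideanSpace ℂ (Fin m) // ‖w‖ = 1})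
    (hf : Continuous f)
    (he : ∀ (z : {z : EuclideanSpace ℂ (Fin n) // ‖z‖ = 1})
        (h : ‖ω • (z : EuclideanSpace ℂ (Fin n))‖ = 1),
        (f ⟨ω • (z : EuclideanSpace ℂ (Fin n)), h⟩ : EuclideanSpace ℂ (Fin m))
          = ω • (f z : EuclideanSpace ℂ (Fin m))) : PP ω n m := by
  classical
  let F : EuclideanSpace ℂ (Fin n) → EuclideanSpace ℂ (Fin m) :=
    fun v => if h : ‖v‖ = 1 then (f ⟨v, h⟩ : EuclideanSpace ℂ (Fin m)) else 0
  have hFv : ∀ v (h : ‖v‖ = 1), F v = f ⟨v, h⟩ := fun v h => dif_pos h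
  have hF : ContinuousOn F {v | ‖v‖ = 1} := by
    rw [continuousOn_iff_continuous_domRestrict]
    have : Set.domRestrict {v | ‖v‖ = 1} F = fun v => (f v : EuclideanSpace ℂ (Fin m)) := by
      funext v
      exact hFv v.1 v.2
    rw [this]
    exact continuous_subtype_val.comp hf
  let g : EuclideanSpace ℂ (Fin n) → EuclideanSpace ℂ (Fin m) :=
    fun v => (‖v‖ : ℂ) • F ((‖v‖ : ℂ)⁻¹ • v)
  have hn1 : ∀ v : EuclideanSpace ℂ (Fin n), v ≠ 0 → ‖(‖v‖ : ℂ)⁻¹ • v‖ = 1 := by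
    intro v hv
    rw [norm_smul, norm_inv, Complex.norm_real, norm_norm]
    exact inv_mul_cancel₀ (norm_ne_zero_iff.2 hv)
  have hgn : ∀ v, ‖g v‖ = ‖v‖ := by
    intro v
    by_cases hv : v = 0
    · subst hv; simp [g]
    · simp only [g]
      rw [hFv _ (hn1 v hv), norm_smul, (f _).2, Complex.norm_real, norm_norm, mul_one]
  have hg0 : g 0 = 0 := by simp [g]
  have hgc : Continuous g := by
    rw [continuous_iff_continuousAt]
    intro v
    by_cases hv : v = 0
    · subst hv
      rw [ContinuousAt, hg0, tendsto_zero_iff_norm_tendsto_zero]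
      simp only [hgn]
      have := (continuous_norm (E := EuclideanSpace ℂ (Fin n))).tendsto 0
      simpa using this
    · have hc : ContinuousOn g {0}ᶜ := by
        have h1 : ContinuousOn (fun v : EuclideanSpace ℂ (Fin n) => (‖v‖ : ℂ)⁻¹ • v) {0}ᶜ := by
          have h0 : ContinuousOn (fun v : EuclideanSpace ℂ (Fin n) => (‖v‖ : ℂ)⁻¹) {0}ᶜ := by
            apply ContinuousOn.inv₀
            · exact (Complex.continuous_ofReal.comp continuous_norm).continuousOn
            · intro v hv
              simpa using hv
          exact h0.smul continuousOn_id
        exact ContinuousOn.smul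
          (Complex.continuous_ofReal.comp continuous_norm).continuousOn
          (hF.comp h1 (fun v hv => hn1 v hv))
      exact hc.continuousAt (isOpen_compl_singleton.mem_nhds hv)
  have hge : ∀ v, g (ω • v) = ω • g v := by
    intro v
    by_cases hv : v = 0
    · subst hv; simp [hg0]
    · simp only [g]
      have h1 : ‖ω • v‖ = ‖v‖ := by rw [norm_smul, hω1, one_mul]
      rw [h1, smul_comm _ ω v]
      have h2 := hn1 v hv
      have h3 : ‖ω • ((‖v‖ : ℂ)⁻¹ • v)‖ = 1 := by rw [norm_smul, hω1, one_mul, h2]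
      rw [hFv _ h3, hFv _ h2, he ⟨_, h2⟩ h3, smul_comm]
  refine ⟨fun v => (g (WithLp.toLp 2 v)).ofLp, ?_, ?_, ?_⟩
  · exact (PiLp.continuous_ofLp 2 _).comp (hgc.comp (PiLp.continuous_toLp 2 _))
  · intro v
    simp only
    rw [WithLp.toLp_smul, hge, WithLp.ofLp_smul]
  · intro v hv
    have h1 : g (WithLp.toLp 2 v) = 0 := by
      ext i
      exact congrFun hv i
    have h2 := hgn (WithLp.toLp 2 v)
    rw [h1, norm_zero] at h2
    have h3 := norm_eq_zero.1 h2.symm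
    funext i
    have := congrArg (fun w : EuclideanSpace ℂ (Fin n) => w i) h3
    simpa using this

end final
end ZpBU

/-- For a prime `p` and integers `n > m ≥ 1`, there is no continuous map from the unit sphere
`S^{2n-1} ⊂ ℂⁿ` to the unit sphere `S^{2m-1} ⊂ ℂᵐ` equivariant with respect to coordinatewise
multiplication by `ω = exp(2πi/p)`. -/
theorem no_equivariant_map_of_spheres
    (p : ℕ) (hp : Nat.Prime p) (n m : ℕ) (hm : 1 ≤ m) (hnm : m < n)
    (ω : ℂ) (hω : ω = Complex.exp (2 * Real.pi * Complex.I / p)) :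
    ¬ ∃ f : {z : EuclideanSpace ℂ (Fin n) // ‖z‖ = 1} → {w : EuclideanSpace ℂ (Fin m) // ‖w‖ = 1},
      Continuous f ∧
      ∀ (z : {z : EuclideanSpace ℂ (Fin n) // ‖z‖ = 1})
        (h : ‖ω • (z : EuclideanSpace ℂ (Fin n))‖ = 1),
        (f ⟨ω • (z : EuclideanSpace ℂ (Fin n)), h⟩ : EuclideanSpace ℂ (Fin m))
          = ω • (f z : EuclideanSpace ℂ (Fin m)) := by
  rintro ⟨f, hf, he⟩
  have hω1 : ‖ω‖ = 1 := by
    have : (2 * Real.pi * Complex.I / p : ℂ) = ((2 * Real.pi / p : ℝ) : ℂ) * Complex.I := by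
      push_cast; ring
    rw [hω, this, Complex.norm_exp_ofReal_mul_I]
  have h1 : ZpBU.PP ω n m := ZpBU.PP_of_map hω1 f hf he
  have h2 : ZpBU.PP ω (m+1) m := (ZpBU.PP.incl (by omega)).comp h1
  apply ZpBU.not_PP hp hω hm
  have h3 := h2.up (m+1)
  rwa [show m + (m + 1) = 2 * m + 1 by ring] at h3
end

section
/- If the standard unit sphere S^{n-1} ⊂ ℝⁿ is written as a union F₁ ∪ F₂ ∪ … ∪ Fₙ of n closed subsets, then at least one Fᵢ contains a pair of antipodal points, i.e., there exist i and x ∈ S^{n-1} with x ∈ Fᵢ and −x ∈ Fᵢ. -/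
namespace BorsukAux

open Finsupp

/-- Mod 2 chains on ordered simplices (lists of vertices), augmented by the empty list. -/
abbrev Ch (X : Type*) := List X →₀ ZMod 2

/-- Linear extension. -/
noncomputable def lin {X M : Type*} [AddCommGroup M] [Module (ZMod 2) M] (f : List X → M) :
    Ch X →ₗ[ZMod 2] M := Finsupp.linearCombination (ZMod 2) f

/-- Generator of the chain module. -/
noncomputable def sg {X : Type*} (l : List X) : Ch X := Finsupp.single l 1

@[simp] lemma lin_sg {X M : Type*} [AddCommGroup M] [Module (ZMod 2) M] (f : List X → M)
    (l : List X) : lin f (sg l) = f l := by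
  simp [lin, sg]

lemma lin_ext {X M : Type*} [AddCommGroup M] [Module (ZMod 2) M] {f g : Ch X →ₗ[ZMod 2] M}
    (h : ∀ l, f (sg l) = g (sg l)) : f = g := by
  apply Finsupp.lhom_ext'
  intro l
  apply LinearMap.ext_ring
  exact h l

/-- Cone operator. -/
noncomputable def cone {X : Type*} (x : X) : Ch X →ₗ[ZMod 2] Ch X := lin (fun m => sg (x :: m))

@[simp] lemma cone_sg {X : Type*} (x : X) (l : List X) : cone x (sg l) = sg (x :: l) := by
  simp [cone]

/-- Boundary of a list. -/
noncomputable def bd {X : Type*} : List X → Ch X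
  | [] => 0
  | x :: l => sg l + cone x (bd l)

/-- Boundary operator. -/
noncomputable def D {X : Type*} : Ch X →ₗ[ZMod 2] Ch X := lin bd

@[simp] lemma D_nil {X : Type*} : D (sg ([] : List X)) = 0 := by simp [D, bd]

lemma D_cons {X : Type*} (x : X) (l : List X) :
    D (sg (x :: l)) = sg l + cone x (D (sg l)) := by simp [D, bd]

lemma D_cone {X : Type*} (x : X) (c : Ch X) : D (cone x c) = c + cone x (D c) := by
  have : D ∘ₗ cone x = LinearMap.id + cone x ∘ₗ D := by
    apply lin_ext
    intro l
    simp [D_cons]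
  exact LinearMap.congr_fun this c

lemma add_self2 {M : Type*} [AddCommGroup M] [Module (ZMod 2) M] (x : M) : x + x = 0 :=
  ZModModule.add_self x

lemma add_cancel_mid {M : Type*} [AddCommGroup M] [Module (ZMod 2) M] (z a b : M) :
    z + a + (a + b) = z + b := by
  rw [show z + a + (a + b) = z + b + (a + a) by abel, add_self2, add_zero]

lemma add_cancel_end {M : Type*} [AddCommGroup M] [Module (ZMod 2) M] (z a : M) :
    z + a + a = z := by
  rw [add_assoc, add_self2, add_zero]

lemma D_D {X : Type*} (c : Ch X) : D (D c) = 0 := by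
  have : (D ∘ₗ D : Ch X →ₗ[ZMod 2] Ch X) = 0 := by
    apply lin_ext
    intro l
    induction l with
    | nil => simp
    | cons x l ih =>
      simp only [LinearMap.comp_apply, LinearMap.zero_apply] at ih ⊢
      rw [D_cons, map_add, D_cone, ih, map_zero, add_zero, add_self2]
  exact LinearMap.congr_fun this c

/-- Pushforward of chains. -/
noncomputable def mp {X : Type*} (g : X → X) : Ch X →ₗ[ZMod 2] Ch X := lin (fun m => sg (m.map g))

@[simp] lemma mp_sg {X : Type*} (g : X → X) (l : List X) : mp g (sg l) = sg (l.map g) := by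
  simp [mp]

lemma mp_cone {X : Type*} (g : X → X) (x : X) (c : Ch X) :
    mp g (cone x c) = cone (g x) (mp g c) := by
  have : mp g ∘ₗ cone x = cone (g x) ∘ₗ mp g := by
    apply lin_ext
    intro l
    simp
  exact LinearMap.congr_fun this c

lemma D_mp {X : Type*} (g : X → X) (c : Ch X) : D (mp g c) = mp g (D c) := by
  have : D ∘ₗ mp g = mp g ∘ₗ D := by
    apply lin_ext
    intro l
    induction l with
    | nil => simp
    | cons x l ih =>
      simp only [LinearMap.comp_apply, mp_sg, List.map_cons] at ih ⊢
      rw [D_cons, D_cons, map_add, mp_cone, ih, mp_sg]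
  exact LinearMap.congr_fun this c

/-- Prism of a list. -/
noncomputable def pr {X : Type*} (g h : X → X) : List X → Ch X
  | [] => 0
  | x :: l => sg (g x :: h x :: l.map h) + cone (g x) (pr g h l)

/-- Prism operator. -/
noncomputable def P {X : Type*} (g h : X → X) : Ch X →ₗ[ZMod 2] Ch X := lin (pr g h)

lemma P_cons {X : Type*} (g h : X → X) (x : X) (l : List X) :
    P g h (sg (x :: l)) = cone (g x) (cone (h x) (mp h (sg l))) + cone (g x) (P g h (sg l)) := by
  simp [P, pr]

lemma P_cone {X : Type*} (g h : X → X) (x : X) (c : Ch X) :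
    P g h (cone x c) = cone (g x) (cone (h x) (mp h c)) + cone (g x) (P g h c) := by
  have : P g h ∘ₗ cone x
      = cone (g x) ∘ₗ cone (h x) ∘ₗ mp h + cone (g x) ∘ₗ P g h := by
    apply lin_ext
    intro l
    simp only [LinearMap.comp_apply, cone_sg, P_cons, LinearMap.add_apply]
  exact LinearMap.congr_fun this c

lemma D_P {X : Type*} (g h : X → X) (c : Ch X) :
    D (P g h c) = mp g c + mp h c + P g h (D c) := by
  have : D ∘ₗ P g h = mp g + mp h + P g h ∘ₗ D := by
    apply lin_ext
    intro l
    induction l with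
    | nil => simp [P, pr, add_self2]
    | cons x l ih =>
      simp only [LinearMap.comp_apply, LinearMap.add_apply] at ih ⊢
      have e1 : mp g (sg (x :: l)) = cone (g x) (mp g (sg l)) := by simp
      have e2 : mp h (sg (x :: l)) = cone (h x) (mp h (sg l)) := by simp
      rw [P_cons, D_cons, map_add, map_add, P_cone, D_cone, D_cone, D_cone, ih, e1, e2, D_mp]
      simp only [map_add]
      have := add_self2 (cone (g x) (mp h (sg l)))
      grind
  exact LinearMap.congr_fun this c

/-! ### The cochains -/

section cochain
variable {X : Type*} (s : ℕ → X → ZMod 2)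

/-- The pair of cochains `(A, W)`. -/
noncomputable def AW : List X → ZMod 2 × ZMod 2
  | [] => (1, 0)
  | x :: l =>
    let w := s (l.length - 1) x * (AW l).2 + (AW l).1
    (s l.length x * w, w)

/-- The cochain `A`. -/
noncomputable def A : Ch X →ₗ[ZMod 2] ZMod 2 := lin (fun l => (AW s l).1)
/-- The cochain `W`. -/
noncomputable def W : Ch X →ₗ[ZMod 2] ZMod 2 := lin (fun l => (AW s l).2)

lemma A_cons (x : X) (l : List X) :
    A s (sg (x :: l)) = s l.length x * W s (sg (x :: l)) := by simp [A, W, AW]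

lemma W_cons (x : X) (l : List X) :
    W s (sg (x :: l)) = s (l.length - 1) x * W s (sg l) + A s (sg l) := by simp [A, W, AW]

lemma A_nil : A s (sg []) = 1 := by simp [A, AW]
lemma W_nil : W s (sg []) = 0 := by simp [W, AW]

end cochain

/-- Chains on simplices of length `k` with vertices in `V`. -/
noncomputable def Sp {X : Type*} (k : ℕ) (V : Set X) : Submodule (ZMod 2) (Ch X) :=
  Submodule.span (ZMod 2) {c | ∃ l : List X, l.length = k ∧ (∀ x ∈ l, x ∈ V) ∧ c = sg l}

lemma sg_mem_Sp {X : Type*} {k : ℕ} {V : Set X} {l : List X} (h : l.length = k)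
    (hV : ∀ x ∈ l, x ∈ V) : sg l ∈ Sp k V := Submodule.subset_span ⟨l, h, hV, rfl⟩

lemma Sp_mono {X : Type*} {k : ℕ} {V V' : Set X} (h : V ⊆ V') : Sp k V ≤ Sp k V' := by
  apply Submodule.span_mono
  rintro c ⟨l, h1, h2, rfl⟩
  exact ⟨l, h1, fun x hx => h (h2 x hx), rfl⟩

lemma cone_mem_Sp {X : Type*} {k : ℕ} {V : Set X} {x : X} (hx : x ∈ V) {c : Ch X}
    (hc : c ∈ Sp k V) : cone x c ∈ Sp (k + 1) V := by
  induction hc using Submodule.span_induction with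
  | mem c h =>
    obtain ⟨l, h1, h2, rfl⟩ := h
    rw [cone_sg]
    exact sg_mem_Sp (by simp [h1]) (by simpa [hx] using h2)
  | zero => simp
  | add c d _ _ h1 h2 => rw [map_add]; exact add_mem h1 h2
  | smul a c _ h => rw [map_smul]; exact Submodule.smul_mem _ _ h

lemma bd_mem_Sp {X : Type*} (l : List X) : D (sg l) ∈ Sp (l.length - 1) {x | x ∈ l} := by
  induction l with
  | nil => simp
  | cons x l ih =>
    rw [D_cons]
    refine add_mem (sg_mem_Sp (by simp) (by simp; tauto)) ?_
    cases l with
    | nil => simp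
    | cons y m =>
      have := cone_mem_Sp (x := x) (V := {z | z ∈ x :: y :: m}) (by simp)
        (Sp_mono (V' := {z | z ∈ x :: y :: m}) (by intro z hz; simp at hz ⊢; tauto) ih)
      simpa using this

lemma pr_mem_Sp {X : Type*} (g h : X → X) (l : List X) :
    P g h (sg l) ∈ Sp (l.length + 1) {y | ∃ x ∈ l, y = g x ∨ y = h x} := by
  induction l with
  | nil => simp [P, pr]
  | cons x l ih =>
    rw [P_cons]
    refine add_mem ?_ ?_
    · simp only [mp_sg, cone_sg]
      refine sg_mem_Sp (by simp) ?_
      simp only [List.mem_cons, List.mem_map]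
      rintro y (rfl | rfl | ⟨z, hz, rfl⟩)
      · exact ⟨x, by simp, by simp⟩
      · exact ⟨x, by simp, by simp⟩
      · exact ⟨z, by simp [hz], by simp⟩
    · refine cone_mem_Sp (V := {y | ∃ z ∈ x :: l, y = g z ∨ y = h z}) ⟨x, by simp, by simp⟩
        (Sp_mono ?_ ih)
      rintro y ⟨z, hz, h⟩
      exact ⟨z, by simp [hz], h⟩

section cochain2
variable {X : Type*} (s : ℕ → X → ZMod 2)

lemma A_cone {k : ℕ} {V : Set X} (x : X) {c : Ch X} (hc : c ∈ Sp k V) :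
    A s (cone x c) = s k x * (s (k - 1) x * W s c + A s c) := by
  induction hc using Submodule.span_induction with
  | mem c h =>
    obtain ⟨l, h1, h2, rfl⟩ := h
    rw [cone_sg, A_cons, W_cons, h1]
  | zero => simp
  | add c d _ _ h1 h2 => simp only [map_add, h1, h2]; ring
  | smul a c _ h => simp only [map_smul, h, smul_eq_mul]; ring

lemma A_D (c : Ch X) : A s (D c) = W s c := by
  have key : ∀ k, ∀ l : List X, l.length = k → A s (D (sg l)) = W s (sg l) := by
    intro k
    induction k using Nat.strong_induction_on with
    | _ k ih =>
      intro l hl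
      cases l with
      | nil => simp [W_nil]
      | cons x l =>
        have hl' : l.length + 1 = k := by simpa using hl
        rw [D_cons, map_add, A_cone s x (bd_mem_Sp l), ih l.length (by omega) l rfl, W_cons]
        have hW : W s (D (sg l)) = 0 := by
          have h1 : ∀ c ∈ Sp (l.length - 1) {x | x ∈ l}, A s (D c) = W s c := by
            intro c hc
            induction hc using Submodule.span_induction with
            | mem c h =>
              obtain ⟨m, h1, h2, rfl⟩ := h
              exact ih _ (by omega) m h1
            | zero => simp
            | add c d _ _ h1 h2 => simp only [map_add, h1, h2]
            | smul a c _ h => simp only [map_smul, h]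
          rw [← h1 _ (bd_mem_Sp l), D_D, map_zero]
        rw [hW]; ring
  have : A s ∘ₗ D = W s := lin_ext fun l => key _ l rfl
  exact LinearMap.congr_fun this c

/-- If some `s i` is constant on the list, `W` vanishes. -/
lemma W_eq_zero (i : ℕ) (a : ZMod 2) (l : List X) (hl : i + 1 < l.length)
    (h : ∀ x ∈ l, s i x = a) : W s (sg l) = 0 := by
  induction l with
  | nil => simp at hl
  | cons x l ih =>
    cases l with
    | nil => simp at hl
    | cons y m =>
      rw [W_cons, A_cons]
      simp only [List.length_cons, Nat.add_sub_cancel] at hl ⊢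
      by_cases hi : i = m.length
      · subst hi
        rw [h x (by simp), h y (by simp), add_self2]
      · rw [ih (by simp; omega) (fun z hz => h z (by simp at hz ⊢; tauto))]
        simp

/-- Behaviour under an involution flipping every `s i`. -/
lemma AW_flip (a : X → X) (l : List X) (h : ∀ i, ∀ x ∈ l, s i (a x) = s i x + 1) :
    W s (sg (l.map a)) = W s (sg l) ∧
      A s (sg (l.map a)) = A s (sg l) + W s (sg l) := by
  induction l with
  | nil => simp [W_nil]
  | cons x l ih =>
    obtain ⟨h1, h2⟩ := ih (fun i z hz => h i z (by simp [hz]))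
    have hw : W s (sg ((x :: l).map a)) = W s (sg (x :: l)) := by
      rw [List.map_cons, W_cons, W_cons, h1, h2, h _ x (by simp), List.length_map]
      linear_combination add_self2 (W s (sg l))
    refine ⟨hw, ?_⟩
    rw [List.map_cons] at hw ⊢
    rw [A_cons, A_cons, hw, h _ x (by simp), List.length_map]
    ring

end cochain2

/-! ### Small chains on the sphere -/

section geom
variable {n : ℕ}

local notation "E" => EuclideanSpace ℝ (Fin n)

/-- Points of the `k`-dimensional subsphere. -/
def Sub (n k : ℕ) : Set (EuclideanSpace ℝ (Fin n)) :=
  {x | ‖x‖ = 1 ∧ ∀ j : Fin n, k < j.1 → x j = 0}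

/-- Small chains of length `k + 1`. -/
noncomputable def Small (n k : ℕ) (ε : ℝ) : Submodule (ZMod 2) (Ch (EuclideanSpace ℝ (Fin n))) :=
  Submodule.span (ZMod 2) {c | ∃ l : List (EuclideanSpace ℝ (Fin n)), l.length = k + 1 ∧
    (∀ x ∈ l, x ∈ Sub n k) ∧ (∀ x ∈ l, ∀ y ∈ l, dist x y < ε) ∧ c = sg l}

lemma sg_mem_Small {k : ℕ} {ε : ℝ} {l : List E} (h1 : l.length = k + 1)
    (h2 : ∀ x ∈ l, x ∈ Sub n k) (h3 : ∀ x ∈ l, ∀ y ∈ l, dist x y < ε) :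
    sg l ∈ Small n k ε := Submodule.subset_span ⟨l, h1, h2, h3, rfl⟩

lemma Sp_le_Small {k : ℕ} {ε : ℝ} {V : Set E} (h2 : V ⊆ Sub n k)
    (h3 : ∀ x ∈ V, ∀ y ∈ V, dist x y < ε) : Sp (k + 1) V ≤ Small n k ε := by
  apply Submodule.span_mono
  rintro c ⟨l, h1, hV, rfl⟩
  exact ⟨l, h1, fun x hx => h2 (hV x hx), fun x hx y hy => h3 _ (hV x hx) _ (hV y hy), rfl⟩

lemma Small_mono {k : ℕ} {ε ε' : ℝ} (h : ε ≤ ε') : Small n k ε ≤ Small n k ε' := by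
  apply Submodule.span_mono
  rintro c ⟨l, h1, h2, h3, rfl⟩
  exact ⟨l, h1, h2, fun x hx y hy => (h3 x hx y hy).trans_le h, rfl⟩

lemma map_Small {k k' : ℕ} {ε ε' : ℝ} (f : Ch E →ₗ[ZMod 2] Ch E)
    (h : ∀ l : List E, l.length = k + 1 → (∀ x ∈ l, x ∈ Sub n k) →
      (∀ x ∈ l, ∀ y ∈ l, dist x y < ε) → f (sg l) ∈ Small n k' ε') {c : Ch E}
    (hc : c ∈ Small n k ε) : f c ∈ Small n k' ε' := by
  induction hc using Submodule.span_induction with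
  | mem c hc =>
    obtain ⟨l, h1, h2, h3, rfl⟩ := hc
    exact h l h1 h2 h3
  | zero => simp
  | add c d _ _ h1 h2 => rw [map_add]; exact add_mem h1 h2
  | smul a c _ h => rw [map_smul]; exact Submodule.smul_mem _ _ h

lemma neg_Small {k : ℕ} {ε : ℝ} {c : Ch E} (hc : c ∈ Small n k ε) :
    mp (fun x => -x) c ∈ Small n k ε := by
  refine map_Small _ ?_ hc
  intro l h1 h2 h3
  rw [mp_sg]
  refine sg_mem_Small (by simpa using h1) ?_ ?_
  · simp only [List.mem_map]
    rintro _ ⟨x, hx, rfl⟩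
    have := h2 x hx
    simp only [Sub, Set.mem_ofPred_eq, norm_neg, PiLp.neg_apply, neg_eq_zero] at this ⊢
    exact this
  · simp only [List.mem_map]
    rintro _ ⟨x, hx, rfl⟩ _ ⟨y, hy, rfl⟩
    rw [dist_neg_neg]
    exact h3 x hx y hy

lemma mp_neg_neg (c : Ch E) : mp (fun x => -x) (mp (fun x => -x) c) = c := by
  have : mp (fun x : E => -x) ∘ₗ mp (fun x : E => -x) = LinearMap.id := by
    apply lin_ext
    intro l
    simp
  exact LinearMap.congr_fun this c

/-- Rotation towards the vector `e`. -/
noncomputable def H (e : E) (t : ℝ) (x : E) : E := Real.cos t • x + Real.sin t • e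

lemma H_mem {k : ℕ} (hk : k + 1 < n) {x : E} (hx : x ∈ Sub n k) (t : ℝ) :
    H (EuclideanSpace.single ⟨k + 1, hk⟩ 1) t x ∈ Sub n (k + 1) := by
  obtain ⟨h1, h2⟩ := hx
  constructor
  · have h0 : inner ℝ (Real.cos t • x)
        (Real.sin t • (EuclideanSpace.single ⟨k + 1, hk⟩ 1 : E)) = 0 := by
      rw [inner_smul_left, inner_smul_right, EuclideanSpace.inner_single_right,
        h2 ⟨k + 1, hk⟩ (by simp)]
      simp
    have h3 := norm_add_sq_eq_norm_sq_add_norm_sq_real h0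
    rw [norm_smul, norm_smul, h1] at h3
    simp only [Real.norm_eq_abs, mul_one, EuclideanSpace.norm_single, norm_one,
      abs_mul_abs_self] at h3
    have h4 := Real.sin_sq_add_cos_sq t
    have h5 : ‖H (EuclideanSpace.single ⟨k + 1, hk⟩ 1 : E) t x‖ ^ 2 = 1 := by
      unfold H
      nlinarith
    have := norm_nonneg (H (EuclideanSpace.single ⟨k + 1, hk⟩ 1 : E) t x)
    nlinarith
  · intro j hj
    have hne : j ≠ ⟨k + 1, hk⟩ := by
      intro h; rw [h] at hj; simp at hj
    simp [H, h2 j (by omega), hne]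

lemma dist_H_le (e : E) (he : ‖e‖ = 1) {x y : E} (hy : ‖y‖ = 1) (t u : ℝ) :
    dist (H e t x) (H e u y) ≤ dist x y + 2 * |t - u| := by
  have h1 : H e t x - H e u y = Real.cos t • (x - y) + (Real.cos t - Real.cos u) • y
      + (Real.sin t - Real.sin u) • e := by
    unfold H; module
  rw [dist_eq_norm, dist_eq_norm, h1]
  have a1 : ‖Real.cos t • (x - y)‖ ≤ ‖x - y‖ := by
    rw [norm_smul]
    exact mul_le_of_le_one_left (norm_nonneg _) (Real.abs_cos_le_one t)
  have a2 : ‖(Real.cos t - Real.cos u) • y‖ ≤ |t - u| := by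
    rw [norm_smul, hy, mul_one]
    have := Real.lipschitzWith_cos.dist_le_mul t u
    simpa [Real.dist_eq] using this
  have a3 : ‖(Real.sin t - Real.sin u) • e‖ ≤ |t - u| := by
    rw [norm_smul, he, mul_one]
    have := Real.lipschitzWith_sin.dist_le_mul t u
    simpa [Real.dist_eq] using this
  have := norm_add₃_le (a := Real.cos t • (x - y)) (b := (Real.cos t - Real.cos u) • y)
    (c := (Real.sin t - Real.sin u) • e)
  linarith

/-- Contract a small cycle to a point of the next sphere. -/
lemma exists_fill {k : ℕ} (hk : k + 1 < n) {ε : ℝ} (hε : 0 < ε) {z : Ch E}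
    (hz : z ∈ Small n k ε) (hDz : D z = 0) :
    ∃ p ∈ Small n (k + 1) (2 * ε), D p = z := by
  set e : E := EuclideanSpace.single ⟨k + 1, hk⟩ 1 with he
  have hen : ‖e‖ = 1 := by simp [he]
  obtain ⟨N, hN⟩ := exists_nat_gt (Real.pi / ε)
  have hN0 : (0 : ℝ) < N := lt_trans (by positivity) hN
  set t : ℕ → ℝ := fun j => j * (Real.pi / 2 / N) with ht
  have hstep : ∀ j, |t j - t (j + 1)| < ε / 2 := by
    intro j
    have h1 : t j - t (j + 1) = - (Real.pi / 2 / N) := by simp only [ht]; push_cast; ring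
    rw [h1, abs_neg, abs_of_nonneg (by positivity), div_div, div_lt_iff₀ (by positivity)]
    rw [div_lt_iff₀ hε] at hN
    linarith
  have hpath : ∀ j : ℕ, ∃ p ∈ Small n (k + 1) (2 * ε), D p = z + mp (H e (t j)) z := by
    intro j
    induction j with
    | zero =>
      refine ⟨0, zero_mem _, ?_⟩
      have h0 : H e (t 0) = fun x => x := by
        funext x
        simp [H, ht]
      have h1 : mp (fun x : E => x) = LinearMap.id := by
        apply lin_ext
        intro l
        simp
      rw [h0, h1, LinearMap.id_apply, add_self2, map_zero]
    | succ j ih =>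
      obtain ⟨p, hp, hDp⟩ := ih
      refine ⟨p + P (H e (t j)) (H e (t (j + 1))) z, add_mem hp ?_, ?_⟩
      · refine map_Small _ ?_ hz
        intro l h1 h2 h3
        have h4 := pr_mem_Sp (H e (t j)) (H e (t (j + 1))) l
        rw [h1] at h4
        refine Sp_le_Small ?_ ?_ h4
        · rintro y ⟨x, hx, rfl | rfl⟩
          · exact H_mem hk (h2 x hx) _
          · exact H_mem hk (h2 x hx) _
        · have hb : ∀ a b, |a - b| < ε / 2 → ∀ x ∈ l, ∀ y ∈ l,
              dist (H e a x) (H e b y) < 2 * ε := by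
            intro a b hab x hx y hy
            have := dist_H_le e hen (x := x) (h2 y hy).1 a b
            have := h3 x hx y hy
            linarith
          have hst := hstep j
          rintro _ ⟨x, hx, rfl | rfl⟩ _ ⟨y, hy, rfl | rfl⟩
          · exact hb _ _ (by simpa using hε) x hx y hy
          · exact hb _ _ hst x hx y hy
          · exact hb _ _ (by rwa [abs_sub_comm]) x hx y hy
          · exact hb _ _ (by simpa using hε) x hx y hy
      · rw [map_add, hDp, D_P, hDz, map_zero, add_zero]
        exact add_cancel_mid _ _ _
  obtain ⟨p, hp, hDp⟩ := hpath N
  have hHN : H e (t N) = fun _ => e := by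
    have : t N = Real.pi / 2 := by simp only [ht]; field_simp
    funext x
    simp [H, this]
  rw [hHN] at hDp
  refine ⟨p + cone e (mp (fun _ => e) z), add_mem hp ?_, ?_⟩
  · refine map_Small (cone e ∘ₗ mp (fun _ => e)) ?_ hz
    intro l h1 h2 h3
    simp only [LinearMap.comp_apply, mp_sg, cone_sg]
    have hmem : ∀ x ∈ e :: l.map (fun _ => e), x = e := by
      intro x hx
      simp only [List.mem_cons, List.mem_map] at hx
      rcases hx with h | ⟨_, _, h⟩
      · exact h
      · exact h.symm
    refine sg_mem_Small (by simp [h1]) ?_ ?_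
    · intro x hx
      rw [hmem x hx]
      refine ⟨hen, ?_⟩
      intro j hj
      have hne : j ≠ ⟨k + 1, hk⟩ := by
        intro h; rw [h] at hj; simp at hj
      simp [he, hne]
    · intro x hx y hy
      rw [hmem x hx, hmem y hy, dist_self]
      linarith
  · rw [map_add, hDp, D_cone, D_mp, hDz, map_zero, map_zero, add_zero]
    exact add_cancel_end _ _

lemma Sub_ne_zero {k : ℕ} {x : E} (hx : x ∈ Sub n k) : x ≠ 0 := by
  intro h
  have := hx.1
  rw [h, norm_zero] at this
  exact zero_ne_one this

lemma A_neg {s : ℕ → E → ZMod 2} (hs : ∀ i x, x ≠ 0 → s i (-x) = s i x + 1) {k : ℕ} {ε : ℝ}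
    {c : Ch E} (hc : c ∈ Small n k ε) : A s (mp (fun x => -x) c) = A s c + W s c := by
  induction hc using Submodule.span_induction with
  | mem c hc =>
    obtain ⟨l, h1, h2, h3, rfl⟩ := hc
    rw [mp_sg]
    exact (AW_flip s _ l fun i x hx => hs i x (Sub_ne_zero (h2 x hx))).2
  | zero => simp
  | add c d _ _ h1 h2 => simp only [map_add, h1, h2]; ring
  | smul a c _ h => simp only [map_smul, h, smul_eq_mul]; ring

lemma exists_chain (k : ℕ) (hk : k < n) : ∀ ε : ℝ, 0 < ε → ∃ c ∈ Small n k ε,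
    D (c + mp (fun x => -x) c) = 0 ∧
    ∀ s : ℕ → E → ZMod 2, (∀ i x, x ≠ 0 → s i (-x) = s i x + 1) → W s c = 1 := by
  induction k with
  | zero =>
    intro ε hε
    set e : E := EuclideanSpace.single ⟨0, hk⟩ 1 with he
    refine ⟨sg [e], sg_mem_Small (by simp) ?_ ?_, ?_, ?_⟩
    · intro x hx
      rw [List.mem_singleton] at hx
      subst hx
      refine ⟨by simp [he], ?_⟩
      intro j hj
      have hne : j ≠ ⟨0, hk⟩ := by
        intro h; rw [h] at hj; simp at hj
      simp [he, hne]
    · intro x hx y hy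
      rw [List.mem_singleton] at hx hy
      rw [hx, hy, dist_self]
      exact hε
    · simp [D_cons, add_self2]
    · intro s _
      rw [W_cons, A_nil, W_nil]
      simp
  | succ k ih =>
    intro ε hε
    obtain ⟨c, hc, hD, hW⟩ := ih (by omega) (ε / 2) (by positivity)
    obtain ⟨p, hp, hDp⟩ := exists_fill hk (by positivity : 0 < ε / 2)
      (add_mem hc (neg_Small hc)) hD
    refine ⟨p, ?_, ?_, ?_⟩
    · rwa [mul_div_cancel₀ _ (two_ne_zero)] at hp
    · rw [map_add, D_mp, hDp, map_add, mp_neg_neg]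
      rw [add_cancel_mid, add_self2]
    · intro s hs
      rw [← A_D, hDp, map_add, A_neg hs hc, hW s hs]
      have := add_self2 (A s c)
      grind

/-- A sign function adapted to a compact set without antipodal pairs. -/
lemma exists_sign {K : Set E} (hK : IsCompact K) (hd : ∀ x ∈ K, -x ∉ K) :
    ∃ δ > 0, ∃ s : E → ZMod 2, (∀ x, x ≠ 0 → s (-x) = s x + 1) ∧
      ∀ x ∈ K, ∀ y, dist y x < δ → s y = 1 := by
  classical
  have hdis : Disjoint K (-K) := by
    rw [Set.disjoint_left]
    intro x hx hx'
    exact hd x hx hx'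
  obtain ⟨δ, hδ, hth⟩ := hdis.exists_thickenings hK hK.neg.isClosed
  rw [Set.disjoint_left] at hth
  have hneg : ∀ x, x ∈ Metric.thickening δ K → -x ∉ Metric.thickening δ K := by
    intro x hx hx'
    apply hth hx
    rw [Metric.mem_thickening_iff] at hx' ⊢
    obtain ⟨z, hz, h⟩ := hx'
    exact ⟨-z, by simpa using hz, by rwa [← dist_neg_neg, neg_neg]⟩
  let r : E → E → Prop := WellOrderingRel
  have hr : ∀ x, x ≠ 0 → (r (-x) x ↔ ¬ r x (-x)) := by
    intro x hx
    have hne : x ≠ -x := by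
      intro h
      have h2 : (2 : ℝ) • x = 0 := by
        rw [two_smul]
        nth_rewrite 2 [h]
        exact add_neg_cancel x
      exact hx ((smul_eq_zero.mp h2).resolve_left two_ne_zero)
    constructor
    · intro h h'
      exact asymm_of WellOrderingRel h h'
    · intro h
      rcases trichotomous_of WellOrderingRel x (-x) with h1 | h1 | h1
      · exact absurd h1 h
      · exact absurd h1 hne
      · exact h1
  let s : E → ZMod 2 := fun x =>
    if x ∈ Metric.thickening δ K then 1
    else if -x ∈ Metric.thickening δ K then 0
    else if r x (-x) then 1 else 0
  refine ⟨δ, hδ, s, ?_, ?_⟩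
  · intro x hx
    have h11 : (1 : ZMod 2) + 1 = 0 := by decide
    simp only [s, neg_neg]
    by_cases h1 : x ∈ Metric.thickening δ K
    · simp [h1, hneg x h1, h11]
    · by_cases h2 : -x ∈ Metric.thickening δ K
      · simp [h1, h2]
      · by_cases h3 : r x (-x) <;> simp [h1, h2, hr x hx, h3, h11]
  · intro x hx y hy
    have : y ∈ Metric.thickening δ K := Metric.mem_thickening_iff.mpr ⟨x, hx, hy⟩
    simp [s, this]

end geom
end BorsukAux

/-- Borsuk's theorem: if the sphere `S^{n-1} ⊂ ℝⁿ` is covered by `n` closed sets, then one of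
them contains a pair of antipodal points. -/
theorem borsuk_antipodal_of_cover
    (n : ℕ) (hn : 1 ≤ n) (F : Fin n → Set (EuclideanSpace ℝ (Fin n)))
    (hF : ∀ i, IsClosed (F i))
    (hcover : Metric.sphere (0 : EuclideanSpace ℝ (Fin n)) 1 ⊆ ⋃ i, F i) :
    ∃ (i : Fin n) (x : EuclideanSpace ℝ (Fin n)),
      ‖x‖ = 1 ∧ x ∈ F i ∧ -x ∈ F i := by
  by_contra hcon
  push Not at hcon
  have hsign : ∀ i : Fin n, ∃ δ > 0, ∃ s : EuclideanSpace ℝ (Fin n) → ZMod 2,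
      (∀ x, x ≠ 0 → s (-x) = s x + 1) ∧
      ∀ x ∈ F i ∩ Metric.sphere 0 1, ∀ y, dist y x < δ → s y = 1 := by
    intro i
    apply BorsukAux.exists_sign
    · exact (isCompact_sphere 0 1).inter_left (hF i)
    · rintro x ⟨hx, hx1⟩ ⟨hx', _⟩
      exact hcon i x (by simpa using hx1) hx hx'
  choose δ hδ s hs hs1 using hsign
  have : Nonempty (Fin n) := ⟨⟨0, hn⟩⟩
  obtain ⟨i0, hi0⟩ := Finite.exists_min δ
  let last : Fin n := ⟨n - 1, by omega⟩
  let s' : ℕ → EuclideanSpace ℝ (Fin n) → ZMod 2 :=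
    fun i => if h : i < n then s ⟨i, h⟩ else s last
  have hs' : ∀ i x, x ≠ 0 → s' i (-x) = s' i x + 1 := by
    intro i x hx
    by_cases h : i < n
    · simpa [s', h] using hs ⟨i, h⟩ x hx
    · simpa [s', h] using hs last x hx
  obtain ⟨c, hc, -, hW⟩ := BorsukAux.exists_chain (n := n) (n - 1) (by omega) (δ i0) (hδ i0)
  have hW1 := hW s' hs'
  have hW0 : BorsukAux.W s' c = 0 := by
    clear hW1 hW
    induction hc using Submodule.span_induction with
    | mem c hc =>
      obtain ⟨l, h1, h2, h3, rfl⟩ := hc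
      obtain ⟨x, hx⟩ : ∃ x, x ∈ l := by
        cases l with
        | nil => simp at h1
        | cons x l => exact ⟨x, by simp⟩
      have hxn : ‖x‖ = 1 := (h2 x hx).1
      obtain ⟨i, hi⟩ := Set.mem_iUnion.mp (hcover (show x ∈ Metric.sphere 0 1 by simpa using hxn))
      obtain ⟨j, hj⟩ := Set.mem_iUnion.mp
        (hcover (show -x ∈ Metric.sphere 0 1 by simpa using hxn))
      have hij : i ≠ j := by
        rintro rfl
        exact hcon i x hxn hi hj
      by_cases hin : i.1 + 1 < n
      · refine BorsukAux.W_eq_zero s' i.1 1 l (by omega) ?_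
        intro y hy
        have := hs1 i x ⟨hi, by simpa using hxn⟩ y ((h3 y hy x hx).trans_le (hi0 i))
        simpa [s'] using this
      · have hjn : j.1 + 1 < n := by
          have : i.1 ≠ j.1 := fun h => hij (Fin.ext h)
          omega
        refine BorsukAux.W_eq_zero s' j.1 0 l (by omega) ?_
        intro y hy
        have h5 := hs1 j (-x) ⟨hj, by simpa using hxn⟩ (-y)
          (by rw [dist_neg_neg]; exact (h3 y hy x hx).trans_le (hi0 j))
        rw [hs j y (BorsukAux.Sub_ne_zero (h2 y hy))] at h5
        have : s j y = 0 := by simpa using h5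
        simpa [s'] using this
    | zero => simp
    | add c d _ _ h1 h2 => rw [map_add, h1, h2, add_zero]
    | smul a c _ h => rw [map_smul, h, smul_zero]
  rw [hW0] at hW1
  exact zero_ne_one hW1
end

section
/- Every compact set F ⊆ ℝ² of positive diameter (with respect to the standard Euclidean metric) can be written as a union of three closed subsets, each of diameter strictly smaller than the diameter of F. -/
namespace BorsukTwo

/-- The linear functional in direction `θ`. -/
noncomputable def lf (θ : ℝ) (x : EuclideanSpace ℝ (Fin 2)) : ℝ :=
  x 0 * Real.cos θ + x 1 * Real.sin θ

/-- The support function of `F`. -/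
noncomputable def supp (F : Set (EuclideanSpace ℝ (Fin 2))) (θ : ℝ) : ℝ := sSup (lf θ '' F)

/-- The middle of the strip in direction `θ`. -/
noncomputable def mid (F : Set (EuclideanSpace ℝ (Fin 2))) (θ : ℝ) : ℝ :=
  (supp F θ - supp F (θ + Real.pi)) / 2

lemma lf_cont : Continuous (fun q : ℝ × EuclideanSpace ℝ (Fin 2) => lf q.1 q.2) := by
  unfold lf; fun_prop

lemma lf_cont' (θ : ℝ) : Continuous (lf θ) := by
  unfold lf; fun_prop

lemma supp_cont {F : Set (EuclideanSpace ℝ (Fin 2))} (hF : IsCompact F) :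
    Continuous (supp F) :=
  hF.continuous_sSup (f := lf) lf_cont

lemma mid_cont {F : Set (EuclideanSpace ℝ (Fin 2))} (hF : IsCompact F) :
    Continuous (mid F) := by
  have := supp_cont hF
  unfold mid; fun_prop

lemma dist_sq (x y : EuclideanSpace ℝ (Fin 2)) :
    dist x y ^ 2 = (x 0 - y 0) ^ 2 + (x 1 - y 1) ^ 2 := by
  rw [EuclideanSpace.dist_eq, Real.sq_sqrt (by positivity)]
  simp [Fin.sum_univ_two, Real.dist_eq, sq_abs]

lemma lf_pi (θ : ℝ) (x : EuclideanSpace ℝ (Fin 2)) : lf (θ + Real.pi) x = - lf θ x := by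
  unfold lf; rw [Real.cos_add_pi, Real.sin_add_pi]; ring

lemma lf_sub_le (θ : ℝ) (x y : EuclideanSpace ℝ (Fin 2)) : lf θ x - lf θ y ≤ dist x y := by
  refine le_of_abs_le (abs_le_of_sq_le_sq ?_ dist_nonneg)
  rw [dist_sq]
  unfold lf
  have hS : Real.sin θ ^ 2 = 1 - Real.cos θ ^ 2 := Real.sin_sq θ
  have := sq_nonneg ((x 0 - y 0) * Real.sin θ - (x 1 - y 1) * Real.cos θ)
  have e : (x 0 * Real.cos θ + x 1 * Real.sin θ - (y 0 * Real.cos θ + y 1 * Real.sin θ)) ^ 2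
      + ((x 0 - y 0) * Real.sin θ - (x 1 - y 1) * Real.cos θ) ^ 2
      = ((x 0 - y 0) ^ 2 + (x 1 - y 1) ^ 2) * (Real.sin θ ^ 2 + Real.cos θ ^ 2) := by ring
  rw [Real.sin_sq_add_cos_sq] at e
  linarith

lemma mid_bound {F : Set (EuclideanSpace ℝ (Fin 2))} (hF : IsCompact F) (θ : ℝ)
    {x : EuclideanSpace ℝ (Fin 2)} (hx : x ∈ F) :
    |lf θ x - mid F θ| ≤ Metric.diam F / 2 := by
  have hc : ∀ φ, IsCompact (lf φ '' F) := fun φ => hF.image (lf_cont' φ)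
  have hne : ∀ φ, (lf φ '' F).Nonempty := fun φ => ⟨_, x, hx, rfl⟩
  have h1 : lf θ x ≤ supp F θ := le_csSup (hc θ).bddAbove ⟨x, hx, rfl⟩
  have h2 : lf (θ + Real.pi) x ≤ supp F (θ + Real.pi) := le_csSup (hc _).bddAbove ⟨x, hx, rfl⟩
  obtain ⟨y, hy, hy'⟩ := (hc θ).sSup_mem (hne θ)
  obtain ⟨z, hz, hz'⟩ := (hc (θ + Real.pi)).sSup_mem (hne _)
  change _ = supp F θ at hy'
  change _ = supp F (θ + Real.pi) at hz'
  have h3 := lf_sub_le θ y z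
  have h4 := Metric.dist_le_diam_of_mem hF.isBounded hy hz
  rw [lf_pi] at h2 hz'
  unfold mid
  rw [abs_le]
  constructor <;> linarith

lemma cos_a (θ : ℝ) : Real.cos (θ + 2 * Real.pi / 3)
    = - Real.cos θ / 2 - Real.sqrt 3 / 2 * Real.sin θ := by
  have : θ + 2 * Real.pi / 3 = θ + Real.pi - Real.pi / 3 := by ring
  rw [this, Real.cos_sub, Real.cos_add_pi, Real.sin_add_pi, Real.cos_pi_div_three,
    Real.sin_pi_div_three]; ring

lemma sin_a (θ : ℝ) : Real.sin (θ + 2 * Real.pi / 3)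
    = - Real.sin θ / 2 + Real.sqrt 3 / 2 * Real.cos θ := by
  have : θ + 2 * Real.pi / 3 = θ + Real.pi - Real.pi / 3 := by ring
  rw [this, Real.sin_sub, Real.cos_add_pi, Real.sin_add_pi, Real.cos_pi_div_three,
    Real.sin_pi_div_three]; ring

lemma cos_b (θ : ℝ) : Real.cos (θ + 4 * Real.pi / 3)
    = - Real.cos θ / 2 + Real.sqrt 3 / 2 * Real.sin θ := by
  have : θ + 4 * Real.pi / 3 = θ + Real.pi + Real.pi / 3 := by ring
  rw [this, Real.cos_add, Real.cos_add_pi, Real.sin_add_pi, Real.cos_pi_div_three,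
    Real.sin_pi_div_three]; ring

lemma sin_b (θ : ℝ) : Real.sin (θ + 4 * Real.pi / 3)
    = - Real.sin θ / 2 - Real.sqrt 3 / 2 * Real.cos θ := by
  have : θ + 4 * Real.pi / 3 = θ + Real.pi + Real.pi / 3 := by ring
  rw [this, Real.sin_add, Real.cos_add_pi, Real.sin_add_pi, Real.cos_pi_div_three,
    Real.sin_pi_div_three]; ring

lemma lf_sum (θ : ℝ) (x : EuclideanSpace ℝ (Fin 2)) :
    lf θ x + lf (θ + 2 * Real.pi / 3) x + lf (θ + 4 * Real.pi / 3) x = 0 := by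
  unfold lf; rw [cos_a, sin_a, cos_b, sin_b]; ring

lemma dist_sq_lf (θ : ℝ) (x y : EuclideanSpace ℝ (Fin 2)) :
    dist x y ^ 2 = 2 / 3 * ((lf θ x - lf θ y) ^ 2
      + (lf (θ + 2 * Real.pi / 3) x - lf (θ + 2 * Real.pi / 3) y) ^ 2
      + (lf (θ + 4 * Real.pi / 3) x - lf (θ + 4 * Real.pi / 3) y) ^ 2) := by
  unfold lf; rw [cos_a, sin_a, cos_b, sin_b, dist_sq]
  have h3 : Real.sqrt 3 ^ 2 = 3 := Real.sq_sqrt (by norm_num)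
  have hS : Real.sin θ ^ 2 = 1 - Real.cos θ ^ 2 := Real.sin_sq θ
  ring_nf
  rw [h3, hS]
  ring

lemma exists_zero {F : Set (EuclideanSpace ℝ (Fin 2))} (hF : IsCompact F) :
    ∃ θ, mid F θ + mid F (θ + 2 * Real.pi / 3) + mid F (θ + 4 * Real.pi / 3) = 0 := by
  have hm := mid_cont hF
  have hper : ∀ θ, supp F (θ + Real.pi + Real.pi) = supp F θ := by
    intro θ
    unfold supp
    congr 1
    apply Set.image_congr
    intro x _
    rw [lf_pi, lf_pi, neg_neg]
  have hneg : ∀ θ, mid F (θ + Real.pi) = - mid F θ := by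
    intro θ; unfold mid; rw [hper]; ring
  set G : ℝ → ℝ := fun θ =>
    mid F θ + mid F (θ + 2 * Real.pi / 3) + mid F (θ + 4 * Real.pi / 3) with hG
  have hGc : Continuous G := by fun_prop
  have hGn : G Real.pi = - G 0 := by
    simp only [hG]
    rw [show Real.pi + 2 * Real.pi / 3 = (0 + 2 * Real.pi / 3) + Real.pi by ring,
      show Real.pi + 4 * Real.pi / 3 = (0 + 4 * Real.pi / 3) + Real.pi by ring, hneg, hneg]
    have := hneg 0
    rw [zero_add] at this
    rw [this]; ring
  rcases le_total (G 0) 0 with h | h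
  · exact mem_range_of_exists_le_of_exists_ge hGc ⟨0, h⟩ ⟨Real.pi, by linarith⟩
  · exact mem_range_of_exists_le_of_exists_ge hGc ⟨Real.pi, by linarith⟩ ⟨0, h⟩

lemma quad {r X Y : ℝ} (hX : X ^ 2 ≤ (3 / 2 * r) ^ 2) (hY : Y ^ 2 ≤ (3 / 2 * r) ^ 2)
    (hZ : (-(X + Y)) ^ 2 ≤ r ^ 2) :
    2 / 3 * (X ^ 2 + Y ^ 2 + (-(X + Y)) ^ 2) ≤ 3 * r ^ 2 := by
  have hr := sq_nonneg r
  rcases le_total 0 (X * Y) with h | h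
  · linarith
  · rcases le_total 0 (Y * (X + Y)) with c | c
    · have : X * (X + Y) ≤ 0 ∨ Y * (X + Y) ≤ 0 := by
        by_contra! hc
        nlinarith [mul_pos hc.1 hc.2, mul_nonneg (neg_nonneg.2 h) (sq_nonneg (X + Y))]
      rcases this with e | e <;> linarith
    · linarith

/-- Points of the pentagon where `w` is the least coordinate. -/
lemma pentagon {r s t w s' t' w' : ℝ} (h : s + t + w = 0) (h' : s' + t' + w' = 0)
    (hs : |s| ≤ r) (ht : |t| ≤ r) (hw : |w| ≤ r)
    (hs' : |s'| ≤ r) (ht' : |t'| ≤ r) (hw' : |w'| ≤ r)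
    (h1 : w ≤ s) (h2 : w ≤ t) (h1' : w' ≤ s') (h2' : w' ≤ t') :
    2 / 3 * ((s - s') ^ 2 + (t - t') ^ 2 + (w - w') ^ 2) ≤ 3 * r ^ 2 := by
  rw [abs_le] at *
  have hX : |s - s'| ≤ 3 / 2 * r := by rw [abs_le]; constructor <;> linarith
  have hY : |t - t'| ≤ 3 / 2 * r := by rw [abs_le]; constructor <;> linarith
  have hZ : |w - w'| ≤ r := by rw [abs_le]; constructor <;> linarith
  have hX2 := sq_le_sq' (abs_le.1 hX).1 (abs_le.1 hX).2
  have hY2 := sq_le_sq' (abs_le.1 hY).1 (abs_le.1 hY).2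
  have hZ2 := sq_le_sq' (abs_le.1 hZ).1 (abs_le.1 hZ).2
  have hw0 : w - w' = -((s - s') + (t - t')) := by linarith
  rw [hw0] at hZ2 ⊢
  have := quad hX2 hY2 hZ2
  linarith

lemma diam_piece {F A : Set (EuclideanSpace ℝ (Fin 2))} (hd : 0 < Metric.diam F)
    (h : ∀ x ∈ A, ∀ y ∈ A, dist x y ^ 2 ≤ 3 * (Metric.diam F / 2) ^ 2) :
    Metric.diam A < Metric.diam F := by
  refine lt_of_le_of_lt (b := 9 / 10 * Metric.diam F) ?_ (by linarith)
  apply Metric.diam_le_of_forall_dist_le (by positivity)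
  intro x hx y hy
  have := h x hx y hy
  refine le_of_abs_le (abs_le_of_sq_le_sq ?_ (by positivity))
  nlinarith [sq_nonneg (Metric.diam F)]

end BorsukTwo

open BorsukTwo in
/-- Borsuk's conjecture in dimension 2: every compact subset of the Euclidean plane of
positive diameter is the union of three closed sets of strictly smaller diameter. -/
theorem borsuk_dim_two
    (F : Set (EuclideanSpace ℝ (Fin 2))) (hF : IsCompact F) (hd : 0 < Metric.diam F) :
    ∃ A B C : Set (EuclideanSpace ℝ (Fin 2)),
      IsClosed A ∧ IsClosed B ∧ IsClosed C ∧ F = A ∪ B ∪ C ∧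
      Metric.diam A < Metric.diam F ∧ Metric.diam B < Metric.diam F ∧
      Metric.diam C < Metric.diam F := by
  obtain ⟨θ, hθ⟩ := exists_zero hF
  let s : EuclideanSpace ℝ (Fin 2) → ℝ := fun x => lf θ x - mid F θ
  let t : EuclideanSpace ℝ (Fin 2) → ℝ :=
    fun x => lf (θ + 2 * Real.pi / 3) x - mid F (θ + 2 * Real.pi / 3)
  let w : EuclideanSpace ℝ (Fin 2) → ℝ :=
    fun x => lf (θ + 4 * Real.pi / 3) x - mid F (θ + 4 * Real.pi / 3)
  have hsc : Continuous s := (lf_cont' _).sub continuous_const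
  have htc : Continuous t := (lf_cont' _).sub continuous_const
  have hwc : Continuous w := (lf_cont' _).sub continuous_const
  have hs : ∀ x ∈ F, |s x| ≤ Metric.diam F / 2 := fun x hx => mid_bound hF _ hx
  have ht : ∀ x ∈ F, |t x| ≤ Metric.diam F / 2 := fun x hx => mid_bound hF _ hx
  have hw : ∀ x ∈ F, |w x| ≤ Metric.diam F / 2 := fun x hx => mid_bound hF _ hx
  have hsum : ∀ x, s x + t x + w x = 0 := by
    intro x
    have := lf_sum θ x
    simp only [s, t, w]; linarith
  have hdist : ∀ x y, dist x y ^ 2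
      = 2 / 3 * ((s x - s y) ^ 2 + (t x - t y) ^ 2 + (w x - w y) ^ 2) := by
    intro x y
    rw [dist_sq_lf θ]; simp only [s, t, w]; ring
  clear_value s t w
  have hcl := hF.isClosed
  refine ⟨F ∩ {x | s x ≤ t x ∧ s x ≤ w x}, F ∩ {x | t x ≤ s x ∧ t x ≤ w x},
    F ∩ {x | w x ≤ s x ∧ w x ≤ t x},
    hcl.inter ((isClosed_le hsc htc).inter (isClosed_le hsc hwc)),
    hcl.inter ((isClosed_le htc hsc).inter (isClosed_le htc hwc)),
    hcl.inter ((isClosed_le hwc hsc).inter (isClosed_le hwc htc)), ?_,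
    diam_piece hd ?_, diam_piece hd ?_, diam_piece hd ?_⟩
  · ext x
    simp only [Set.mem_union, Set.mem_inter_iff, Set.mem_ofPred_eq]
    rcases le_total (s x) (t x) with a | a <;> rcases le_total (s x) (w x) with b | b <;>
      rcases le_total (t x) (w x) with c | c <;> grind
  · rintro x ⟨hx, a, b⟩ y ⟨hy, a', b'⟩
    have := pentagon (s := t x) (t := w x) (w := s x) (s' := t y) (t' := w y) (w' := s y)
      (by linarith [hsum x]) (by linarith [hsum y])
      (ht x hx) (hw x hx) (hs x hx) (ht y hy) (hw y hy) (hs y hy) a b a' b'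
    rw [hdist]; linarith
  · rintro x ⟨hx, a, b⟩ y ⟨hy, a', b'⟩
    have := pentagon (s := s x) (t := w x) (w := t x) (s' := s y) (t' := w y) (w' := t y)
      (by linarith [hsum x]) (by linarith [hsum y])
      (hs x hx) (hw x hx) (ht x hx) (hs y hy) (hw y hy) (ht y hy) a b a' b'
    rw [hdist]; linarith
  · rintro x ⟨hx, a, b⟩ y ⟨hy, a', b'⟩
    have := pentagon (hsum x) (hsum y)
      (hs x hx) (ht x hx) (hw x hx) (hs y hy) (ht y hy) (hw y hy) a b a' b'
    rw [hdist]; linarith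
end

section
/- Every compact set F ⊆ ℝ³ of positive diameter (with respect to the standard Euclidean metric) can be written as a union of four closed subsets, each of diameter strictly smaller than the diameter of F. -/
/-!
Proof outline (after Gale and Grünbaum).  A set of diameter `D` fits in a regular octahedron whose
opposite faces are at distance `D` (intermediate value theorem along a rotation by a quarter turn),
one vertex of each of the three antipodal pairs of which may be cut off.  The truncated octahedron
is then split into four explicit convex pieces of diameter `< D`.
-/

namespace BorsukThree

/-- Elementary bound on the coordinate differences, main case. -/
theorem bound_a (X Y Z : ℝ) (hX : 0 ≤ X) (hZ : 0 ≤ Z) (hZY : Z ≤ Y)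
    (h1 : 2 * Y + Z ≤ 2.0772) (h2 : X + Y + Z ≤ 1.4222) (h3 : X + Y ≤ 1.2111)
    (h4 : Y ≤ 0.93305) (h5 : X ≤ 0.7111) : X ^ 2 + Y ^ 2 + Z ^ 2 ≤ 0.9975 := by
  rcases le_total Y 0.5 with hY | hY
  · nlinarith [mul_nonneg hX (sub_nonneg.2 h5), mul_nonneg hZ (sub_nonneg.2 (hZY.trans hY)),
      mul_nonneg (hZ.trans hZY) (sub_nonneg.2 hY)]
  rcases le_total Z 0.2111 with hZ' | hZ'
  · have a : X ^ 2 ≤ (1.2111 - Y) ^ 2 := pow_le_pow_left₀ hX (by linarith) 2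
    have b : Z ^ 2 ≤ 0.2111 ^ 2 := pow_le_pow_left₀ hZ hZ' 2
    nlinarith [mul_nonneg (sub_nonneg.2 hY) (sub_nonneg.2 h4)]
  · have a : X ^ 2 ≤ (1.4222 - Y - Z) ^ 2 := pow_le_pow_left₀ hX (by linarith) 2
    have b : Y ^ 2 + Z ^ 2 + (1.4222 - Y - Z) ^ 2 ≤ 0.9975 := by
      clear a h2 h3 h5 hX
      nlinarith [mul_nonneg (sub_nonneg.2 hZ') (sub_nonneg.2 hZY),
        mul_nonneg (sub_nonneg.2 hZ') (sub_nonneg.2 h1),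
        mul_nonneg (sub_nonneg.2 hZ') (sub_nonneg.2 hY),
        mul_nonneg (sub_nonneg.2 hZY) (sub_nonneg.2 h1),
        mul_nonneg (sub_nonneg.2 hZY) (sub_nonneg.2 hY),
        mul_nonneg (sub_nonneg.2 h1) (sub_nonneg.2 hY)]
    linarith

theorem bound_b (X Y Z : ℝ) (hX : 0 ≤ X) (hZ : 0 ≤ Z) (hZY : Z ≤ Y)
    (h1 : Y + Z ≤ 1.2885) (h3 : X + Y ≤ 0.8661) : X ^ 2 + Y ^ 2 + Z ^ 2 ≤ 0.9975 := by
  nlinarith [mul_nonneg hX hZ, mul_nonneg hX (sub_nonneg.2 hZY), mul_nonneg hZ (sub_nonneg.2 hZY),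
    mul_nonneg hX (sub_nonneg.2 h1),
    mul_nonneg hX (sub_nonneg.2 h3), mul_nonneg hZ (sub_nonneg.2 h1),
    mul_nonneg hZ (sub_nonneg.2 h3),
    mul_nonneg (sub_nonneg.2 hZY) (sub_nonneg.2 h1),
    mul_nonneg (sub_nonneg.2 hZY) (sub_nonneg.2 h3),
    mul_nonneg (sub_nonneg.2 h1) (sub_nonneg.2 h3)]

theorem bound_c (X Y Z : ℝ) (hX : 0 ≤ X) (hZ : 0 ≤ Z) (hZY : Z ≤ Y)
    (h1 : 2 * Y + Z ≤ 2.04915) (h3 : X + Y ≤ 0.8661) : X ^ 2 + Y ^ 2 + Z ^ 2 ≤ 0.9975 := by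
  nlinarith [mul_nonneg hX hZ, mul_nonneg hX (sub_nonneg.2 hZY), mul_nonneg hZ (sub_nonneg.2 hZY),
    mul_nonneg hX (sub_nonneg.2 h1),
    mul_nonneg hX (sub_nonneg.2 h3), mul_nonneg hZ (sub_nonneg.2 h1),
    mul_nonneg hZ (sub_nonneg.2 h3),
    mul_nonneg (sub_nonneg.2 hZY) (sub_nonneg.2 h1),
    mul_nonneg (sub_nonneg.2 hZY) (sub_nonneg.2 h3),
    mul_nonneg (sub_nonneg.2 h1) (sub_nonneg.2 h3)]

theorem bound_d (X Y Z : ℝ) (hX : 0 ≤ X) (hY : 0 ≤ Y) (hZ : 0 ≤ Z) (h1 : X ≤ 0.655)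
    (h2 : Y ≤ 0.655) (h3 : Z ≤ 0.655) (h : X + Y + Z ≤ 1.6761) :
    X ^ 2 + Y ^ 2 + Z ^ 2 ≤ 0.9975 := by
  nlinarith [mul_nonneg (sub_nonneg.2 h1) (sub_nonneg.2 h2),
    mul_nonneg (sub_nonneg.2 h1) (sub_nonneg.2 h3), mul_nonneg (sub_nonneg.2 h2) (sub_nonneg.2 h3),
    mul_nonneg hX (sub_nonneg.2 h1), mul_nonneg hY (sub_nonneg.2 h2),
    mul_nonneg hZ (sub_nonneg.2 h3), mul_nonneg hX (sub_nonneg.2 h),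
    mul_nonneg hY (sub_nonneg.2 h), mul_nonneg hZ (sub_nonneg.2 h)]

/-- The truncated octahedron. -/
structure Oct (x y z : ℝ) : Prop where
  ppp : x + y + z ≤ 0.8661
  ppm : x + y - z ≤ 0.8661
  pmp : x - y + z ≤ 0.8661
  pmm : x - y - z ≤ 0.8661
  mpp : -x + y + z ≤ 0.8661
  mpm : -x + y - z ≤ 0.8661
  mmp : -x - y + z ≤ 0.8661
  mmm : -x - y - z ≤ 0.8661
  hx : x ≤ 1 / 2
  hy : y ≤ 1 / 2
  hz : z ≤ 1 / 2

/-- The piece around an uncut vertex. -/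
structure Piece (x y z : ℝ) : Prop extends Oct x y z where
  hxy : x ≤ y
  hxz : x ≤ z
  hg : x ≤ -0.155

/-- The piece around the face between the three cut vertices. -/
structure Core (x y z : ℝ) : Prop extends Oct x y z where
  gx : -0.155 ≤ x
  gy : -0.155 ≤ y
  gz : -0.155 ≤ z

theorem Oct.rot {x y z : ℝ} (h : Oct x y z) : Oct y z x := by
  obtain ⟨_, _, _, _, _, _, _, _, _, _, _⟩ := h
  constructor <;> linarith

theorem Oct.swap {x y z : ℝ} (h : Oct x y z) : Oct x z y := by
  obtain ⟨_, _, _, _, _, _, _, _, _, _, _⟩ := h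
  constructor <;> linarith

theorem Piece.swap {x y z : ℝ} (h : Piece x y z) : Piece x z y :=
  { h.toOct.swap with hxy := h.hxz, hxz := h.hxy, hg := h.hg }

theorem core_bound {x y z u v w : ℝ} (h : Core x y z) (k : Core u v w) :
    (x - u) ^ 2 + (y - v) ^ 2 + (z - w) ^ 2 ≤ 0.9975 := by
  obtain ⟨⟨_, _, _, _, _, _, _, _, _, _, _⟩, _, _, _⟩ := h
  obtain ⟨⟨_, _, _, _, _, _, _, _, _, _, _⟩, _, _, _⟩ := k
  rw [← sq_abs (x - u), ← sq_abs (y - v), ← sq_abs (z - w)]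
  apply bound_d _ _ _ (abs_nonneg _) (abs_nonneg _) (abs_nonneg _)
  · rw [abs_le]; constructor <;> linarith
  · rw [abs_le]; constructor <;> linarith
  · rw [abs_le]; constructor <;> linarith
  · rcases abs_cases (x - u) with ⟨e, _⟩ | ⟨e, _⟩ <;> rcases abs_cases (y - v) with ⟨f, _⟩ | ⟨f, _⟩ <;>
      rcases abs_cases (z - w) with ⟨g, _⟩ | ⟨g, _⟩ <;> rw [e, f, g] <;> linarith

theorem piece_bound_aux {x y z u v w : ℝ} (h : Piece x y z) (k : Piece u v w)
    (hv : 0 ≤ y - v) (h1 : z - w ≤ y - v) (h2 : -(z - w) ≤ y - v) :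
    (x - u) ^ 2 + (y - v) ^ 2 + (z - w) ^ 2 ≤ 0.9975 := by
  obtain ⟨⟨_, _, _, _, _, _, _, _, _, _, _⟩, _, _, _⟩ := h
  obtain ⟨⟨_, _, _, _, _, _, _, _, _, _, _⟩, _, _, _⟩ := k
  rcases le_total 0 (x - u) with hx | hx <;> rcases le_total 0 (z - w) with hz | hz
  · apply bound_a <;> linarith
  · rw [← neg_sq (z - w)]
    apply bound_a <;> linarith
  · rw [← neg_sq (x - u)]
    apply bound_b <;> linarith
  · rw [← neg_sq (z - w), ← neg_sq (x - u)]
    apply bound_c <;> linarith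

theorem piece_bound {x y z u v w : ℝ} (h : Piece x y z) (k : Piece u v w) :
    (x - u) ^ 2 + (y - v) ^ 2 + (z - w) ^ 2 ≤ 0.9975 := by
  rcases le_total 0 (y - v) with a | a <;> rcases le_total 0 (z - w) with b | b <;>
    rcases le_total (|y - v|) (|z - w|) with c | c <;>
    simp only [abs_of_nonneg, abs_of_nonpos, a, b] at c
  all_goals first
    | exact piece_bound_aux h k (by linarith) (by linarith) (by linarith)
    | linarith [piece_bound_aux k h (by linarith) (by linarith) (by linarith)]
    | linarith [piece_bound_aux h.swap k.swap (by linarith) (by linarith) (by linarith)]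
    | linarith [piece_bound_aux k.swap h.swap (by linarith) (by linarith) (by linarith)]

theorem cover {x y z : ℝ} (h : Oct x y z) :
    Piece x y z ∨ Piece y z x ∨ Piece z x y ∨ Core x y z := by
  by_cases hc : -0.155 ≤ x ∧ -0.155 ≤ y ∧ -0.155 ≤ z
  · exact Or.inr (Or.inr (Or.inr ⟨h, hc.1, hc.2.1, hc.2.2⟩))
  rcases le_total x y with a | a <;> rcases le_total y z with b | b <;>
    rcases le_total x z with c | c
  all_goals first
    | exact Or.inl ⟨h, by linarith, by linarith,
        by by_contra hh; exact hc ⟨by linarith, by linarith, by linarith⟩⟩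
    | exact Or.inr (Or.inl ⟨h.rot, by linarith, by linarith,
        by by_contra hh; exact hc ⟨by linarith, by linarith, by linarith⟩⟩)
    | exact Or.inr (Or.inr (Or.inl ⟨h.rot.rot, by linarith, by linarith,
        by by_contra hh; exact hc ⟨by linarith, by linarith, by linarith⟩⟩))

/-- Euclidean three-space. -/
abbrev E3 := EuclideanSpace ℝ (Fin 3)

theorem isClosed_piece {X Y Z : E3 → ℝ} (hX : Continuous X) (hY : Continuous Y)
    (hZ : Continuous Z) {F : Set E3} (hF : IsClosed F) (hO : ∀ p ∈ F, Oct (X p) (Y p) (Z p)) :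
    IsClosed {p | p ∈ F ∧ Piece (X p) (Y p) (Z p)} := by
  have : {p | p ∈ F ∧ Piece (X p) (Y p) (Z p)} =
      F ∩ ({p | X p ≤ Y p} ∩ ({p | X p ≤ Z p} ∩ {p | X p ≤ -0.155})) := by
    ext p
    constructor
    · rintro ⟨h, k⟩
      exact ⟨h, k.hxy, k.hxz, k.hg⟩
    · rintro ⟨h, a, b, c⟩
      exact ⟨h, hO p h, a, b, c⟩
  rw [this]
  exact hF.inter ((isClosed_le hX hY).inter ((isClosed_le hX hZ).inter
    (isClosed_le hX continuous_const)))

theorem isClosed_core {X Y Z : E3 → ℝ} (hX : Continuous X) (hY : Continuous Y)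
    (hZ : Continuous Z) {F : Set E3} (hF : IsClosed F) (hO : ∀ p ∈ F, Oct (X p) (Y p) (Z p)) :
    IsClosed {p | p ∈ F ∧ Core (X p) (Y p) (Z p)} := by
  have : {p | p ∈ F ∧ Core (X p) (Y p) (Z p)} =
      F ∩ ({p | -0.155 ≤ X p} ∩ ({p | -0.155 ≤ Y p} ∩ {p | -0.155 ≤ Z p})) := by
    ext p
    constructor
    · rintro ⟨h, k⟩
      exact ⟨h, k.gx, k.gy, k.gz⟩
    · rintro ⟨h, a, b, c⟩
      exact ⟨h, hO p h, a, b, c⟩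
  rw [this]
  exact hF.inter ((isClosed_le continuous_const hX).inter ((isClosed_le continuous_const hY).inter
    (isClosed_le continuous_const hZ)))

theorem diam_lt {S : Set E3} {D : ℝ} (hD : 0 < D)
    (h : ∀ p ∈ S, ∀ q ∈ S, dist p q ^ 2 ≤ 0.9975 * D ^ 2) : Metric.diam S < D := by
  have : Metric.diam S ≤ 0.999 * D := by
    apply Metric.diam_le_of_forall_dist_le (by positivity)
    intro p hp q hq
    refine (pow_le_pow_iff_left₀ dist_nonneg (by positivity) two_ne_zero).1 ?_
    nlinarith [h p hp q hq, sq_nonneg D]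
  linarith

/-- Splitting, given coordinates that put `F` into the truncated octahedron. -/
theorem split_of_coords {F : Set E3} (hF : IsClosed F) {D : ℝ} (hD : 0 < D) {X Y Z : E3 → ℝ}
    (hX : Continuous X) (hY : Continuous Y) (hZ : Continuous Z)
    (hdist : ∀ p q, dist p q ^ 2 = D ^ 2 * ((X p - X q) ^ 2 + (Y p - Y q) ^ 2 + (Z p - Z q) ^ 2))
    (hO : ∀ p ∈ F, Oct (X p) (Y p) (Z p)) :
    ∃ A B C G : Set E3,
      IsClosed A ∧ IsClosed B ∧ IsClosed C ∧ IsClosed G ∧ F = A ∪ B ∪ C ∪ G ∧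
      Metric.diam A < D ∧ Metric.diam B < D ∧ Metric.diam C < D ∧ Metric.diam G < D := by
  refine ⟨{p | p ∈ F ∧ Piece (X p) (Y p) (Z p)}, {p | p ∈ F ∧ Piece (Y p) (Z p) (X p)},
    {p | p ∈ F ∧ Piece (Z p) (X p) (Y p)}, {p | p ∈ F ∧ Core (X p) (Y p) (Z p)},
    isClosed_piece hX hY hZ hF hO, isClosed_piece hY hZ hX hF fun p hp => (hO p hp).rot,
    isClosed_piece hZ hX hY hF fun p hp => (hO p hp).rot.rot, isClosed_core hX hY hZ hF hO,
    ?_, ?_, ?_, ?_, ?_⟩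
  · ext p
    constructor
    · intro hp
      rcases cover (hO p hp) with h | h | h | h
      · exact Or.inl (Or.inl (Or.inl ⟨hp, h⟩))
      · exact Or.inl (Or.inl (Or.inr ⟨hp, h⟩))
      · exact Or.inl (Or.inr ⟨hp, h⟩)
      · exact Or.inr ⟨hp, h⟩
    · rintro (((h | h) | h) | h) <;> exact h.1
  · apply diam_lt hD
    rintro p ⟨-, hp⟩ q ⟨-, hq⟩
    rw [hdist]
    nlinarith [mul_le_mul_of_nonneg_left (piece_bound hp hq) (sq_nonneg D)]
  · apply diam_lt hD
    rintro p ⟨-, hp⟩ q ⟨-, hq⟩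
    rw [hdist]
    nlinarith [mul_le_mul_of_nonneg_left (piece_bound hp hq) (sq_nonneg D)]
  · apply diam_lt hD
    rintro p ⟨-, hp⟩ q ⟨-, hq⟩
    rw [hdist]
    nlinarith [mul_le_mul_of_nonneg_left (piece_bound hp hq) (sq_nonneg D)]
  · apply diam_lt hD
    rintro p ⟨-, hp⟩ q ⟨-, hq⟩
    rw [hdist]
    nlinarith [mul_le_mul_of_nonneg_left (core_bound hp hq) (sq_nonneg D)]

/-- One of two opposite vertices can be cut off. -/
theorem exists_sign {F : Set E3} {X : E3 → ℝ} (h : ∀ p ∈ F, ∀ q ∈ F, X p - X q ≤ 1) :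
    ∃ σ : ℝ, (σ = 1 ∨ σ = -1) ∧ ∀ p ∈ F, σ * X p ≤ 1 / 2 := by
  by_cases k : ∀ p ∈ F, X p ≤ 1 / 2
  · exact ⟨1, Or.inl rfl, fun p hp => by linarith [k p hp]⟩
  · push Not at k
    obtain ⟨q, hq, hk⟩ := k
    exact ⟨-1, Or.inr rfl, fun p hp => by linarith [h q hq p hp]⟩

/-- Splitting, given coordinates that put `F` into the octahedron. -/
theorem split_of_octahedron {F : Set E3} (hF : IsClosed F) {D : ℝ} (hD : 0 < D) {X Y Z : E3 → ℝ}
    (hX : Continuous X) (hY : Continuous Y) (hZ : Continuous Z)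
    (hdist : ∀ p q, dist p q ^ 2 = D ^ 2 * ((X p - X q) ^ 2 + (Y p - Y q) ^ 2 + (Z p - Z q) ^ 2))
    (hle : ∀ p ∈ F, ∀ q ∈ F, dist p q ≤ D)
    (h1 : ∀ p ∈ F, |X p + Y p + Z p| ≤ 0.8661) (h2 : ∀ p ∈ F, |X p - Y p - Z p| ≤ 0.8661)
    (h3 : ∀ p ∈ F, |-X p + Y p - Z p| ≤ 0.8661) (h4 : ∀ p ∈ F, |-X p - Y p + Z p| ≤ 0.8661) :
    ∃ A B C G : Set E3,
      IsClosed A ∧ IsClosed B ∧ IsClosed C ∧ IsClosed G ∧ F = A ∪ B ∪ C ∪ G ∧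
      Metric.diam A < D ∧ Metric.diam B < D ∧ Metric.diam C < D ∧ Metric.diam G < D := by
  have key : ∀ p ∈ F, ∀ q ∈ F, (X p - X q) ^ 2 + (Y p - Y q) ^ 2 + (Z p - Z q) ^ 2 ≤ 1 := by
    intro p hp q hq
    have a := hdist p q
    have b : dist p q ^ 2 ≤ D ^ 2 := pow_le_pow_left₀ dist_nonneg (hle p hp q hq) 2
    rw [a] at b
    have c : 0 < D ^ 2 := by positivity
    by_contra hh
    push Not at hh
    nlinarith
  obtain ⟨σ, hσ, hσX⟩ := exists_sign (F := F) (X := X) fun p hp q hq => by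
    nlinarith [key p hp q hq, sq_nonneg (Y p - Y q), sq_nonneg (Z p - Z q)]
  obtain ⟨τ, hτ, hτY⟩ := exists_sign (F := F) (X := Y) fun p hp q hq => by
    nlinarith [key p hp q hq, sq_nonneg (X p - X q), sq_nonneg (Z p - Z q)]
  obtain ⟨ρ, hρ, hρZ⟩ := exists_sign (F := F) (X := Z) fun p hp q hq => by
    nlinarith [key p hp q hq, sq_nonneg (Y p - Y q), sq_nonneg (X p - X q)]
  refine split_of_coords hF hD (X := fun p => σ * X p) (Y := fun p => τ * Y p)
    (Z := fun p => ρ * Z p) (by fun_prop) (by fun_prop) (by fun_prop) ?_ ?_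
  · intro p q
    rw [hdist]
    rcases hσ with rfl | rfl <;> rcases hτ with rfl | rfl <;> rcases hρ with rfl | rfl <;> ring
  · intro p hp
    have a := abs_le.1 (h1 p hp)
    have b := abs_le.1 (h2 p hp)
    have c := abs_le.1 (h3 p hp)
    have d := abs_le.1 (h4 p hp)
    have e := hσX p hp
    have f := hτY p hp
    have g := hρZ p hp
    rcases hσ with rfl | rfl <;> rcases hτ with rfl | rfl <;> rcases hρ with rfl | rfl <;>
      constructor <;> linarith

/-- Support function of `F`. -/
noncomputable def supp (F : Set E3) (a b c : ℝ) : ℝ :=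
  sSup ((fun p : E3 => a * p 0 + b * p 1 + c * p 2) '' F)

theorem le_supp {F : Set E3} (hF : IsCompact F) (a b c : ℝ) {p : E3} (hp : p ∈ F) :
    a * p 0 + b * p 1 + c * p 2 ≤ supp F a b c := by
  apply le_csSup
  · exact (hF.image (by fun_prop)).bddAbove
  · exact ⟨p, hp, rfl⟩

theorem continuous_supp {F : Set E3} (hF : IsCompact F) {a b c : ℝ → ℝ} (ha : Continuous a)
    (hb : Continuous b) (hc : Continuous c) : Continuous fun t => supp F (a t) (b t) (c t) := by
  apply hF.continuous_sSup (f := fun t (p : E3) => a t * p 0 + b t * p 1 + c t * p 2)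
  simp only [Function.HasUncurry.uncurry, id]
  fun_prop

theorem dist_sq (p q : E3) :
    dist p q ^ 2 = (p 0 - q 0) ^ 2 + (p 1 - q 1) ^ 2 + (p 2 - q 2) ^ 2 := by
  rw [EuclideanSpace.dist_eq, Real.sq_sqrt (by positivity), Fin.sum_univ_three]
  simp [Real.dist_eq, sq_abs]

/-- The width in a direction of norm `√3`. -/
theorem width {F : Set E3} (hF : IsCompact F) (hne : F.Nonempty) {D : ℝ} (hD : 0 < D)
    (hle : ∀ p ∈ F, ∀ q ∈ F, dist p q ≤ D) (a b c : ℝ) (h : a ^ 2 + b ^ 2 + c ^ 2 = 3) :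
    supp F a b c + supp F (-a) (-b) (-c) ≤ 2 * 0.8661 * D := by
  have hc : ∀ a b c : ℝ, ContinuousOn (fun p : E3 => a * p 0 + b * p 1 + c * p 2) F := by
    intro a b c
    fun_prop
  obtain ⟨p, hp, e, -⟩ := hF.exists_sSup_image_eq_and_ge hne (hc a b c)
  obtain ⟨q, hq, f, -⟩ := hF.exists_sSup_image_eq_and_ge hne (hc (-a) (-b) (-c))
  rw [supp, supp, e, f]
  have k : dist p q ^ 2 ≤ D ^ 2 := pow_le_pow_left₀ dist_nonneg (hle p hp q hq) 2
  rw [dist_sq] at k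
  have : (a * (p 0 - q 0) + b * (p 1 - q 1) + c * (p 2 - q 2)) ^ 2 ≤ (2 * 0.8661 * D) ^ 2 := by
    have cs : (a * (p 0 - q 0) + b * (p 1 - q 1) + c * (p 2 - q 2)) ^ 2 ≤
        (a ^ 2 + b ^ 2 + c ^ 2) *
          ((p 0 - q 0) ^ 2 + (p 1 - q 1) ^ 2 + (p 2 - q 2) ^ 2) := by
      nlinarith [sq_nonneg (a * (p 1 - q 1) - b * (p 0 - q 0)),
        sq_nonneg (a * (p 2 - q 2) - c * (p 0 - q 0)),
        sq_nonneg (b * (p 2 - q 2) - c * (p 1 - q 1))]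
    rw [h] at cs
    nlinarith [sq_nonneg D]
  have := abs_le_of_sq_le_sq' this (by positivity)
  linarith [this.2]

/-- The rotating odd function. -/
noncomputable def mid (F : Set E3) (a b c : ℝ) : ℝ := (supp F a b c - supp F (-a) (-b) (-c)) / 2

theorem mid_neg (F : Set E3) (a b c : ℝ) : mid F (-a) (-b) (-c) = -mid F a b c := by
  simp only [mid, neg_neg]
  ring

theorem continuous_mid {F : Set E3} (hF : IsCompact F) {a b c : ℝ → ℝ} (ha : Continuous a)
    (hb : Continuous b) (hc : Continuous c) : Continuous fun t => mid F (a t) (b t) (c t) :=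
  ((continuous_supp hF ha hb hc).sub (continuous_supp hF ha.neg hb.neg hc.neg)).div_const 2

theorem abs_sub_mid {F : Set E3} (hF : IsCompact F) {D : ℝ} (hD : 0 < D)
    (hle : ∀ p ∈ F, ∀ q ∈ F, dist p q ≤ D) (a b c : ℝ) (h : a ^ 2 + b ^ 2 + c ^ 2 = 3)
    {p : E3} (hp : p ∈ F) :
    |(a * p 0 + b * p 1 + c * p 2 - mid F a b c) / D| ≤ 0.8661 := by
  have w := width hF ⟨p, hp⟩ hD hle a b c h
  have u := le_supp hF a b c hp
  have v := le_supp hF (-a) (-b) (-c) hp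
  rw [abs_div, abs_of_pos hD, div_le_iff₀ hD, abs_le, mid]
  constructor <;> linarith

/-- There is a rotation for which the four mid-planes meet in a point. -/
theorem exists_rotation {F : Set E3} (hF : IsCompact F) : ∃ c s : ℝ, c ^ 2 + s ^ 2 = 1 ∧
    mid F (c - s) (s + c) 1 + mid F (c + s) (s - c) (-1) + mid F (-c - s) (c - s) (-1) +
      mid F (-c + s) (-s - c) 1 = 0 := by
  let G : ℝ → ℝ := fun t =>
    mid F (Real.cos t - Real.sin t) (Real.sin t + Real.cos t) 1 +
    mid F (Real.cos t + Real.sin t) (Real.sin t - Real.cos t) (-1) +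
    mid F (-Real.cos t - Real.sin t) (Real.cos t - Real.sin t) (-1) +
    mid F (-Real.cos t + Real.sin t) (-Real.sin t - Real.cos t) 1
  have hG : Continuous G := by
    refine (((continuous_mid hF ?_ ?_ ?_).add (continuous_mid hF ?_ ?_ ?_)).add
      (continuous_mid hF ?_ ?_ ?_)).add (continuous_mid hF ?_ ?_ ?_) <;> fun_prop
  have hodd : G (Real.pi / 2) = -G 0 := by
    have e1 := mid_neg F 1 (-1) (-1)
    have e2 := mid_neg F (-1) (-1) 1
    have e3 := mid_neg F 1 1 1
    have e4 := mid_neg F (-1) 1 (-1)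
    simp only [neg_neg] at e1 e2 e3 e4
    simp only [G, Real.cos_pi_div_two, Real.sin_pi_div_two, Real.cos_zero, Real.sin_zero, zero_sub,
      zero_add, add_zero, sub_zero, neg_zero]
    rw [e1, e2, e3, e4]
    ring
  have hz : (0 : ℝ) ∈ Set.uIcc (G 0) (G (Real.pi / 2)) := by
    rw [hodd, Set.mem_uIcc]
    rcases le_total 0 (G 0) with h | h
    · right; constructor <;> linarith
    · left; constructor <;> linarith
  obtain ⟨t, -, ht⟩ := intermediate_value_uIcc hG.continuousOn hz
  exact ⟨Real.cos t, Real.sin t, by rw [add_comm]; exact Real.sin_sq_add_cos_sq t, ht⟩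

end BorsukThree

open BorsukThree in
/-- Borsuk's conjecture in dimension 3: every compact subset of Euclidean `ℝ³` of positive
diameter is the union of four closed sets of strictly smaller diameter. -/
theorem borsuk_dim_three
    (F : Set (EuclideanSpace ℝ (Fin 3))) (hF : IsCompact F) (hd : 0 < Metric.diam F) :
    ∃ A B C D : Set (EuclideanSpace ℝ (Fin 3)),
      IsClosed A ∧ IsClosed B ∧ IsClosed C ∧ IsClosed D ∧ F = A ∪ B ∪ C ∪ D ∧
      Metric.diam A < Metric.diam F ∧ Metric.diam B < Metric.diam F ∧
      Metric.diam C < Metric.diam F ∧ Metric.diam D < Metric.diam F := by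
  have hle : ∀ p ∈ F, ∀ q ∈ F, dist p q ≤ Metric.diam F := fun p hp q hq =>
    Metric.dist_le_diam_of_mem hF.isBounded hp hq
  generalize Metric.diam F = D at *
  obtain ⟨c, s, hcs, hm⟩ := exists_rotation hF
  have n1 : (c - s) ^ 2 + (s + c) ^ 2 + 1 ^ 2 = 3 := by linear_combination 2 * hcs
  have n2 : (c + s) ^ 2 + (s - c) ^ 2 + (-1) ^ 2 = 3 := by linear_combination 2 * hcs
  have n3 : (-c - s) ^ 2 + (c - s) ^ 2 + (-1) ^ 2 = 3 := by linear_combination 2 * hcs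
  have n4 : (-c + s) ^ 2 + (-s - c) ^ 2 + 1 ^ 2 = 3 := by linear_combination 2 * hcs
  have k1 := fun p (hp : p ∈ F) => abs_sub_mid hF hd hle _ _ _ n1 hp
  have k2 := fun p (hp : p ∈ F) => abs_sub_mid hF hd hle _ _ _ n2 hp
  have k3 := fun p (hp : p ∈ F) => abs_sub_mid hF hd hle _ _ _ n3 hp
  have k4 := fun p (hp : p ∈ F) => abs_sub_mid hF hd hle _ _ _ n4 hp
  generalize mid F (c - s) (s + c) 1 = m1 at *
  generalize mid F (c + s) (s - c) (-1) = m2 at *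
  generalize mid F (-c - s) (c - s) (-1) = m3 at *
  generalize mid F (-c + s) (-s - c) 1 = m4 at *
  obtain rfl : m4 = -m1 - m2 - m3 := by linarith
  refine split_of_octahedron hF.isClosed hd
    (X := fun p => (c * p 0 + s * p 1 - (m1 + m2) / 2) / D)
    (Y := fun p => (-s * p 0 + c * p 1 - (m1 + m3) / 2) / D)
    (Z := fun p => (p 2 - (-m2 - m3) / 2) / D)
    (by fun_prop) (by fun_prop) (by fun_prop) ?_ hle ?_ ?_ ?_ ?_
  · intro p q
    rw [dist_sq]
    field_simp
    linear_combination (-4 * (p 0 - q 0) ^ 2 - 4 * (p 1 - q 1) ^ 2) * hcs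
  · intro p hp
    convert k1 p hp using 2
    ring
  · intro p hp
    convert k2 p hp using 2
    ring
  · intro p hp
    convert k3 p hp using 2
    ring
  · intro p hp
    convert k4 p hp using 2
    ring
end
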